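/- arXiv:1705.00293 — 2 statements merged into one kernel-verified Lean document; each statement's English description precedes it below -/
import Mathlib

section
/- There exist 4-regular matchstick graphs with exactly 94, exactly 95, and exactly 96 vertices. -/
open scoped Classical

/-- A matchstick graph: a finite set of points in the Euclidean plane together with
a finite set of unit-length non-crossing straight edges between distinct points. -/
structure MatchstickGraph where
  V : Finset (EuclideanSpace ℝ (Fin 2))
  E : Finset (Sym2 (EuclideanSpace ℝ (Fin 2)))
  edge_mem : ∀ e ∈ E, ∀ u v : EuclideanSpace ℝ (Fin 2), e = s(u, v) → u ∈ V ∧ v ∈ V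
  edge_ne : ∀ e ∈ E, ¬ e.IsDiag
  edge_unit : ∀ e ∈ E, ∀ u v : EuclideanSpace ℝ (Fin 2), e = s(u, v) → dist u v = 1
  noncross : ∀ e₁ ∈ E, ∀ e₂ ∈ E, e₁ ≠ e₂ →
    ∀ u v x y : EuclideanSpace ℝ (Fin 2), e₁ = s(u, v) → e₂ = s(x, y) →
      segment ℝ u v ∩ segment ℝ x y ⊆ (({u, v} : Set (EuclideanSpace ℝ (Fin 2))) ∩ {x, y})

/-- The degree of a vertex: the number of edges containing it. -/
noncomputable def MatchstickGraph.degree (G : MatchstickGraph)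
    (v : EuclideanSpace ℝ (Fin 2)) : ℕ :=
  (G.E.filter (fun e => v ∈ e)).card

/-- A matchstick graph is 4-regular if every vertex has degree 4. -/
def MatchstickGraph.IsFourRegular (G : MatchstickGraph) : Prop :=
  ∀ v ∈ G.V, G.degree v = 4

/-- A matchstick graph is (2,4)-regular if every vertex has degree 2 or degree 4. -/
def MatchstickGraph.IsTwoFourRegular (G : MatchstickGraph) : Prop :=
  ∀ v ∈ G.V, G.degree v = 2 ∨ G.degree v = 4

/-! ### Fixed-point ball arithmetic in the complex plane -/

/-- A disc in the complex plane, with centre `(re, im)` and radius `rad` measured in units of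
`1 / prec`. -/
structure Ball where
  re : ℤ
  im : ℤ
  rad : ℤ

/-- The fixed-point denominator. -/
def prec : ℤ := 1000000000000

namespace Ball

/-- The rescaled centre of a ball. -/
noncomputable def center (A : Ball) : ℂ := ⟨A.re, A.im⟩

/-- Membership of a complex number in a ball. -/
def Contains (A : Ball) (z : ℂ) : Prop := ‖(prec : ℂ) * z - A.center‖ ≤ A.rad

/-- An upper bound for the norm of the rescaled centre. -/
def size (A : Ball) : ℤ := |A.re| + |A.im|

/-- A lower bound for the rescaled norm of the elements of a ball. -/
def lower (A : Ball) : ℤ := max |A.re| |A.im| - A.rad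

def neg (A : Ball) : Ball := ⟨-A.re, -A.im, A.rad⟩

def conj (A : Ball) : Ball := ⟨A.re, -A.im, A.rad⟩

def add (A B : Ball) : Ball := ⟨A.re + B.re, A.im + B.im, A.rad + B.rad⟩

def sub (A B : Ball) : Ball := A.add B.neg

def mul (A B : Ball) : Ball :=
  ⟨(A.re * B.re - A.im * B.im) / prec, (A.re * B.im + A.im * B.re) / prec,
    (A.size * B.rad + B.size * A.rad + A.rad * B.rad) / prec + 3⟩

/-- The ball `A` lies inside the ball `B`. -/
def within (A B : Ball) : Bool := decide ((A.sub B).size + A.rad ≤ B.rad)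

/-- The centre of a ball, as a ball of radius zero. -/
def point (A : Ball) : Ball := ⟨A.re, A.im, 0⟩

/-- A test ensuring that `C` contains all quotients of elements of `A` by elements of `B`. -/
def quotWithin (A B C : Ball) : Bool :=
  decide (0 < B.lower) &&
    decide (((A.sub (C.point.mul B)).size + (A.sub (C.point.mul B)).rad) * prec ≤ C.rad * B.lower)

/-- A test ensuring that `C` contains the square roots of all the real elements of `A`. -/
def sqrtWithin (A C : Ball) : Bool :=
  decide (0 < C.re) && decide (C.im = 0) && decide (A.rad ≤ A.re) &&
    decide (|prec * A.re - C.re * C.re| + prec * A.rad ≤ C.rad * C.re)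

lemma prec_pos : (0 : ℝ) < (prec : ℝ) := by norm_num [prec]

lemma norm_prec : ‖(prec : ℂ)‖ = (prec : ℝ) := by
  rw [Complex.norm_intCast, abs_of_pos prec_pos]

lemma norm_mk_le (x y : ℝ) : ‖(⟨x, y⟩ : ℂ)‖ ≤ |x| + |y| := Complex.norm_le_abs_re_add_abs_im _

lemma norm_center_le (A : Ball) : ‖A.center‖ ≤ A.size := by
  simpa [center, size] using norm_mk_le (A.re : ℝ) (A.im : ℝ)

lemma max_le_norm_center (A : Ball) : ((max |A.re| |A.im| : ℤ) : ℝ) ≤ ‖A.center‖ := by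
  push_cast
  exact max_le (by simpa [center] using Complex.abs_re_le_norm A.center)
    (by simpa [center] using Complex.abs_im_le_norm A.center)

lemma Contains.rad_nonneg {A : Ball} {z : ℂ} (h : A.Contains z) : (0 : ℝ) ≤ A.rad :=
  (norm_nonneg _).trans h

lemma Contains.norm_le {A : Ball} {z : ℂ} (h : A.Contains z) :
    (prec : ℝ) * ‖z‖ ≤ A.size + A.rad := by
  have h1 : (prec : ℂ) * z = A.center + ((prec : ℂ) * z - A.center) := by ring
  have h2 : (prec : ℝ) * ‖z‖ = ‖(prec : ℂ) * z‖ := by rw [norm_mul, norm_prec]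
  rw [h2, h1]
  exact (norm_add_le _ _).trans (add_le_add A.norm_center_le h)

lemma Contains.lower_le {A : Ball} {z : ℂ} (h : A.Contains z) :
    (A.lower : ℝ) ≤ (prec : ℝ) * ‖z‖ := by
  have h1 : A.center = (prec : ℂ) * z - ((prec : ℂ) * z - A.center) := by ring
  have h2 : ‖A.center‖ ≤ (prec : ℝ) * ‖z‖ + A.rad := by
    rw [h1, ← norm_prec, ← norm_mul]
    exact (norm_sub_le _ _).trans (by linarith [show ‖(prec : ℂ) * z - A.center‖ ≤ A.rad from h])
  have h3 := A.max_le_norm_center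
  unfold lower
  push_cast at h3 ⊢
  linarith

lemma Contains.ne_zero {A : Ball} {z : ℂ} (h : A.Contains z) (hA : 0 < A.lower) : z ≠ 0 := by
  rintro rfl
  have h1 := h.lower_le
  have h2 : (0 : ℝ) < A.lower := by exact_mod_cast hA
  simp at h1
  exact absurd h2 (not_lt.2 (by exact_mod_cast h1))

lemma Contains.neg {A : Ball} {z : ℂ} (h : A.Contains z) : A.neg.Contains (-z) := by
  have : (prec : ℂ) * -z - A.neg.center = -((prec : ℂ) * z - A.center) := by
    apply Complex.ext <;> simp [center, Ball.neg] <;> ring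
  unfold Contains
  rw [this, norm_neg]
  exact h

lemma Contains.conj {A : Ball} {z : ℂ} (h : A.Contains z) :
    A.conj.Contains (starRingEnd ℂ z) := by
  have : (prec : ℂ) * starRingEnd ℂ z - A.conj.center =
      starRingEnd ℂ ((prec : ℂ) * z - A.center) := by
    apply Complex.ext <;> simp [center, Ball.conj, sub_eq_add_neg, add_comm]
  unfold Contains
  rw [this, RCLike.norm_conj]
  exact h

lemma Contains.add {A B : Ball} {z w : ℂ} (hz : A.Contains z) (hw : B.Contains w) :
    (A.add B).Contains (z + w) := by
  have : (prec : ℂ) * (z + w) - (A.add B).center =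
      ((prec : ℂ) * z - A.center) + ((prec : ℂ) * w - B.center) := by
    apply Complex.ext <;> simp [center, Ball.add] <;> ring
  unfold Contains
  rw [this]
  exact (norm_add_le _ _).trans (by simpa [Ball.add] using add_le_add hz hw)

lemma Contains.sub {A B : Ball} {z w : ℂ} (hz : A.Contains z) (hw : B.Contains w) :
    (A.sub B).Contains (z - w) := by
  rw [sub_eq_add_neg]
  exact hz.add hw.neg

lemma contains_point (A : Ball) : A.point.Contains (A.center / prec) := by
  have : (prec : ℂ) ≠ 0 := by norm_num [prec]
  have h : (prec : ℂ) * (A.center / prec) - A.point.center = 0 := by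
    rw [mul_div_cancel₀ _ this]
    simp [center, point]
  unfold Contains
  rw [h]
  simp [point]

lemma abs_div_prec_sub_le (x : ℤ) : |(x : ℝ) / prec - ((x / prec : ℤ) : ℝ)| ≤ 1 := by
  have hp := prec_pos
  have h1 : (prec : ℝ) * ((x / prec : ℤ) : ℝ) ≤ x := by
    exact_mod_cast Int.mul_ediv_self_le (by norm_num [prec])
  have h2 : (x : ℝ) < prec * ((x / prec : ℤ) : ℝ) + prec := by
    exact_mod_cast Int.lt_mul_ediv_self_add (by norm_num [prec])
  rw [abs_le]
  constructor
  · rw [le_sub_iff_add_le, le_div_iff₀ hp]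
    nlinarith
  · rw [sub_le_iff_le_add, div_le_iff₀ hp]
    nlinarith

lemma Contains.mul {A B : Ball} {z w : ℂ} (hz : A.Contains z) (hw : B.Contains w) :
    (A.mul B).Contains (z * w) := by
  have hp := prec_pos
  have hp0 : (prec : ℂ) ≠ 0 := by norm_num [prec]
  set d := (prec : ℂ) * z - A.center with hd
  set e := (prec : ℂ) * w - B.center with he
  have hd' : ‖d‖ ≤ A.rad := hz
  have he' : ‖e‖ ≤ B.rad := hw
  have h1 : (prec : ℂ) * (z * w) - (A.mul B).center =
      (A.center * e + B.center * d + d * e) / prec +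
        (A.center * B.center / prec - (A.mul B).center) := by
    rw [hd, he]
    field_simp
    ring
  have h2 : A.center * B.center / prec - (A.mul B).center =
      ⟨((A.re * B.re - A.im * B.im : ℤ) : ℝ) / prec -
          (((A.re * B.re - A.im * B.im) / prec : ℤ) : ℝ),
        ((A.re * B.im + A.im * B.re : ℤ) : ℝ) / prec -
          (((A.re * B.im + A.im * B.re) / prec : ℤ) : ℝ)⟩ := by
    have : (prec : ℂ) = ((prec : ℝ) : ℂ) := by push_cast; rfl
    rw [this]
    apply Complex.ext
    · simp [center, Ball.mul]
    · simp [center, Ball.mul]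
  have h3 : ‖A.center * B.center / prec - (A.mul B).center‖ ≤ 2 := by
    rw [h2]
    refine (norm_mk_le _ _).trans ?_
    linarith [abs_div_prec_sub_le (A.re * B.re - A.im * B.im),
      abs_div_prec_sub_le (A.re * B.im + A.im * B.re)]
  have h4 : ‖A.center * e + B.center * d + d * e‖ ≤
      ((A.size * B.rad + B.size * A.rad + A.rad * B.rad : ℤ) : ℝ) := by
    push_cast
    refine (norm_add₃_le).trans ?_
    rw [norm_mul, norm_mul, norm_mul]
    have hA := A.norm_center_le
    have hB := B.norm_center_le
    have hA0 := (norm_nonneg _).trans hA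
    have hB0 := (norm_nonneg _).trans hB
    have hr := hz.rad_nonneg
    gcongr
  have h5 := (abs_le.1 (abs_div_prec_sub_le
    (A.size * B.rad + B.size * A.rad + A.rad * B.rad))).2
  unfold Contains
  rw [h1]
  refine (norm_add_le _ _).trans ?_
  rw [norm_div, norm_prec]
  have h6 := (div_le_div_iff_of_pos_right hp).2 h4
  have h7 : ((A.mul B).rad : ℝ) =
    (((A.size * B.rad + B.size * A.rad + A.rad * B.rad) / prec : ℤ) : ℝ) + 3 := by
    simp [Ball.mul]
  rw [h7]
  linarith

lemma Contains.mono {A B : Ball} {z : ℂ} (hz : A.Contains z) (h : A.within B = true) :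
    B.Contains z := by
  have h1 : (A.sub B).size + A.rad ≤ B.rad := by simpa [within] using h
  have h2 : (((A.sub B).size : ℤ) : ℝ) + A.rad ≤ B.rad := by exact_mod_cast h1
  have h3 := (A.sub B).norm_center_le
  have h4 : (prec : ℂ) * z - B.center = ((prec : ℂ) * z - A.center) + (A.sub B).center := by
    apply Complex.ext <;> simp [center, Ball.sub, Ball.add, Ball.neg]
      <;> ring
  unfold Contains
  rw [h4]
  exact (norm_add_le _ _).trans (by linarith [show ‖(prec : ℂ) * z - A.center‖ ≤ A.rad from hz])

lemma Contains.div {A B C : Ball} {z w : ℂ} (hz : A.Contains z) (hw : B.Contains w)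
    (h : quotWithin A B C = true) : C.Contains (z / w) := by
  have hp := prec_pos
  simp only [quotWithin, Bool.and_eq_true, decide_eq_true_eq] at h
  obtain ⟨hB, hC⟩ := h
  have hw0 := hw.ne_zero hB
  have hp0 : (prec : ℂ) ≠ 0 := by norm_num [prec]
  have hB' : (0 : ℝ) < B.lower := by exact_mod_cast hB
  have hC' : (((A.sub (C.point.mul B)).size : ℝ) + (A.sub (C.point.mul B)).rad) * prec ≤
    C.rad * B.lower := by exact_mod_cast hC
  have hlow := hw.lower_le
  have hD := (hz.sub (C.contains_point.mul hw)).norm_le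
  have key : (prec : ℂ) * (z / w) - C.center = prec * (z - C.center / prec * w) / w := by
    field_simp
  have hwpos : 0 < ‖w‖ := norm_pos_iff.2 hw0
  have hrad : (0 : ℝ) ≤ C.rad := by
    by_contra hneg
    have : (C.rad : ℝ) * B.lower < 0 := mul_neg_of_neg_of_pos (not_le.1 hneg) hB'
    have h0 : (0 : ℝ) ≤ (A.sub (C.point.mul B)).size + (A.sub (C.point.mul B)).rad :=
      le_trans (by positivity) hD
    nlinarith
  unfold Contains
  rw [key, norm_div, norm_mul, norm_prec, div_le_iff₀ hwpos]
  have h1 : (prec : ℝ) * (prec * ‖z - C.center / prec * w‖) ≤ C.rad * (prec * ‖w‖) := by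
    nlinarith [mul_le_mul_of_nonneg_left hlow hrad, mul_le_mul_of_nonneg_right hD hp.le]
  have h2 : (prec : ℝ) * (prec * ‖z - C.center / prec * w‖) ≤ prec * (C.rad * ‖w‖) := by
    linarith
  exact le_of_mul_le_mul_left h2 hp

lemma Contains.sqrt {A C : Ball} {x : ℝ} (hx : A.Contains (x : ℂ))
    (h : sqrtWithin A C = true) : 0 ≤ x ∧ C.Contains ((√x : ℝ) : ℂ) := by
  have hp := prec_pos
  simp only [sqrtWithin, Bool.and_eq_true, decide_eq_true_eq] at h
  obtain ⟨⟨⟨hC, hC0⟩, hA⟩, hrad⟩ := h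
  have hC' : (0 : ℝ) < C.re := by exact_mod_cast hC
  have hA' : (A.rad : ℝ) ≤ A.re := by exact_mod_cast hA
  have hrad' : |(prec : ℝ) * A.re - C.re * C.re| + prec * A.rad ≤ C.rad * C.re := by
    exact_mod_cast hrad
  have h1 : |(prec : ℝ) * x - A.re| ≤ A.rad := by
    refine le_trans ?_ hx
    simpa [center] using Complex.abs_re_le_norm ((prec : ℂ) * x - A.center)
  have hx0 : 0 ≤ x := by
    have := (abs_le.1 h1).1
    exact nonneg_of_mul_nonneg_right (by linarith : 0 ≤ (prec : ℝ) * x) hp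
  refine ⟨hx0, ?_⟩
  have h2 : (prec : ℂ) * ((√x : ℝ) : ℂ) - C.center = ((prec * √x - C.re : ℝ) : ℂ) := by
    apply Complex.ext <;> simp [center, hC0]
  unfold Contains
  rw [h2, Complex.norm_real, Real.norm_eq_abs]
  have hs := Real.sqrt_nonneg x
  have h3 : |(prec : ℝ) * √x - C.re| * (prec * √x + C.re) ≤ C.rad * C.re := by
    rw [← abs_of_nonneg (by positivity : (0 : ℝ) ≤ prec * √x + C.re), ← abs_mul]
    have : ((prec : ℝ) * √x - C.re) * (prec * √x + C.re) =
        (prec * A.re - C.re * C.re) + prec * (prec * x - A.re) := by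
      linear_combination (prec : ℝ) ^ 2 * Real.sq_sqrt hx0
    rw [this]
    refine (abs_add_le _ _).trans ?_
    rw [abs_mul (prec : ℝ), abs_of_pos hp]
    nlinarith
  have h4 : |(prec : ℝ) * √x - C.re| * C.re ≤ C.rad * C.re := by
    refine le_trans ?_ h3
    gcongr
    nlinarith
  exact le_of_mul_le_mul_right h4 hC'

end Ball

/-! ### Eisenstein integers and linear forms -/

/-- The primitive sixth root of unity `(1 + i √3) / 2`. -/
noncomputable def ω : ℂ := ⟨1 / 2, √3 / 2⟩

/-- The Eisenstein integer `a + b ω`. -/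
noncomputable def eis (c : ℤ × ℤ) : ℂ := c.1 + c.2 * ω

lemma ω_sq : ω * ω = ω - 1 := by
  have h : √3 * √3 = 3 := Real.mul_self_sqrt (by norm_num)
  apply Complex.ext
  · simp [ω]
    linarith
  · simp [ω]
    ring

lemma norm_ω : ‖ω‖ = 1 := by
  have h : √3 * √3 = 3 := Real.mul_self_sqrt (by norm_num)
  rw [Complex.norm_def, Complex.normSq_apply, Real.sqrt_eq_one]
  simp only [ω]
  linarith

/-- Multiplication of Eisenstein integers. -/
def eisMul (c d : ℤ × ℤ) : ℤ × ℤ :=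
  (c.1 * d.1 - c.2 * d.2, c.1 * d.2 + c.2 * d.1 + c.2 * d.2)

lemma eis_eisMul (c d : ℤ × ℤ) : eis (eisMul c d) = eis c * eis d := by
  simp only [eis, eisMul]
  push_cast
  linear_combination (-(c.2 * d.2 : ℂ)) * ω_sq

lemma eis_sub (c d : ℤ × ℤ) : eis (c - d) = eis c - eis d := by
  simp only [eis, Prod.fst_sub, Prod.snd_sub]
  push_cast
  ring

lemma eis_neg (c : ℤ × ℤ) : eis (-c) = -eis c := by
  simp only [eis, Prod.fst_neg, Prod.snd_neg]
  push_cast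
  ring

/-- The units of the Eisenstein integers. -/
def eisUnits : List (ℤ × ℤ) := [(1, 0), (0, 1), (-1, 1), (-1, 0), (0, -1), (1, -1)]

lemma norm_eis_of_mem_eisUnits {c : ℤ × ℤ} (hc : c ∈ eisUnits) : ‖eis c‖ = 1 := by
  have h : ω - 1 = ω * ω := ω_sq.symm
  simp only [eisUnits, List.mem_cons, List.not_mem_nil, or_false] at hc
  rcases hc with rfl | rfl | rfl | rfl | rfl | rfl
  · simp [eis]
  · simp [eis, norm_ω]
  · have : eis (-1, 1) = ω * ω := by
      rw [ω_sq]
      simp [eis]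
      ring
    rw [this, norm_mul, norm_ω, one_mul]
  · simp [eis]
  · simp [eis, norm_ω]
  · have : eis (1, -1) = -(ω * ω) := by
      rw [ω_sq]
      simp [eis]
      ring
    rw [this, norm_neg, norm_mul, norm_ω, one_mul]

/-- Evaluation of a linear form with Eisenstein coefficients. -/
noncomputable def evalForm : List (ℤ × ℤ) → List ℂ → ℂ
  | c :: f, u :: U => eis c * u + evalForm f U
  | _, _ => 0

/-- Subtraction of linear forms. -/
def subForm : List (ℤ × ℤ) → List (ℤ × ℤ) → List (ℤ × ℤ)
  | c :: f, d :: g => (c - d) :: subForm f g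
  | f, [] => f
  | [], g => g.map (-·)

lemma evalForm_map_neg (f : List (ℤ × ℤ)) (U : List ℂ) :
    evalForm (f.map (-·)) U = -evalForm f U := by
  induction f generalizing U with
  | nil => simp [evalForm]
  | cons c f ih =>
    cases U with
    | nil => simp [evalForm]
    | cons u U =>
      simp only [List.map_cons, evalForm, ih, eis_neg]
      ring

lemma evalForm_subForm (f g : List (ℤ × ℤ)) (U : List ℂ) :
    evalForm (subForm f g) U = evalForm f U - evalForm g U := by
  induction f generalizing g U with
  | nil =>
    cases g with
    | nil => simp [subForm, evalForm]
    | cons d g => simp [subForm, evalForm_map_neg, evalForm, -List.map_cons]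
  | cons c f ih =>
    cases g with
    | nil => simp [subForm, evalForm]
    | cons d g =>
      cases U with
      | nil => simp [evalForm]
      | cons u U =>
        simp only [subForm, evalForm, ih, eis_sub]
        ring

lemma evalForm_map_eisMul (c : ℤ × ℤ) (f : List (ℤ × ℤ)) (U : List ℂ) :
    evalForm (f.map (eisMul c)) U = eis c * evalForm f U := by
  induction f generalizing U with
  | nil => simp [evalForm]
  | cons d f ih =>
    cases U with
    | nil => simp [evalForm]
    | cons u U =>
      simp only [List.map_cons, evalForm, ih, eis_eisMul]
      ring

lemma evalForm_map_zero (f : List (ℤ × ℤ)) (U : List ℂ) :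
    evalForm (f.map fun _ => (0, 0)) U = 0 := by
  induction f generalizing U with
  | nil => simp [evalForm]
  | cons d f ih =>
    cases U with
    | nil => simp [evalForm]
    | cons u U =>
      rw [List.map_cons, evalForm, ih]
      simp [eis]

/-- A ball around an Eisenstein integer. -/
def eisBall (c : ℤ × ℤ) : Ball :=
  ⟨c.1 * prec + c.2 * 500000000000, c.2 * 866025403784, |c.2|⟩

lemma contains_eisBall (c : ℤ × ℤ) : (eisBall c).Contains (eis c) := by
  have h : (prec : ℂ) * eis c - (eisBall c).center =
      ((c.2 * (prec * (√3 / 2) - 866025403784) : ℝ) : ℂ) * Complex.I := by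
    apply Complex.ext
    · simp [Ball.center, eisBall, eis, ω, prec]
      ring
    · simp [Ball.center, eisBall, eis, ω, prec]
      ring
  have h1 : (1.732050807568 : ℝ) ≤ √3 := Real.le_sqrt_of_sq_le (by norm_num)
  have h2 : √3 ≤ (1.732050807570 : ℝ) := (Real.sqrt_le_left (by norm_num)).2 (by norm_num)
  unfold Ball.Contains
  rw [h, norm_mul, Complex.norm_I, mul_one, Complex.norm_real, Real.norm_eq_abs, abs_mul]
  have h3 : |(prec : ℝ) * (√3 / 2) - 866025403784| ≤ 1 := by
    rw [abs_le]
    norm_num [prec]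
    constructor <;> linarith
  simpa [eisBall] using mul_le_mul_of_nonneg_left h3 (abs_nonneg (c.2 : ℝ))

/-- Evaluation of a linear form in ball arithmetic. -/
def evalBall : List (ℤ × ℤ) → List Ball → Ball
  | c :: f, B :: L => ((eisBall c).mul B).add (evalBall f L)
  | _, _ => ⟨0, 0, 0⟩

lemma contains_evalBall (f : List (ℤ × ℤ)) {L : List Ball} {U : List ℂ}
    (h : List.Forall₂ Ball.Contains L U) : (evalBall f L).Contains (evalForm f U) := by
  induction h generalizing f with
  | nil => cases f <;> simp [evalBall, evalForm, Ball.Contains, Ball.center, Complex.norm_def]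
  | cons hB _ ih =>
    cases f with
    | nil => simp [evalBall, evalForm, Ball.Contains, Ball.center, Complex.norm_def]
    | cons c f => exact ((contains_eisBall c).mul hB).add (ih f)

/-! ### Solving for unit vectors -/

/-- The ball of radius zero around an integer. -/
def intBall (k : ℤ) : Ball := ⟨k * prec, 0, 0⟩

lemma contains_intBall (k : ℤ) : (intBall k).Contains k := by
  have : (prec : ℂ) * k - (intBall k).center = 0 := by
    apply Complex.ext <;> simp [intBall, Ball.center, mul_comm]
  unfold Ball.Contains
  rw [this]
  simp [intBall]

lemma contains_intBall_one : (intBall 1).Contains 1 := by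
  simpa using contains_intBall 1

lemma contains_intBall_neg_one : (intBall (-1)).Contains (-1) := by
  simpa using contains_intBall (-1)

/-- The ball of radius zero around the imaginary unit. -/
def imagBall : Ball := ⟨0, prec, 0⟩

lemma contains_imagBall : imagBall.Contains Complex.I := by
  have : (prec : ℂ) * Complex.I - imagBall.center = 0 := by
    apply Complex.ext <;> simp [imagBall, Ball.center]
  unfold Ball.Contains
  rw [this]
  simp [imagBall]

/-- A ball containing the squared norm. -/
def Ball.normSq (A : Ball) : Ball := A.mul A.conj

lemma Ball.Contains.normSq {A : Ball} {z : ℂ} (h : A.Contains z) :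
    A.normSq.Contains ((Complex.normSq z : ℝ) : ℂ) := by
  rw [← Complex.mul_conj]
  exact h.mul h.conj

/-- Twice the inner product of `α u` and `γ`, when `‖α u + γ‖ = ‖β‖` and `u` is a unit vector. -/
def crossBall (A B C : Ball) : Ball := (B.normSq.sub A.normSq).sub C.normSq

/-- A test ensuring that the ball `D` contains one of the unit solutions `u` of
`‖α u + γ‖ = ‖β‖`. The ball `S` contains twice the area form of `α u` and `γ`, whose sign is
chosen by `s`. -/
def solveCheck (A B C : Ball) (s : Bool) (S D : Ball) : Bool :=
  Ball.sqrtWithin (((intBall 4).mul (A.normSq.mul C.normSq)).sub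
    ((crossBall A B C).mul (crossBall A B C))) S &&
  Ball.quotWithin ((crossBall A B C).add (imagBall.mul (bif s then S else S.neg)))
    ((intBall 2).mul (A.mul C.conj)) D

lemma exists_unit_of_solveCheck {A B C S D : Ball} {s : Bool} {α β γ : ℂ} (hα : A.Contains α)
    (hβ : B.Contains β) (hγ : C.Contains γ) (h : solveCheck A B C s S D = true) :
    ∃ u : ℂ, ‖u‖ = 1 ∧ ‖α * u + γ‖ = ‖β‖ ∧ D.Contains u := by
  simp only [solveCheck, Bool.and_eq_true] at h
  obtain ⟨h1, h2⟩ := h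
  set a := Complex.normSq α
  set b := Complex.normSq β
  set c := Complex.normSq γ
  have hX : (crossBall A B C).Contains ((b - a - c : ℝ) : ℂ) := by
    push_cast
    exact (hβ.normSq.sub hα.normSq).sub hγ.normSq
  have hM : (((intBall 4).mul (A.normSq.mul C.normSq)).sub
      ((crossBall A B C).mul (crossBall A B C))).Contains
      ((4 * (a * c) - (b - a - c) * (b - a - c) : ℝ) : ℂ) := by
    have := ((contains_intBall 4).mul (hα.normSq.mul hγ.normSq)).sub (hX.mul hX)
    push_cast at this ⊢
    exact this
  obtain ⟨h0, hS⟩ := hM.sqrt h1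
  set Y := √(4 * (a * c) - (b - a - c) * (b - a - c)) with hY
  have hYY : Y * Y = 4 * (a * c) - (b - a - c) * (b - a - c) := Real.mul_self_sqrt h0
  obtain ⟨t, ht, htY⟩ : ∃ t : ℝ, t * t = Y * Y ∧ (bif s then S else S.neg).Contains (t : ℂ) := by
    cases s with
    | true => exact ⟨Y, rfl, hS⟩
    | false => exact ⟨-Y, by ring, by simpa using hS.neg⟩
  have hden := (contains_intBall 2).mul (hα.mul hγ.conj)
  have hne := hden.ne_zero (by
    simp only [Ball.quotWithin, Bool.and_eq_true, decide_eq_true_eq] at h2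
    exact h2.1)
  have hD := (hX.add (contains_imagBall.mul htY)).div hden h2
  set u := (((b - a - c : ℝ) : ℂ) + Complex.I * (t : ℂ)) /
    (((2 : ℤ) : ℂ) * (α * starRingEnd ℂ γ)) with hu
  have hα0 : α ≠ 0 := by
    rintro rfl
    simp at hne
  have hγ0 : γ ≠ 0 := by
    rintro rfl
    simp at hne
  have hac : a * c ≠ 0 := mul_ne_zero (by simpa [a] using hα0) (by simpa [c] using hγ0)
  have hnu : Complex.normSq u = 1 := by
    rw [hu, Complex.normSq_div, Complex.normSq_mul, Complex.normSq_mul, Complex.normSq_conj,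
      mul_comm Complex.I, Complex.normSq_add_mul_I]
    have : Complex.normSq ((2 : ℤ) : ℂ) = 4 := by
      rw [Complex.normSq_apply]
      norm_num
    rw [this, div_eq_one_iff_eq (mul_ne_zero four_ne_zero hac)]
    linarith
  refine ⟨u, ?_, ?_, hD⟩
  · rw [Complex.norm_def, hnu, Real.sqrt_one]
  · have h3 : (α * u * starRingEnd ℂ γ).re = (b - a - c) / 2 := by
      have : α * u * starRingEnd ℂ γ =
          (((b - a - c : ℝ) : ℂ) + Complex.I * (t : ℂ)) / ((2 : ℝ) : ℂ) := by
        have hγ' : starRingEnd ℂ γ ≠ 0 := by simpa using hγ0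
        rw [hu]
        push_cast
        field_simp
      rw [this, Complex.div_ofReal_re]
      simp
    rw [Complex.norm_def, Complex.norm_def, Complex.normSq_add, h3, Complex.normSq_mul, hnu]
    congr 1
    change a * 1 + c + 2 * ((b - a - c) / 2) = b
    ring

/-! ### Frameworks built from unit vectors -/

/-- One step in the construction of a list of unit vectors: the new vector `u` makes
`eis lead * u + evalForm tail U` a unit vector. -/
structure Stage where
  lead : ℤ × ℤ
  tail : List (ℤ × ℤ)
  sign : Bool
  root : Ball
  dir : Ball

/-- The linear forms that are unit vectors after a stage. -/
def Stage.extend (S : Stage) (F : List (List (ℤ × ℤ))) : List (List (ℤ × ℤ)) :=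
  (S.lead :: S.tail) :: ((1, 0) :: S.tail.map fun _ => (0, 0)) :: F.map ((0, 0) :: ·)

/-- The numerical test of a stage. -/
def Stage.check (S : Stage) (L : List Ball) : Bool :=
  solveCheck (eisBall S.lead) (intBall 1) (evalBall S.tail L) S.sign S.root S.dir

/-- All numerical tests of a sequence of stages. -/
def stagesCheck : List Stage → List Ball → Bool
  | [], _ => true
  | S :: l, L => S.check L && stagesCheck l (S.dir :: L)

/-- The balls containing the unit vectors after a sequence of stages. -/
def stagesDirs : List Stage → List Ball → List Ball
  | [], L => L
  | S :: l, L => stagesDirs l (S.dir :: L)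

/-- The unit linear forms after a sequence of stages. -/
def stagesForms : List Stage → List (List (ℤ × ℤ)) → List (List (ℤ × ℤ))
  | [], F => F
  | S :: l, F => stagesForms l (S.extend F)

lemma exists_of_stagesCheck (l : List Stage) {L : List Ball} {U : List ℂ}
    {F : List (List (ℤ × ℤ))} (hL : List.Forall₂ Ball.Contains L U)
    (hF : ∀ f ∈ F, ‖evalForm f U‖ = 1) (h : stagesCheck l L = true) :
    ∃ U' : List ℂ, List.Forall₂ Ball.Contains (stagesDirs l L) U' ∧
      ∀ f ∈ stagesForms l F, ‖evalForm f U'‖ = 1 := by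
  induction l generalizing L U F with
  | nil => exact ⟨U, hL, hF⟩
  | cons S l ih =>
    simp only [stagesCheck, Bool.and_eq_true] at h
    obtain ⟨u, hu, hS, hD⟩ := exists_unit_of_solveCheck (contains_eisBall S.lead)
      (contains_intBall 1) (contains_evalBall S.tail hL) h.1
    refine ih (List.Forall₂.cons hD hL) ?_ h.2
    intro f hf
    simp only [Stage.extend, List.mem_cons, List.mem_map] at hf
    rcases hf with rfl | rfl | ⟨g, hg, rfl⟩
    · simpa [evalForm] using hS
    · rw [evalForm, evalForm_map_zero]
      simpa [eis] using hu
    · rw [evalForm]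
      simpa [eis] using hF g hg

/-- A planar framework whose vertices are linear forms in unit vectors. Two vertices `axis₁`,
`axis₂` and a vertex `tip` are singled out. -/
structure Piece where
  stages : List Stage
  pts : List (List (ℤ × ℤ))
  edges : List (ℕ × ℕ)
  axis₁ : ℕ
  axis₂ : ℕ
  tip : ℕ

namespace Piece

/-- Balls containing the unit vectors of a piece. -/
def dirs (Q : Piece) : List Ball := stagesDirs Q.stages [intBall 1]

/-- The linear form describing a vertex. -/
def form (Q : Piece) (i : ℕ) : List (ℤ × ℤ) := Q.pts.getD i []

/-- A test ensuring that the edges of a piece are unit vectors. -/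
def edgeCheck (Q : Piece) : Bool :=
  Q.edges.all fun e => (stagesForms Q.stages [[(1, 0)]]).any fun f =>
    eisUnits.any fun c => decide (subForm (Q.form e.1) (Q.form e.2) = f.map (eisMul c))

/-- The list of unit vectors `U` realizes the piece. -/
def Realizes (Q : Piece) (U : List ℂ) : Prop :=
  List.Forall₂ Ball.Contains Q.dirs U ∧
    ∀ e ∈ Q.edges, ‖evalForm (Q.form e.1) U - evalForm (Q.form e.2) U‖ = 1

lemma exists_realizes {Q : Piece} (h₁ : stagesCheck Q.stages [intBall 1] = true)
    (h₂ : Q.edgeCheck = true) : ∃ U, Q.Realizes U := by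
  obtain ⟨U, hU, hF⟩ := exists_of_stagesCheck Q.stages (L := [intBall 1]) (U := [1])
    (F := [[(1, 0)]]) (List.Forall₂.cons contains_intBall_one List.Forall₂.nil)
    (by simp [evalForm, eis]) h₁
  refine ⟨U, hU, fun e he => ?_⟩
  have h3 := List.all_eq_true.1 h₂ e he
  simp only [List.any_eq_true, decide_eq_true_eq] at h3
  obtain ⟨f, hf, c, hc, hfc⟩ := h3
  rw [← evalForm_subForm, hfc, evalForm_map_eisMul, norm_mul, norm_eis_of_mem_eisUnits hc,
    hF f hf, one_mul]

end Piece

/-! ### Matchstick graphs from approximate coordinates -/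

/-- The point of the Euclidean plane with a given complex coordinate. -/
def toPlane (z : ℂ) : EuclideanSpace ℝ (Fin 2) := !₂[z.re, z.im]

lemma dist_toPlane (z w : ℂ) : dist (toPlane z) (toPlane w) = ‖z - w‖ := by
  rw [EuclideanSpace.dist_eq, Complex.norm_def, Complex.normSq_apply]
  simp [toPlane, Real.dist_eq, sq_abs, ← sq]

lemma toPlane_injective : Function.Injective toPlane := by
  intro z w h
  rw [← sub_eq_zero, ← norm_eq_zero, ← dist_toPlane, h, dist_self]

/-- Two unit segments with a common endpoint and distinct other endpoints meet only there. -/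
lemma eq_of_mem_segment_of_dist_eq_one {A B C p : EuclideanSpace ℝ (Fin 2)} (hB : dist A B = 1)
    (hC : dist A C = 1) (hBC : B ≠ C) (h₁ : p ∈ segment ℝ A B) (h₂ : p ∈ segment ℝ A C) :
    p = A := by
  rw [segment_eq_image_lineMap] at h₁ h₂
  obtain ⟨s, hs, rfl⟩ := h₁
  obtain ⟨t, ht, hst⟩ := h₂
  have h3 : dist (AffineMap.lineMap A C t) A = dist (AffineMap.lineMap A B s) A := by rw [hst]
  rw [dist_lineMap_left, dist_lineMap_left, hB, hC, mul_one, mul_one, Real.norm_of_nonneg hs.1,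
    Real.norm_of_nonneg ht.1] at h3
  subst h3
  rcases eq_or_ne t 0 with rfl | h0
  · simp
  · exfalso
    apply hBC
    simp only [AffineMap.lineMap_apply, vsub_eq_sub, vadd_eq_add, add_left_inj] at hst
    have := smul_right_injective _ h0 hst
    exact (sub_left_injective this).symm

/-- The value of an integral linear functional at an integral point. -/
def functional (l p : ℤ × ℤ) : ℤ := l.1 * p.1 + l.2 * p.2

/-- A test ensuring that the functional `l` separates the segments `ab` and `cd`, when the
coordinates of the endpoints are known up to an error `1`. -/
def separates (l a b c d : ℤ × ℤ) : Bool :=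
  decide (max (functional l a) (functional l b) + 2 * (|l.1| + |l.2|) <
    min (functional l c) (functional l d))

/-- A direction orthogonal to `ab`. -/
def normal (a b : ℤ × ℤ) : ℤ × ℤ := (a.2 - b.2, b.1 - a.1)

/-- A test ensuring that two approximately known segments are disjoint. -/
def apart (a b c d : ℤ × ℤ) : Bool :=
  separates (1, 0) a b c d || separates (1, 0) c d a b ||
  separates (0, 1) a b c d || separates (0, 1) c d a b ||
  separates (normal a b) a b c d || separates (normal a b) c d a b ||
  separates (normal c d) a b c d || separates (normal c d) c d a b

/-- The integral point `a` approximates `z` in units of `1 / 10000`. -/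
def Approximates (a : ℤ × ℤ) (z : ℂ) : Prop :=
  |10000 * z.re - a.1| ≤ 1 ∧ |10000 * z.im - a.2| ≤ 1

lemma Approximates.abs_functional_sub_le {a : ℤ × ℤ} {z : ℂ} (h : Approximates a z)
    (l : ℤ × ℤ) :
    |10000 * (l.1 * z.re + l.2 * z.im) - functional l a| ≤ |(l.1 : ℝ)| + |(l.2 : ℝ)| := by
  have h1 : 10000 * (l.1 * z.re + l.2 * z.im) - functional l a =
      l.1 * (10000 * z.re - a.1) + l.2 * (10000 * z.im - a.2) := by
    simp only [functional]
    push_cast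
    ring
  rw [h1]
  refine (abs_add_le _ _).trans ?_
  rw [abs_mul, abs_mul]
  nlinarith [abs_nonneg (l.1 : ℝ), abs_nonneg (l.2 : ℝ), h.1, h.2]

lemma functional_mem_segment {z w : ℂ} {p : EuclideanSpace ℝ (Fin 2)} (l : ℤ × ℤ)
    (hp : p ∈ segment ℝ (toPlane z) (toPlane w)) :
    l.1 * p 0 + l.2 * p 1 ∈ Set.uIcc (l.1 * z.re + l.2 * z.im) (l.1 * w.re + l.2 * w.im) := by
  obtain ⟨a, b, ha, hb, hab, rfl⟩ := hp
  rw [← segment_eq_uIcc]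
  refine ⟨a, b, ha, hb, hab, ?_⟩
  simp [toPlane]
  ring

lemma disjoint_of_separates {l a b c d : ℤ × ℤ} {za zb zc zd : ℂ} (ha : Approximates a za)
    (hb : Approximates b zb) (hc : Approximates c zc) (hd : Approximates d zd)
    (h : separates l a b c d = true) :
    Disjoint (segment ℝ (toPlane za) (toPlane zb)) (segment ℝ (toPlane zc) (toPlane zd)) := by
  rw [Set.disjoint_left]
  intro p h1 h2
  have h3 := (functional_mem_segment l h1).2
  have h4 := (functional_mem_segment l h2).1
  have h5 : max (functional l a) (functional l b) + 2 * (|l.1| + |l.2|) <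
    min (functional l c) (functional l d) := by simpa [separates] using h
  have h6 : max (functional l a : ℝ) (functional l b) + 2 * (|(l.1 : ℝ)| + |(l.2 : ℝ)|) <
    min (functional l c : ℝ) (functional l d) := by exact_mod_cast h5
  have ea := (abs_le.1 (ha.abs_functional_sub_le l)).2
  have eb := (abs_le.1 (hb.abs_functional_sub_le l)).2
  have ec := (abs_le.1 (hc.abs_functional_sub_le l)).1
  have ed := (abs_le.1 (hd.abs_functional_sub_le l)).1
  have m1 := le_max_left (functional l a : ℝ) (functional l b)
  have m2 := le_max_right (functional l a : ℝ) (functional l b)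
  have m3 := min_le_left (functional l c : ℝ) (functional l d)
  have m4 := min_le_right (functional l c : ℝ) (functional l d)
  rcases le_max_iff.1 h3 with h3 | h3 <;> rcases min_le_iff.1 h4 with h4 | h4 <;> linarith

lemma disjoint_of_apart {a b c d : ℤ × ℤ} {za zb zc zd : ℂ} (ha : Approximates a za)
    (hb : Approximates b zb) (hc : Approximates c zc) (hd : Approximates d zd)
    (h : apart a b c d = true) :
    Disjoint (segment ℝ (toPlane za) (toPlane zb)) (segment ℝ (toPlane zc) (toPlane zd)) := by
  simp only [apart, Bool.or_eq_true] at h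
  rcases h with ((((((h | h) | h) | h) | h) | h) | h) | h
  exacts [disjoint_of_separates ha hb hc hd h, (disjoint_of_separates hc hd ha hb h).symm,
    disjoint_of_separates ha hb hc hd h, (disjoint_of_separates hc hd ha hb h).symm,
    disjoint_of_separates ha hb hc hd h, (disjoint_of_separates hc hd ha hb h).symm,
    disjoint_of_separates ha hb hc hd h, (disjoint_of_separates hc hd ha hb h).symm]

/-- A test ensuring that two edges with approximately known endpoints do not cross. -/
def compatible (T : ℕ → ℤ × ℤ) (e f : ℕ × ℕ) : Bool :=
  if e.1 = f.1 then decide (e.2 ≠ f.2) else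
  if e.1 = f.2 then decide (e.2 ≠ f.1) else
  if e.2 = f.1 then true else
  if e.2 = f.2 then true else apart (T e.1) (T e.2) (T f.1) (T f.2)

/-- A test on all pairs of members of a list, in order. -/
def allPairs {α : Type*} (r : α → α → Bool) : List α → Bool
  | [] => true
  | a :: l => l.all (r a) && allPairs r l

lemma pairwise_of_allPairs {α : Type*} {r : α → α → Bool} {l : List α}
    (h : allPairs r l = true) : l.Pairwise (fun a b => r a b = true) := by
  induction l with
  | nil => exact List.Pairwise.nil
  | cons a l ih =>
    simp only [allPairs, Bool.and_eq_true, List.all_eq_true] at h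
    exact List.Pairwise.cons h.1 (ih h.2)

/-- The test on approximate coordinates `T` and edges `E` that certifies a 4-regular
matchstick graph with `n` vertices. -/
def graphCheck (n : ℕ) (T : List (ℤ × ℤ)) (E : List (ℕ × ℕ)) : Bool :=
  allPairs (fun i j => apart (T.getD i 0) (T.getD i 0) (T.getD j 0) (T.getD j 0))
    (List.range n) &&
  E.all (fun e => decide (e.1 < n) && decide (e.2 < n) && decide (e.1 ≠ e.2)) &&
  allPairs (compatible (fun i => T.getD i 0)) E &&
  (List.range n).all
    (fun i => decide (E.countP (fun e => decide (e.1 = i) || decide (e.2 = i)) = 4))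

lemma inter_segment_subset {P : ℕ → ℂ} {T : ℕ → ℤ × ℤ} {e f : ℕ × ℕ}
    (hT : ∀ i ∈ ({e.1, e.2, f.1, f.2} : Set ℕ), Approximates (T i) (P i))
    (he : ‖P e.1 - P e.2‖ = 1) (hf : ‖P f.1 - P f.2‖ = 1)
    (hP : Set.InjOn P {e.1, e.2, f.1, f.2}) (h : compatible T e f = true) :
    segment ℝ (toPlane (P e.1)) (toPlane (P e.2)) ∩ segment ℝ (toPlane (P f.1)) (toPlane (P f.2)) ⊆
      {toPlane (P e.1), toPlane (P e.2)} ∩ {toPlane (P f.1), toPlane (P f.2)} := by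
  obtain ⟨a, b⟩ := e
  obtain ⟨c, d⟩ := f
  rw [← dist_toPlane] at he hf
  have hne : ∀ i ∈ ({a, b, c, d} : Set ℕ), ∀ j ∈ ({a, b, c, d} : Set ℕ), i ≠ j →
    toPlane (P i) ≠ toPlane (P j) := fun i hi j hj hij h => hij (hP hi hj (toPlane_injective h))
  rintro p ⟨h1, h2⟩
  simp only [compatible] at h
  simp only at he hf h1 h2
  split_ifs at h with k1 k2 k3 k4
  · subst k1
    have := eq_of_mem_segment_of_dist_eq_one he hf
      (hne _ (by simp) _ (by simp) (by simpa using h)) h1 h2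
    simp [this]
  · subst k2
    rw [dist_comm] at hf
    rw [segment_symm] at h2
    have := eq_of_mem_segment_of_dist_eq_one he hf
      (hne _ (by simp) _ (by simp) (by simpa using h)) h1 h2
    simp [this]
  · subst k3
    rw [dist_comm] at he
    rw [segment_symm] at h1
    have := eq_of_mem_segment_of_dist_eq_one he hf (hne _ (by simp) _ (by simp) k2) h1 h2
    simp [this]
  · subst k4
    rw [dist_comm] at he hf
    rw [segment_symm] at h1 h2
    have := eq_of_mem_segment_of_dist_eq_one he hf (hne _ (by simp) _ (by simp) k1) h1 h2
    simp [this]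
  · exact ((Set.disjoint_left.1 (disjoint_of_apart (hT _ (by simp)) (hT _ (by simp))
      (hT _ (by simp)) (hT _ (by simp)) h)) h1 h2).elim

lemma ne_of_compatible {T : ℕ → ℤ × ℤ} {e f : ℕ × ℕ}
    (h : compatible T e f = true) : s(e.1, e.2) ≠ s(f.1, f.2) := by
  obtain ⟨a, b⟩ := e
  obtain ⟨c, d⟩ := f
  simp only [compatible] at h
  simp only [ne_eq, Sym2.eq_iff, not_or, not_and]
  split_ifs at h with k1 k2 k3 k4
  all_goals simp_all

lemma exists_graph_of_graphCheck {n : ℕ} {T : List (ℤ × ℤ)} {E : List (ℕ × ℕ)} {P : ℕ → ℂ}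
    (hT : ∀ i < n, Approximates (T.getD i 0) (P i)) (hE : ∀ e ∈ E, ‖P e.1 - P e.2‖ = 1)
    (h : graphCheck n T E = true) :
    ∃ G : MatchstickGraph, G.IsFourRegular ∧ G.V.card = n := by
  simp only [graphCheck, Bool.and_eq_true] at h
  obtain ⟨⟨⟨h1, h2⟩, h3⟩, h4⟩ := h
  replace h1 := pairwise_of_allPairs h1
  replace h3 := pairwise_of_allPairs h3
  have hlt : ∀ i < n, ∀ j < n, i < j → toPlane (P i) ≠ toPlane (P j) := by
    intro i hi j hj hij heq
    have h5 := List.pairwise_iff_getElem.1 h1 i j (by simpa) (by simpa) hij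
    simp only [List.getElem_range] at h5
    refine (Set.disjoint_left.1
      (disjoint_of_apart (hT i hi) (hT i hi) (hT j hj) (hT j hj) h5)) (left_mem_segment _ _ _) ?_
    rw [heq]
    exact left_mem_segment _ _ _
  have hinj : Set.InjOn (fun i => toPlane (P i)) (Set.Iio n) := by
    intro i hi j hj heq
    rcases lt_trichotomy i j with hij | hij | hij
    · exact (hlt i hi j hj hij heq).elim
    · exact hij
    · exact (hlt j hj i hi hij heq.symm).elim
  have hmem : ∀ e ∈ E, e.1 < n ∧ e.2 < n ∧ e.1 ≠ e.2 := by
    intro e he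
    simpa [and_assoc] using List.all_eq_true.1 h2 e he
  set edge : ℕ × ℕ → Sym2 (EuclideanSpace ℝ (Fin 2)) :=
    fun e => s(toPlane (P e.1), toPlane (P e.2)) with hedge
  have hnodup : (E.map edge).Nodup := by
    refine List.pairwise_map.2 (h3.imp_of_mem ?_)
    intro e f he hf hef heq
    obtain ⟨he1, he2, -⟩ := hmem e he
    obtain ⟨hf1, hf2, -⟩ := hmem f hf
    apply ne_of_compatible hef
    rw [Sym2.eq_iff] at heq ⊢
    exact heq.imp (fun h => ⟨hinj he1 hf1 h.1, hinj he2 hf2 h.2⟩)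
      (fun h => ⟨hinj he1 hf2 h.1, hinj he2 hf1 h.2⟩)
  set R : ℕ × ℕ → ℕ × ℕ → Prop := fun e f => edge e ≠ edge f →
    segment ℝ (toPlane (P e.1)) (toPlane (P e.2)) ∩
      segment ℝ (toPlane (P f.1)) (toPlane (P f.2)) ⊆
    {toPlane (P e.1), toPlane (P e.2)} ∩ {toPlane (P f.1), toPlane (P f.2)} with hR
  have hcompat : E.Pairwise R := by
    refine h3.imp_of_mem fun {e f} he hf hef _ => ?_
    obtain ⟨he1, he2, -⟩ := hmem e he
    obtain ⟨hf1, hf2, -⟩ := hmem f hf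
    have hsub : ∀ i ∈ ({e.1, e.2, f.1, f.2} : Set ℕ), i < n := by
      rintro i (rfl | rfl | rfl | rfl) <;> assumption
    exact inter_segment_subset (fun i hi => hT i (hsub i hi)) (hE e he) (hE f hf)
      (fun i hi j hj h => hinj (hsub i hi) (hsub j hj) (congrArg toPlane h)) hef
  have hcross : ∀ e ∈ E, ∀ f ∈ E, R e f := by
    intro e he f hf
    refine hcompat.forall_of_forall_of_flip (fun e he h => (h rfl).elim) ?_ he hf
    refine hcompat.imp fun {e f} h hne => ?_
    rw [Set.inter_comm, Set.inter_comm {toPlane (P f.1), toPlane (P f.2)}]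
    exact h hne.symm
  refine ⟨⟨(Finset.range n).image fun i => toPlane (P i), (E.map edge).toFinset, ?_, ?_, ?_, ?_⟩,
    ?_, ?_⟩
  · intro e he u v huv
    simp only [List.mem_toFinset, List.mem_map] at he
    obtain ⟨f, hf, rfl⟩ := he
    obtain ⟨hf1, hf2, -⟩ := hmem f hf
    simp only [Finset.mem_image, Finset.mem_range]
    rcases Sym2.eq_iff.1 huv with ⟨rfl, rfl⟩ | ⟨rfl, rfl⟩
    · exact ⟨⟨_, hf1, rfl⟩, ⟨_, hf2, rfl⟩⟩
    · exact ⟨⟨_, hf2, rfl⟩, ⟨_, hf1, rfl⟩⟩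
  · intro e he
    simp only [List.mem_toFinset, List.mem_map] at he
    obtain ⟨f, hf, rfl⟩ := he
    obtain ⟨hf1, hf2, hf3⟩ := hmem f hf
    rw [hedge, Sym2.mk_isDiag_iff]
    exact fun h => hf3 (hinj hf1 hf2 h)
  · intro e he u v huv
    simp only [List.mem_toFinset, List.mem_map] at he
    obtain ⟨f, hf, rfl⟩ := he
    rcases Sym2.eq_iff.1 huv with ⟨rfl, rfl⟩ | ⟨rfl, rfl⟩
    · rw [dist_toPlane, hE f hf]
    · rw [dist_comm, dist_toPlane, hE f hf]
  · intro e₁ he₁ e₂ he₂ hne u v x y huv hxy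
    simp only [List.mem_toFinset, List.mem_map] at he₁ he₂
    obtain ⟨e, he, rfl⟩ := he₁
    obtain ⟨f, hf, rfl⟩ := he₂
    have hc := hcross e he f hf hne
    rcases Sym2.eq_iff.1 huv with ⟨rfl, rfl⟩ | ⟨rfl, rfl⟩ <;>
    rcases Sym2.eq_iff.1 hxy with ⟨rfl, rfl⟩ | ⟨rfl, rfl⟩
    · exact hc
    · rwa [segment_symm ℝ (toPlane (P f.2)), Set.pair_comm (toPlane (P f.2))]
    · rwa [segment_symm ℝ (toPlane (P e.2)), Set.pair_comm (toPlane (P e.2))]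
    · rwa [segment_symm ℝ (toPlane (P f.2)), Set.pair_comm (toPlane (P f.2)),
        segment_symm ℝ (toPlane (P e.2)), Set.pair_comm (toPlane (P e.2))]
  · intro v hv
    simp only [Finset.mem_image, Finset.mem_range] at hv
    obtain ⟨i, hi, rfl⟩ := hv
    have h5 := List.all_eq_true.1 h4 i (by simpa)
    rw [decide_eq_true_eq] at h5
    have h6 : (E.map edge).toFinset.filter (fun e => toPlane (P i) ∈ e) =
        ((E.map edge).filter (fun e => decide (toPlane (P i) ∈ e))).toFinset := by
      ext e
      simp
    change ((E.map edge).toFinset.filter (fun e => toPlane (P i) ∈ e)).card = 4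
    rw [h6, List.toFinset_card_of_nodup (hnodup.filter _), ← List.countP_eq_length_filter,
      List.countP_map, ← h5]
    refine List.countP_congr fun e he => ?_
    obtain ⟨he1, he2, -⟩ := hmem e he
    simp only [Function.comp_apply, hedge, Sym2.mem_iff, Bool.or_eq_true, decide_eq_true_eq]
    exact or_congr ⟨fun h => (hinj hi he1 h).symm, fun h => by rw [h]⟩
      ⟨fun h => (hinj hi he2 h).symm, fun h => by rw [h]⟩
  · rw [Finset.card_image_of_injOn, Finset.card_range]
    exact fun i hi j hj h => hinj (Finset.mem_range.1 hi) (Finset.mem_range.1 hj) h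

/-! ### Rings of mirror-symmetric links -/

namespace Piece

/-- The position of a vertex of a piece (for `b = false`), or of its mirror image in the line
through the axis vertices (for `b = true`). -/
noncomputable def pos (Q : Piece) (U : List ℂ) (b : Bool) (i : ℕ) : ℂ :=
  let δ := evalForm (Q.form Q.axis₁) U - evalForm (Q.form Q.axis₂) U
  bif b then evalForm (Q.form Q.axis₁) U +
    δ / starRingEnd ℂ δ * starRingEnd ℂ (evalForm (Q.form i) U - evalForm (Q.form Q.axis₁) U)
  else evalForm (Q.form i) U

/-- The vector from the tip of a piece to its mirror image. -/
noncomputable def span (Q : Piece) (U : List ℂ) : ℂ := Q.pos U true Q.tip - Q.pos U false Q.tip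

lemma pos_axis₁ (Q : Piece) (U : List ℂ) (b : Bool) :
    Q.pos U b Q.axis₁ = Q.pos U false Q.axis₁ := by
  cases b <;> simp [pos]

lemma pos_axis₂ (Q : Piece) (U : List ℂ) (b : Bool) :
    Q.pos U b Q.axis₂ = Q.pos U false Q.axis₂ := by
  cases b with
  | false => rfl
  | true =>
    simp only [pos, cond_true, cond_false]
    set z := evalForm (Q.form Q.axis₁) U
    set w := evalForm (Q.form Q.axis₂) U
    rcases eq_or_ne z w with h | h
    · simp [h]
    · have h1 : starRingEnd ℂ (z - w) ≠ 0 := (map_ne_zero _).2 (sub_ne_zero.2 h)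
      rw [← neg_sub z w, map_neg, mul_neg, div_mul_cancel₀ _ h1]
      ring

lemma norm_pos_sub_pos {Q : Piece} {U : List ℂ}
    (h : evalForm (Q.form Q.axis₁) U ≠ evalForm (Q.form Q.axis₂) U) (b : Bool) (i j : ℕ) :
    ‖Q.pos U b i - Q.pos U b j‖ = ‖evalForm (Q.form i) U - evalForm (Q.form j) U‖ := by
  cases b with
  | false => rfl
  | true =>
    simp only [pos, cond_true]
    rw [add_sub_add_left_eq_sub, ← mul_sub, ← map_sub, norm_mul, norm_div, RCLike.norm_conj,
      RCLike.norm_conj, div_self (by simpa [sub_eq_zero] using h), one_mul]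
    congr 1
    ring

end Piece

/-- A piece with balls around the direction of its mirror and around its rotation. -/
structure Link where
  piece : Piece
  refl : Ball
  rot : Ball

namespace Link

def vertexBall (L : Link) (i : ℕ) : Ball := evalBall (L.piece.form i) L.piece.dirs

/-- A ball around the vector between the axis vertices. -/
def axisBall (L : Link) : Ball :=
  (L.vertexBall L.piece.axis₁).sub (L.vertexBall L.piece.axis₂)

def posBall (L : Link) (b : Bool) (i : ℕ) : Ball :=
  bif b then (L.vertexBall L.piece.axis₁).add
    (L.refl.mul ((L.vertexBall i).sub (L.vertexBall L.piece.axis₁)).conj)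
  else L.vertexBall i

def spanBall (L : Link) : Ball :=
  (L.posBall true L.piece.tip).sub (L.posBall false L.piece.tip)

/-- A test of the direction of the mirror. -/
def reflCheck (L : Link) : Bool := Ball.quotWithin L.axisBall L.axisBall.conj L.refl

variable {L : Link} {U : List ℂ}

lemma contains_vertexBall (h : L.piece.Realizes U) (i : ℕ) :
    (L.vertexBall i).Contains (evalForm (L.piece.form i) U) :=
  contains_evalBall _ h.1

lemma axis_ne (h : L.piece.Realizes U) (hc : L.reflCheck = true) :
    evalForm (L.piece.form L.piece.axis₁) U ≠ evalForm (L.piece.form L.piece.axis₂) U := by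
  simp only [reflCheck, Ball.quotWithin, Bool.and_eq_true, decide_eq_true_eq] at hc
  have h1 := (((contains_vertexBall h L.piece.axis₁).sub
    (contains_vertexBall h L.piece.axis₂)).conj).ne_zero hc.1
  exact sub_ne_zero.1 ((map_ne_zero _).1 h1)

lemma contains_posBall (h : L.piece.Realizes U) (hc : L.reflCheck = true) (b : Bool) (i : ℕ) :
    (L.posBall b i).Contains (L.piece.pos U b i) := by
  cases b with
  | false => exact contains_vertexBall h i
  | true =>
    have h1 := contains_vertexBall h L.piece.axis₁
    have h2 := h1.sub (contains_vertexBall h L.piece.axis₂)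
    exact h1.add ((h2.div h2.conj hc).mul ((contains_vertexBall h i).sub h1).conj)

lemma contains_spanBall (h : L.piece.Realizes U) (hc : L.reflCheck = true) :
    L.spanBall.Contains (L.piece.span U) :=
  (contains_posBall h hc _ _).sub (contains_posBall h hc _ _)

end Link

/-- The base point of each link in a chain of links, the tips being glued to their successors. -/
noncomputable def chainBase (ρ s : ℕ → ℂ) : ℕ → ℂ
  | 0 => 0
  | l + 1 => chainBase ρ s l + ρ l * s l

/-- Balls around the base points of a chain of links. -/
def chainBall (K : ℕ → Link) : ℕ → Ball
  | 0 => intBall 0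
  | l + 1 => (chainBall K l).add ((K l).rot.mul (K l).spanBall)

/-- The vertices of a ring of `m` links are named by the number of the link, the side of the
mirror and the number of the vertex of the piece. This replaces a name by a canonical one. -/
def canonical (m : ℕ) (K : ℕ → Link) (v : ℕ × Bool × ℕ) : ℕ × Bool × ℕ :=
  bif v.2.1 then
    if v.2.2 = (K v.1).piece.axis₁ then (v.1, false, v.2.2) else
    if v.2.2 = (K v.1).piece.axis₂ then (v.1, false, v.2.2) else
    if v.2.2 = (K v.1).piece.tip then
      ((v.1 + 1) % m, false, (K ((v.1 + 1) % m)).piece.tip)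
    else v
  else v

/-- All pairs of a link and a side of its mirror. -/
def sides (m : ℕ) : List (ℕ × Bool) := (List.range m).flatMap fun l => [(l, false), (l, true)]

/-- The canonical names of the vertices of a ring of links. -/
def ringNames (m : ℕ) (K : ℕ → Link) : List (ℕ × Bool × ℕ) :=
  (sides m).flatMap fun c => ((List.range (K c.1).piece.pts.length).map fun i =>
    (c.1, c.2, i)).filter fun v => decide (canonical m K v = v)

/-- The edges of a ring of links. -/
def ringEdges (m : ℕ) (K : ℕ → Link) (N : List (ℕ × Bool × ℕ)) : List (ℕ × ℕ) :=
  (sides m).flatMap fun c => (K c.1).piece.edges.map fun e =>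
    (N.idxOf (canonical m K (c.1, c.2, e.1)), N.idxOf (canonical m K (c.1, c.2, e.2)))

/-- A ball around the position of a vertex in a ring of links. -/
def placeBall (K : ℕ → Link) (v : ℕ × Bool × ℕ) : Ball :=
  ((K v.1).rot.mul (((K v.1).posBall v.2.1 v.2.2).sub
    ((K v.1).posBall false (K v.1).piece.tip))).add (chainBall K v.1)

/-- A ball of approximations in units of `1 / 10000`. -/
def approxBall (a : ℤ × ℤ) : Ball := ⟨a.1 * 100000000, a.2 * 100000000, 100000000⟩

/-- A test of the approximate coordinates `T` of the vertices with names `N`. -/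
def placeCheck (K : ℕ → Link) : List (ℕ × Bool × ℕ) → List (ℤ × ℤ) → Bool
  | [], [] => true
  | v :: N, a :: T => (placeBall K v).within (approxBall a) && placeCheck K N T
  | _, _ => false

lemma approximates_of_contains {a : ℤ × ℤ} {z : ℂ} (h : (approxBall a).Contains z) :
    Approximates a z := by
  have hre := (Complex.abs_re_le_norm _).trans h
  have him := (Complex.abs_im_le_norm _).trans h
  simp only [approxBall, Ball.center, prec] at hre him
  norm_num [abs_le] at hre him
  simp only [Approximates, abs_le]
  refine ⟨⟨?_, ?_⟩, ?_, ?_⟩ <;> linarith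

/-- The data of a closed ring of links. -/
structure IsRing (m : ℕ) (K : ℕ → Link) (U : ℕ → List ℂ) (ρ : ℕ → ℂ) : Prop where
  realizes : ∀ l < m, (K l).piece.Realizes (U l)
  reflCheck : ∀ l < m, (K l).reflCheck = true
  norm_rot : ∀ l < m, ‖ρ l‖ = 1
  contains_rot : ∀ l < m, (K l).rot.Contains (ρ l)
  closed : chainBase ρ (fun l => (K l).piece.span (U l)) m = 0

namespace IsRing

variable {m : ℕ} {K : ℕ → Link} {U : ℕ → List ℂ} {ρ : ℕ → ℂ}

/-- The position of a vertex in a ring of links. -/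
noncomputable def place (K : ℕ → Link) (U : ℕ → List ℂ) (ρ : ℕ → ℂ) (v : ℕ × Bool × ℕ) : ℂ :=
  ρ v.1 * ((K v.1).piece.pos (U v.1) v.2.1 v.2.2 -
    (K v.1).piece.pos (U v.1) false (K v.1).piece.tip) +
  chainBase ρ (fun l => (K l).piece.span (U l)) v.1

lemma contains_chainBall (h : IsRing m K U ρ) {l : ℕ} (hl : l ≤ m) :
    (chainBall K l).Contains (chainBase ρ (fun l => (K l).piece.span (U l)) l) := by
  induction l with
  | zero => simpa [chainBall, chainBase] using contains_intBall 0
  | succ l ih =>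
    exact (ih (by lia)).add ((h.contains_rot l hl).mul
      (Link.contains_spanBall (h.realizes l hl) (h.reflCheck l hl)))

lemma contains_placeBall (h : IsRing m K U ρ) {v : ℕ × Bool × ℕ} (hv : v.1 < m) :
    (placeBall K v).Contains (place K U ρ v) :=
  ((h.contains_rot _ hv).mul ((Link.contains_posBall (h.realizes _ hv) (h.reflCheck _ hv) _ _).sub
    (Link.contains_posBall (h.realizes _ hv) (h.reflCheck _ hv) _ _))).add
    (h.contains_chainBall hv.le)

lemma place_canonical (h : IsRing m K U ρ) {v : ℕ × Bool × ℕ} (hv : v.1 < m) :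
    place K U ρ (canonical m K v) = place K U ρ v := by
  obtain ⟨l, b, i⟩ := v
  cases b with
  | false => rfl
  | true =>
    simp only [canonical, cond_true]
    split_ifs with h1 h2 h3
    · subst h1
      simp only [place, Piece.pos_axis₁ _ _ true]
    · subst h2
      simp only [place, Piece.pos_axis₂ _ _ true]
    · subst h3
      have h4 : chainBase ρ (fun l => (K l).piece.span (U l)) ((l + 1) % m) =
          chainBase ρ (fun l => (K l).piece.span (U l)) (l + 1) := by
        rcases (Nat.succ_le_of_lt hv).eq_or_lt with h5 | h5
        · have h6 : l + 1 = m := h5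
          rw [h6, Nat.mod_self, h.closed]
          rfl
        · rw [Nat.mod_eq_of_lt h5]
      simp only [place, sub_self, mul_zero, zero_add, h4]
      rw [chainBase, add_comm]
      rfl
    · rfl

lemma norm_place_sub_place (h : IsRing m K U ρ) {l : ℕ} (hl : l < m) (b : Bool) {e : ℕ × ℕ}
    (he : e ∈ (K l).piece.edges) :
    ‖place K U ρ (l, b, e.1) - place K U ρ (l, b, e.2)‖ = 1 := by
  simp only [place]
  rw [add_sub_add_right_eq_sub, ← mul_sub, norm_mul, h.norm_rot l hl, one_mul,
    sub_sub_sub_cancel_right,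
    Piece.norm_pos_sub_pos (Link.axis_ne (h.realizes l hl) (h.reflCheck l hl)),
    (h.realizes l hl).2 e he]

lemma approximates (h : IsRing m K U ρ) {N : List (ℕ × Bool × ℕ)} {T : List (ℤ × ℤ)}
    (hN : ∀ v ∈ N, v.1 < m) (hc : placeCheck K N T = true) :
    N.length = T.length ∧ ∀ i < T.length, Approximates (T.getD i 0)
      (place K U ρ (N.getD i (0, false, 0))) := by
  induction N generalizing T with
  | nil =>
    cases T with
    | nil => simp
    | cons a T => simp [placeCheck] at hc
  | cons v N ih =>
    cases T with
    | nil => simp [placeCheck] at hc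
    | cons a T =>
      simp only [placeCheck, Bool.and_eq_true] at hc
      obtain ⟨h1, h2⟩ := ih (fun w hw => hN w (List.mem_cons_of_mem _ hw)) hc.2
      refine ⟨by simp [h1], fun i hi => ?_⟩
      cases i with
      | zero =>
        exact approximates_of_contains ((h.contains_placeBall (hN v (by simp))).mono hc.1)
      | succ i => simpa using h2 i (by simpa using hi)

lemma exists_graph (h : IsRing m K U ρ) {n : ℕ} {T : List (ℤ × ℤ)} {E : List (ℕ × ℕ)}
    (hn : T.length = n) (hT : placeCheck K (ringNames m K) T = true)
    (hE : ringEdges m K (ringNames m K) = E) (hG : graphCheck n T E = true) :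
    ∃ G : MatchstickGraph, G.IsFourRegular ∧ G.V.card = n := by
  have hsides : ∀ c ∈ sides m, c.1 < m := by
    intro c hc
    simp only [sides, List.mem_flatMap, List.mem_range, List.mem_cons, List.not_mem_nil,
      or_false] at hc
    obtain ⟨l, hl, rfl | rfl⟩ := hc <;> exact hl
  have hN : ∀ v ∈ ringNames m K, v.1 < m := by
    intro v hv
    simp only [ringNames, List.mem_flatMap, List.mem_filter, List.mem_map] at hv
    obtain ⟨c, hc, ⟨i, -, rfl⟩, -⟩ := hv
    exact hsides c hc
  obtain ⟨hlen, happ⟩ := h.approximates hN hT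
  subst hn
  refine exists_graph_of_graphCheck (P := fun i =>
    place K U ρ ((ringNames m K).getD i (0, false, 0))) happ ?_ hG
  intro e he
  have hlt : e.1 < T.length ∧ e.2 < T.length := by
    simp only [graphCheck, Bool.and_eq_true] at hG
    have := List.all_eq_true.1 hG.1.1.2 e he
    simp only [Bool.and_eq_true, decide_eq_true_eq] at this
    exact this.1
  rw [← hE] at he
  simp only [ringEdges, List.mem_flatMap, List.mem_map] at he
  obtain ⟨c, hc, f, hf, rfl⟩ := he
  rw [← hlen] at hlt
  simp only
  rw [List.getD_eq_getElem _ _ hlt.1, List.getD_eq_getElem _ _ hlt.2, List.getElem_idxOf,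
    List.getElem_idxOf, h.place_canonical (hsides c hc), h.place_canonical (hsides c hc)]
  exact h.norm_place_sub_place (hsides c hc) c.2 hf

end IsRing

/-- A test ensuring that two unit vectors in the balls `D` and `D'` close up a triangle. -/
def triangleCheck (A B C : Ball) (s : Bool) (S D D' : Ball) : Bool :=
  solveCheck A B C s S D && Ball.quotWithin ((A.mul D).add C).neg B D'

lemma exists_triangle {A B C S D D' : Ball} {s : Bool} {α β γ : ℂ} (hα : A.Contains α)
    (hβ : B.Contains β) (hγ : C.Contains γ) (h : triangleCheck A B C s S D D' = true) :
    ∃ u v : ℂ, ‖u‖ = 1 ∧ ‖v‖ = 1 ∧ γ + u * α + v * β = 0 ∧ D.Contains u ∧ D'.Contains v := by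
  simp only [triangleCheck, Bool.and_eq_true] at h
  obtain ⟨u, hu, hs, hD⟩ := exists_unit_of_solveCheck hα hβ hγ h.1
  have hβ0 : β ≠ 0 := by
    have h2 := h.2
    simp only [Ball.quotWithin, Bool.and_eq_true, decide_eq_true_eq] at h2
    exact hβ.ne_zero h2.1
  refine ⟨u, -(α * u + γ) / β, hu, ?_, ?_, hD, ((hα.mul hD).add hγ).neg.div hβ h.2⟩
  · rw [norm_div, norm_neg, hs, div_self (norm_ne_zero_iff.2 hβ0)]
  · field_simp
    ring

/-! ### The pieces -/

/-- A framework with 25 vertices. -/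
def piece25 : Piece where
  stages := [
    { lead := (0, -2)
      tail := [(2, -2)]
      sign := false
      root := ⟨3872983346205, 0, 350⟩
      dir := ⟨-18237254218, -999833687450, 67⟩ },
    { lead := (2, -2)
      tail := [(-2, 0), (-2, -2)]
      sign := true
      root := ⟨1070466269259, 0, 34928⟩
      dir := ⟨647056244445, 762442270944, 3804⟩ },
    { lead := (2, -2)
      tail := [(-2, 0), (0, 0), (0, 0)]
      sign := true
      root := ⟨3872983346203, 0, 332784⟩
      dir := ⟨161173994667, 986926007075, 56231⟩ }]
  pts :=
    [[(0, 0), (0, 0), (0, 0), (0, 0)], [(1, 0), (0, 0), (0, 0), (0, 0)],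
     [(0, 1), (0, 0), (0, 0), (0, 0)], [(1, -1), (0, 0), (0, 0), (0, 0)],
     [(-1, 1), (0, 0), (0, 0), (0, 0)], [(1, -1), (-1, -1), (0, 0), (0, 0)],
     [(1, -1), (0, -1), (0, 0), (0, 0)], [(1, -1), (-1, 0), (0, 0), (0, 0)],
     [(1, -1), (0, -2), (0, 0), (0, 0)], [(1, -1), (-2, 0), (0, 0), (0, 0)],
     [(1, -1), (0, -2), (0, 0), (-1, -1)], [(1, -1), (0, -2), (0, 0), (0, -1)],
     [(1, -1), (0, -2), (0, 0), (-1, 0)], [(1, -1), (0, -2), (0, 0), (0, -2)],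
     [(1, -1), (0, -2), (0, 0), (-2, 0)], [(1, -1), (0, -2), (0, -1), (0, -2)],
     [(1, -1), (0, -2), (1, -1), (0, -2)], [(1, -1), (0, -2), (1, -2), (0, -2)],
     [(1, -1), (0, -2), (0, -2), (0, -2)], [(1, -1), (0, -2), (-2, 0), (-2, -2)],
     [(1, -1), (0, -2), (2, -2), (0, -2)], [(-1, 1), (2, -2), (-2, 0), (-2, -2)],
     [(0, 1), (2, -2), (-2, 0), (-2, -2)], [(1, 0), (2, -2), (-2, 0), (-2, -2)],
     [(-1, 2), (2, -2), (-2, 0), (-2, -2)]]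
  edges :=
    [(0, 1), (1, 2), (0, 2), (1, 3), (0, 3), (2, 4), (0, 4), (5, 6), (6, 7), (5, 7), (6, 8),
     (5, 8), (7, 9), (5, 9), (10, 11), (11, 12), (10, 12), (11, 13), (10, 13), (12, 14),
     (10, 14), (15, 16), (16, 17), (15, 17), (16, 13), (15, 13), (17, 18), (15, 18), (14, 18),
     (12, 8), (11, 8), (18, 19), (14, 19), (9, 19), (7, 3), (6, 3), (4, 9), (17, 20),
     (16, 20), (19, 21), (4, 21), (21, 22), (2, 22), (22, 23), (1, 23), (22, 24), (21, 24)]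
  axis₁ := 24
  axis₂ := 20
  tip := 23

/-- A framework with 22 vertices. -/
def piece22 : Piece where
  stages := [
    { lead := (-2, 2)
      tail := [(0, 2)]
      sign := true
      root := ⟨3872983346205, 0, 350⟩
      dir := ⟨-18237254218, 999833687449, 66⟩ },
    { lead := (0, 2)
      tail := [(0, 0), (-2, 0)]
      sign := false
      root := ⟨3872983346206, 0, 327⟩
      dir := ⟨856762745781, -515710769174, 66⟩ },
    { lead := (2, -2)
      tail := [(1, 0), (2, -2), (0, -2)]
      sign := true
      root := ⟨3858443092453, 0, 11319⟩
      dir := ⟨-992933377329, 118673114843, 1957⟩ }]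
  pts :=
    [[(0, 0), (0, 0), (0, 0), (0, 0)], [(1, 0), (0, 0), (0, 0), (0, 0)],
     [(0, 1), (0, 0), (0, 0), (0, 0)], [(1, -1), (0, 0), (0, 0), (0, 0)],
     [(-1, 1), (0, 0), (0, 0), (0, 0)], [(1, -1), (0, 1), (2, -2), (0, -2)],
     [(1, -1), (1, 1), (2, -2), (0, -2)], [(1, -1), (1, 0), (2, -2), (0, -2)],
     [(1, -1), (0, 2), (2, -2), (0, -2)], [(1, -1), (0, 0), (2, -2), (0, -2)],
     [(1, -1), (0, 2), (2, -2), (-2, -1)], [(1, -1), (0, 2), (2, -2), (-1, -1)],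
     [(1, -1), (0, 2), (2, -2), (-1, -2)], [(1, -1), (0, 2), (2, -2), (-2, 0)],
     [(1, -1), (0, 2), (2, -2), (-2, -2)], [(1, -1), (0, 2), (1, -1), (-2, 0)],
     [(1, -1), (0, 2), (2, -1), (-2, 0)], [(1, -1), (0, 2), (1, 0), (-2, 0)],
     [(1, -1), (0, 2), (0, 0), (-2, 0)], [(1, 1), (0, 0), (0, 0), (0, 0)],
     [(-1, 1), (0, 1), (0, 0), (0, 0)], [(1, -1), (0, 2), (2, 0), (-2, 0)]]
  edges :=
    [(0, 1), (1, 2), (0, 2), (1, 3), (0, 3), (2, 4), (0, 4), (5, 6), (6, 7), (5, 7), (6, 8),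
     (5, 8), (7, 9), (5, 9), (10, 11), (11, 12), (10, 12), (11, 13), (10, 13), (12, 14),
     (10, 14), (15, 16), (16, 17), (15, 17), (16, 13), (15, 13), (17, 18), (15, 18), (14, 18),
     (12, 8), (11, 8), (9, 14), (18, 3), (9, 3), (4, 7), (2, 19), (1, 19), (6, 20), (4, 20),
     (17, 21), (16, 21)]
  axis₁ := 21
  axis₂ := 19
  tip := 20

/-- A framework with 18 vertices. -/
def piece18 : Piece where
  stages := [
    { lead := (0, -2)
      tail := [(2, -2)]
      sign := false
      root := ⟨3872983346205, 0, 350⟩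
      dir := ⟨-18237254218, -999833687450, 67⟩ },
    { lead := (2, -2)
      tail := [(-2, 0), (-2, -2)]
      sign := true
      root := ⟨1070466269259, 0, 34928⟩
      dir := ⟨647056244445, 762442270944, 3804⟩ }]
  pts :=
    [[(0, 0), (0, 0), (0, 0)], [(1, 0), (0, 0), (0, 0)], [(0, 1), (0, 0), (0, 0)],
     [(1, -1), (0, 0), (0, 0)], [(-1, 1), (0, 0), (0, 0)], [(1, -1), (0, 0), (-1, -1)],
     [(1, -1), (0, 0), (0, -1)], [(1, -1), (0, 0), (-1, 0)], [(1, -1), (0, 0), (0, -2)],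
     [(1, -1), (0, 0), (-2, 0)], [(1, -1), (0, -1), (0, -2)], [(1, -1), (1, -1), (0, -2)],
     [(1, -1), (1, -2), (0, -2)], [(1, -1), (0, -2), (0, -2)], [(1, -1), (-2, 0), (-2, -2)],
     [(1, 1), (0, 0), (0, 0)], [(1, -1), (2, -2), (0, -2)], [(-1, -1), (-2, 2), (-4, 2)]]
  edges :=
    [(0, 1), (1, 2), (0, 2), (1, 3), (0, 3), (2, 4), (0, 4), (5, 6), (6, 7), (5, 7), (6, 8),
     (5, 8), (7, 9), (5, 9), (10, 11), (11, 12), (10, 12), (11, 8), (10, 8), (12, 13),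
     (10, 13), (9, 13), (7, 3), (6, 3), (13, 14), (9, 14), (4, 14), (2, 15), (1, 15),
     (12, 16), (11, 16), (14, 17), (4, 17)]
  axis₁ := 17
  axis₂ := 15
  tip := 16

/-- A framework with 12 vertices. -/
def piece12 : Piece where
  stages := [
    { lead := (0, -2)
      tail := [(2, -2)]
      sign := false
      root := ⟨3872983346205, 0, 350⟩
      dir := ⟨-18237254218, -999833687450, 67⟩ }]
  pts :=
    [[(0, 0), (0, 0)], [(0, 0), (1, 0)], [(0, 0), (0, 1)], [(0, 0), (1, -1)],
     [(0, 0), (-1, 1)], [(0, -1), (1, -1)], [(1, -1), (1, -1)], [(1, -2), (1, -1)],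
     [(0, -2), (1, -1)], [(0, 0), (1, 1)], [(2, -2), (1, -1)], [(-2, 0), (-1, -1)]]
  edges :=
    [(0, 1), (1, 2), (0, 2), (1, 3), (0, 3), (2, 4), (0, 4), (5, 6), (6, 7), (5, 7), (6, 3),
     (5, 3), (7, 8), (5, 8), (4, 8), (2, 9), (1, 9), (7, 10), (6, 10), (8, 11), (4, 11)]
  axis₁ := 11
  axis₂ := 9
  tip := 10

/-- The framework `piece12` with a different choice of the tip. -/
def piece12Turned : Piece :=
  { piece12 with axis₁ := 10, axis₂ := 11, tip := 9 }

/-- The links of the graph with 94 vertices. -/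
def links94 : ℕ → Link
  | 0 => ⟨piece25, ⟨-777250795554, -629190909671, 106405⟩, intBall 1⟩
  | _ => ⟨piece25, ⟨-777250795554, -629190909671, 106405⟩, intBall (-1)⟩

/-- The approximate coordinates of the graph with 94 vertices. -/
def coords94 : List (ℤ × ℤ) :=
  [(8347, -8963), (9959, 907), (606, -2632), (17700, -5424), (-1006, -12501), (14597, -22464),
   (21068, -14840), (11229, -13048), (24435, -24255), (4759, -20673), (9435, -32916),
   (19435, -32916), (14435, -24255), (14435, -41576), (4435, -24255), (5868, -36419),
   (5685, -46417), (-2882, -41260), (-2700, -31262), (-5200, -21579), (-3065, -51258),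
   (-10965, -13408), (-9353, -3539), (0, 0), (-18706, -7078), (-38547, -25564),
   (-46009, -18907), (-36513, -15773), (-48043, -28698), (-29051, -22430), (-34910, -39991),
   (-44736, -38136), (-38216, -30553), (-41429, -47573), (-28390, -32408), (-24321, -44866),
   (-32094, -51158), (-33657, -41281), (-22759, -54744), (-25884, -34989), (-19344, -45345),
   (-12912, -53001), (-9497, -43602), (-15930, -35945), (-20079, -26847), (-20740, -16869),
   (-28202, -10212), (-46045, -4384), (-47657, -14253), (-38304, -10714), (-55398, -7922),
   (-36692, -845), (-52295, 9118), (-58766, 1494), (-48927, -298), (-62133, 10909),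
   (-42457, 7326), (-47133, 19570), (-57133, 19570), (-52133, 10909), (-52133, 28230),
   (-42133, 10909), (-43566, 23073), (-43383, 33071), (-34816, 27914), (-34998, 17916),
   (-32498, 8233), (-34633, 37912), (-26733, 62), (-28345, -9807), (-37698, -13346),
   (-18992, -6268), (849, 12218), (8311, 5561), (-1185, 2427), (10345, 15352), (-8648, 9084),
   (-2789, 26644), (7038, 24790), (518, 17207), (3731, 34227), (-9308, 19062), (-13377, 31520),
   (-5604, 37812), (-4041, 27935), (-14939, 41397), (-11814, 21643), (-18354, 31998),
   (-24786, 39655), (-28201, 30256), (-21768, 22599), (-17619, 13501), (-16959, 3523),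
   (-9496, -3134)]

/-- The edges of the graph with 94 vertices. -/
def edges94 : List (ℕ × ℕ) :=
  [(0, 1), (1, 2), (0, 2), (1, 3), (0, 3), (2, 4), (0, 4), (5, 6), (6, 7), (5, 7), (6, 8),
   (5, 8), (7, 9), (5, 9), (10, 11), (11, 12), (10, 12), (11, 13), (10, 13), (12, 14), (10, 14),
   (15, 16), (16, 17), (15, 17), (16, 13), (15, 13), (17, 18), (15, 18), (14, 18), (12, 8),
   (11, 8), (18, 19), (14, 19), (9, 19), (7, 3), (6, 3), (4, 9), (17, 20), (16, 20), (19, 21),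
   (4, 21), (21, 22), (2, 22), (22, 23), (1, 23), (22, 24), (21, 24), (25, 26), (26, 27),
   (25, 27), (26, 28), (25, 28), (27, 29), (25, 29), (30, 31), (31, 32), (30, 32), (31, 33),
   (30, 33), (32, 34), (30, 34), (35, 36), (36, 37), (35, 37), (36, 38), (35, 38), (37, 39),
   (35, 39), (40, 41), (41, 42), (40, 42), (41, 38), (40, 38), (42, 43), (40, 43), (39, 43),
   (37, 33), (36, 33), (43, 44), (39, 44), (34, 44), (32, 28), (31, 28), (29, 34), (42, 20),
   (41, 20), (44, 45), (29, 45), (45, 46), (27, 46), (46, 70), (26, 70), (46, 24), (45, 24),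
   (47, 48), (48, 49), (47, 49), (48, 50), (47, 50), (49, 51), (47, 51), (52, 53), (53, 54),
   (52, 54), (53, 55), (52, 55), (54, 56), (52, 56), (57, 58), (58, 59), (57, 59), (58, 60),
   (57, 60), (59, 61), (57, 61), (62, 63), (63, 64), (62, 64), (63, 60), (62, 60), (64, 65),
   (62, 65), (61, 65), (59, 55), (58, 55), (65, 66), (61, 66), (56, 66), (54, 50), (53, 50),
   (51, 56), (64, 67), (63, 67), (66, 68), (51, 68), (68, 69), (49, 69), (69, 70), (48, 70),
   (69, 71), (68, 71), (72, 73), (73, 74), (72, 74), (73, 75), (72, 75), (74, 76), (72, 76),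
   (77, 78), (78, 79), (77, 79), (78, 80), (77, 80), (79, 81), (77, 81), (82, 83), (83, 84),
   (82, 84), (83, 85), (82, 85), (84, 86), (82, 86), (87, 88), (88, 89), (87, 89), (88, 85),
   (87, 85), (89, 90), (87, 90), (86, 90), (84, 80), (83, 80), (90, 91), (86, 91), (81, 91),
   (79, 75), (78, 75), (76, 81), (89, 67), (88, 67), (91, 92), (76, 92), (92, 93), (74, 93),
   (93, 23), (73, 23), (93, 71), (92, 71)]

/-- The links of the graph with 95 vertices. -/
def links95 : ℕ → Link
  | 0 => ⟨piece18, ⟨749534734970, 661965014991, 23475⟩, intBall 1⟩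
  | 1 => ⟨piece22, ⟨-923368632169, 383914533622, 3862⟩, ⟨369584910032, 929196962046, 247487⟩⟩
  | _ => ⟨piece12, ⟨983822497779, -179146009901, 110⟩, ⟨-257810823264, -966195414710, 305423⟩⟩

/-- The approximate coordinates of the graph with 95 vertices. -/
def coords95 : List (ℤ × ℤ) :=
  [(17662, 28794), (24132, 36419), (14294, 38210), (27500, 27003), (7824, 30586),
   (12500, 18343), (22500, 18343), (17500, 27003), (17500, 9682), (7500, 27003), (8932, 14840),
   (8750, 4841), (182, 9998), (365, 19997), (-2135, 29679), (20765, 45835), (0, 0),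
   (2059, 38757), (7159, 56553), (17056, 55122), (10868, 47266), (13347, 64408), (971, 48698),
   (-3629, 60970), (3867, 67590), (5852, 57789), (-5614, 70771), (-1644, 51169), (-8622, 61234),
   (-15377, 68607), (-18385, 59071), (-11630, 51697), (-7094, 42785), (-33872, 56263),
   (-38645, 47476), (-28648, 47737), (-43869, 56003), (-23876, 56524), (-35986, 69963),
   (-28028, 76018), (-26763, 66098), (-37251, 79883), (-34721, 60043), (-50841, 69145),
   (-47146, 78437), (-40946, 70591), (-57041, 76992), (-44642, 61299), (-55415, 67125),
   (-64773, 70651), (-63147, 60784), (-53790, 57258), (-33420, 38949), (-25140, 66444),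
   (-72505, 64310), (-49417, 32307), (-43336, 40246), (-39501, 31010), (-53252, 41542),
   (-45582, 23071), (-62789, 28656), (-65076, 18921), (-55502, 21807), (-72363, 25769),
   (-53215, 31542), (-68095, 42555), (-75075, 35394), (-65383, 32930), (-77787, 45020),
   (-58403, 40091), (-68113, 47555), (-75146, 54665), (-65473, 57200), (-58440, 50091),
   (-40656, 3378), (-43234, -6284), (-33578, -3685), (-50313, 780), (-31000, 5976),
   (-43121, 7728), (-52735, 10482), (-45543, 17431), (-35930, 14677), (-36156, -13347),
   (-55156, 20185), (-25930, 14596), (-21923, -3477), (-26190, -12521), (-31889, -4304),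
   (-16224, -11695), (-27621, 4740), (-17232, -1746), (-8112, -5847), (-9120, 4102),
   (-18240, 8203)]

/-- The edges of the graph with 95 vertices. -/
def edges95 : List (ℕ × ℕ) :=
  [(0, 1), (1, 2), (0, 2), (1, 3), (0, 3), (2, 4), (0, 4), (5, 6), (6, 7), (5, 7), (6, 8),
   (5, 8), (7, 9), (5, 9), (10, 11), (11, 12), (10, 12), (11, 8), (10, 8), (12, 13), (10, 13),
   (9, 13), (7, 3), (6, 3), (13, 14), (9, 14), (4, 14), (2, 15), (1, 15), (12, 16), (11, 16),
   (14, 17), (4, 17), (18, 19), (19, 20), (18, 20), (19, 21), (18, 21), (20, 22), (18, 22),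
   (23, 24), (24, 25), (23, 25), (24, 26), (23, 26), (25, 27), (23, 27), (28, 29), (29, 30),
   (28, 30), (29, 26), (28, 26), (30, 31), (28, 31), (27, 31), (25, 21), (24, 21), (31, 32),
   (27, 32), (22, 32), (20, 15), (19, 15), (30, 53), (29, 53), (32, 17), (22, 17), (33, 34),
   (34, 35), (33, 35), (34, 36), (33, 36), (35, 37), (33, 37), (38, 39), (39, 40), (38, 40),
   (39, 41), (38, 41), (40, 42), (38, 42), (43, 44), (44, 45), (43, 45), (44, 46), (43, 46),
   (45, 47), (43, 47), (48, 49), (49, 50), (48, 50), (49, 46), (48, 46), (50, 51), (48, 51),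
   (47, 51), (45, 41), (44, 41), (42, 47), (51, 36), (42, 36), (37, 40), (35, 52), (34, 52),
   (39, 53), (37, 53), (50, 54), (49, 54), (55, 56), (56, 57), (55, 57), (56, 58), (55, 58),
   (57, 59), (55, 59), (60, 61), (61, 62), (60, 62), (61, 63), (60, 63), (62, 64), (60, 64),
   (65, 66), (66, 67), (65, 67), (66, 68), (65, 68), (67, 69), (65, 69), (70, 71), (71, 72),
   (70, 72), (71, 68), (70, 68), (72, 73), (70, 73), (69, 73), (67, 63), (66, 63), (64, 69),
   (73, 58), (64, 58), (59, 62), (57, 52), (56, 52), (61, 84), (59, 84), (72, 54), (71, 54),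
   (74, 75), (75, 76), (74, 76), (75, 77), (74, 77), (76, 78), (74, 78), (79, 80), (80, 81),
   (79, 81), (80, 77), (79, 77), (81, 82), (79, 82), (78, 82), (76, 83), (75, 83), (81, 84),
   (80, 84), (82, 85), (78, 85), (86, 87), (87, 88), (86, 88), (87, 89), (86, 89), (88, 90),
   (86, 90), (91, 92), (92, 93), (91, 93), (92, 89), (91, 89), (93, 94), (91, 94), (90, 94),
   (88, 83), (87, 83), (93, 16), (92, 16), (94, 85), (90, 85)]

/-- The links of the graph with 96 vertices. -/
def links96 : ℕ → Link
  | 0 => ⟨piece18, ⟨749534734970, 661965014991, 23475⟩, intBall 1⟩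
  | 1 => ⟨piece12Turned, ⟨-989701240009, -143148368928, 242⟩, ⟨855726550421, 517428324411, 126747⟩⟩
  | 2 => ⟨piece12, ⟨983822497779, -179146009901, 110⟩, ⟨-912864399544, -408262890851, 1251937⟩⟩
  | _ => ⟨piece12Turned, ⟨-989701240009, -143148368928, 242⟩, ⟨-945685205737, -325083822500, 1522234⟩⟩

/-- The approximate coordinates of the graph with 96 vertices. -/
def coords96 : List (ℤ × ℤ) :=
  [(17662, 28794), (24132, 36419), (14294, 38210), (27500, 27003), (7824, 30586),
   (12500, 18343), (22500, 18343), (17500, 27003), (17500, 9682), (7500, 27003), (8932, 14840),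
   (8750, 4841), (182, 9998), (365, 19997), (-2135, 29679), (20765, 45835), (0, 0),
   (2059, 38757), (7159, 56553), (17056, 55122), (10868, 47266), (13347, 64408), (971, 48698),
   (-3629, 60970), (3867, 67590), (5852, 57789), (-5614, 70771), (-1644, 51169), (-8622, 61234),
   (-15377, 68607), (-18385, 59071), (-11630, 51697), (-7094, 42785), (-33495, 51272),
   (-24938, 56446), (-33697, 61270), (-24735, 46448), (-42255, 56095), (-34735, 46428),
   (-29718, 37778), (-39718, 37758), (-44735, 46408), (-25140, 66444), (-34701, 29108),
   (-51885, 53400), (-56001, 35351), (-63730, 29005), (-65361, 38871), (-54370, 25485),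
   (-57633, 45217), (-51021, 34908), (-44535, 27296), (-41186, 36719), (-47672, 44330),
   (-77012, 10678), (-86141, 6595), (-78041, 731), (-85112, 16542), (-68912, 4813),
   (-75185, 15332), (-79101, 24534), (-69174, 23324), (-65259, 14122), (-87169, -3352),
   (-73090, 32525), (-59024, 6304), (-70538, -8191), (-80251, -10573), (-77457, -971),
   (-73332, -17793), (-67744, 1410), (-66239, -10744), (-63681, -20411), (-56588, -13363),
   (-59146, -3695), (-42660, -9964), (-52117, -13215), (-44573, -19779), (-50204, -3399),
   (-35117, -16528), (-40425, -5491), (-43503, 4023), (-33724, 1932), (-30646, -7583),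
   (-54030, -23030), (-36802, 11446), (-25135, -15927), (-17300, 846), (-8406, 5417),
   (-8894, -4571), (-16811, 10834), (-17788, -9142), (-22074, 2331), (-26807, 11140),
   (-32070, 2637), (-27337, -6172)]

/-- The edges of the graph with 96 vertices. -/
def edges96 : List (ℕ × ℕ) :=
  [(0, 1), (1, 2), (0, 2), (1, 3), (0, 3), (2, 4), (0, 4), (5, 6), (6, 7), (5, 7), (6, 8),
   (5, 8), (7, 9), (5, 9), (10, 11), (11, 12), (10, 12), (11, 8), (10, 8), (12, 13), (10, 13),
   (9, 13), (7, 3), (6, 3), (13, 14), (9, 14), (4, 14), (2, 15), (1, 15), (12, 16), (11, 16),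
   (14, 17), (4, 17), (18, 19), (19, 20), (18, 20), (19, 21), (18, 21), (20, 22), (18, 22),
   (23, 24), (24, 25), (23, 25), (24, 26), (23, 26), (25, 27), (23, 27), (28, 29), (29, 30),
   (28, 30), (29, 26), (28, 26), (30, 31), (28, 31), (27, 31), (25, 21), (24, 21), (31, 32),
   (27, 32), (22, 32), (20, 15), (19, 15), (30, 42), (29, 42), (32, 17), (22, 17), (33, 34),
   (34, 35), (33, 35), (34, 36), (33, 36), (35, 37), (33, 37), (38, 39), (39, 40), (38, 40),
   (39, 36), (38, 36), (40, 41), (38, 41), (37, 41), (35, 42), (34, 42), (40, 43), (39, 43),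
   (41, 44), (37, 44), (45, 46), (46, 47), (45, 47), (46, 48), (45, 48), (47, 49), (45, 49),
   (50, 51), (51, 52), (50, 52), (51, 48), (50, 48), (52, 53), (50, 53), (49, 53), (47, 64),
   (46, 64), (52, 43), (51, 43), (53, 44), (49, 44), (54, 55), (55, 56), (54, 56), (55, 57),
   (54, 57), (56, 58), (54, 58), (59, 60), (60, 61), (59, 61), (60, 57), (59, 57), (61, 62),
   (59, 62), (58, 62), (56, 63), (55, 63), (61, 64), (60, 64), (62, 65), (58, 65), (66, 67),
   (67, 68), (66, 68), (67, 69), (66, 69), (68, 70), (66, 70), (71, 72), (72, 73), (71, 73),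
   (72, 69), (71, 69), (73, 74), (71, 74), (70, 74), (68, 63), (67, 63), (73, 84), (72, 84),
   (74, 65), (70, 65), (75, 76), (76, 77), (75, 77), (76, 78), (75, 78), (77, 79), (75, 79),
   (80, 81), (81, 82), (80, 82), (81, 78), (80, 78), (82, 83), (80, 83), (79, 83), (77, 84),
   (76, 84), (82, 85), (81, 85), (83, 86), (79, 86), (87, 88), (88, 89), (87, 89), (88, 90),
   (87, 90), (89, 91), (87, 91), (92, 93), (93, 94), (92, 94), (93, 90), (92, 90), (94, 95),
   (92, 95), (91, 95), (89, 16), (88, 16), (94, 85), (93, 85), (95, 86), (91, 86)]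

/-! ### The three graphs -/

lemma exists_realizes_piece25 : ∃ U, piece25.Realizes U :=
  Piece.exists_realizes (by decide +kernel) (by decide +kernel)

lemma exists_realizes_piece22 : ∃ U, piece22.Realizes U :=
  Piece.exists_realizes (by decide +kernel) (by decide +kernel)

lemma exists_realizes_piece18 : ∃ U, piece18.Realizes U :=
  Piece.exists_realizes (by decide +kernel) (by decide +kernel)

lemma exists_realizes_piece12 : ∃ U, piece12.Realizes U :=
  Piece.exists_realizes (by decide +kernel) (by decide +kernel)

lemma exists_graph_94 : ∃ G : MatchstickGraph, G.IsFourRegular ∧ G.V.card = 94 := by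
  obtain ⟨U, hU⟩ := exists_realizes_piece25
  have hring : IsRing 2 links94 (fun _ => U) (fun l => if l = 0 then 1 else -1) := by
    refine ⟨fun l hl => ?_, fun l hl => ?_, fun l hl => ?_, fun l hl => ?_, ?_⟩
    · interval_cases l <;> exact hU
    · interval_cases l <;> decide +kernel
    · interval_cases l <;> simp
    · interval_cases l
      · exact contains_intBall_one
      · exact contains_intBall_neg_one
    · simp [chainBase, links94]
  exact hring.exists_graph (T := coords94) (E := edges94) (by decide +kernel) (by decide +kernel)
    (by decide +kernel) (by decide +kernel)

lemma exists_graph_95 : ∃ G : MatchstickGraph, G.IsFourRegular ∧ G.V.card = 95 := by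
  obtain ⟨U₀, h₀⟩ := exists_realizes_piece18
  obtain ⟨U₁, h₁⟩ := exists_realizes_piece22
  obtain ⟨U₂, h₂⟩ := exists_realizes_piece12
  have c₀ : (links95 0).reflCheck = true := by decide +kernel
  have c₁ : (links95 1).reflCheck = true := by decide +kernel
  have c₂ : (links95 2).reflCheck = true := by decide +kernel
  obtain ⟨u, v, hu, hv, huv, hD, hD'⟩ := exists_triangle
    (S := ⟨63147245486017, 0, 10440380⟩) (s := true)
    (D := (links95 1).rot) (D' := (links95 2).rot)
    (Link.contains_spanBall (L := links95 1) h₁ c₁)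
    (Link.contains_spanBall (L := links95 2) h₂ c₂)
    (Link.contains_spanBall (L := links95 0) h₀ c₀) (by decide +kernel)
  have hring : IsRing 3 links95 (fun l => [U₀, U₁, U₂].getD l []) (fun l => [1, u, v].getD l 0) := by
    refine ⟨fun l hl => ?_, fun l hl => ?_, fun l hl => ?_, fun l hl => ?_, ?_⟩
    · interval_cases l
      exacts [h₀, h₁, h₂]
    · interval_cases l <;> assumption
    · interval_cases l <;> simp [hu, hv]
    · interval_cases l
      exacts [contains_intBall_one, hD, hD']
    · simpa [chainBase] using huv
  exact hring.exists_graph (T := coords95) (E := edges95) (by decide +kernel) (by decide +kernel)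
    (by decide +kernel) (by decide +kernel)

lemma exists_graph_96 : ∃ G : MatchstickGraph, G.IsFourRegular ∧ G.V.card = 96 := by
  obtain ⟨U₀, h₀⟩ := exists_realizes_piece18
  obtain ⟨U, h₂⟩ := exists_realizes_piece12
  have h₁ : piece12Turned.Realizes U := h₂
  have c₀ : (links96 0).reflCheck = true := by decide +kernel
  have c₁ : (links96 1).reflCheck = true := by decide +kernel
  have c₂ : (links96 2).reflCheck = true := by decide +kernel
  have c₃ : (links96 3).reflCheck = true := by decide +kernel
  have s₀ := Link.contains_spanBall (L := links96 0) h₀ c₀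
  have s₁ := Link.contains_spanBall (L := links96 1) h₁ c₁
  obtain ⟨t, ht, -, hB⟩ := exists_unit_of_solveCheck
    (S := ⟨80773618873661, 0, 5410933⟩) (s := true)
    (D := (links96 1).rot) s₁ (contains_intBall 8) s₀ (by decide +kernel)
  obtain ⟨u, v, hu, hv, huv, hD, hD'⟩ := exists_triangle
    (S := ⟨68811894478539, 0, 75996262⟩) (s := true)
    (D := (links96 2).rot) (D' := (links96 3).rot)
    (Link.contains_spanBall (L := links96 2) h₂ c₂)
    (Link.contains_spanBall (L := links96 3) h₁ c₃)
    (s₀.add (hB.mul s₁)) (by decide +kernel)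
  have hring : IsRing 4 links96 (fun l => [U₀, U, U, U].getD l [])
      (fun l => [1, t, u, v].getD l 0) := by
    refine ⟨fun l hl => ?_, fun l hl => ?_, fun l hl => ?_, fun l hl => ?_, ?_⟩
    · interval_cases l
      exacts [h₀, h₁, h₂, h₁]
    · interval_cases l <;> assumption
    · interval_cases l <;> simp [ht, hu, hv]
    · interval_cases l
      exacts [contains_intBall_one, hB, hD, hD']
    · simpa [chainBase] using huv
  exact hring.exists_graph (T := coords96) (E := edges96) (by decide +kernel) (by decide +kernel)
    (by decide +kernel) (by decide +kernel)

/-- There exist 4-regular matchstick graphs with exactly 94, 95 and 96 vertices. -/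
theorem exists_fourRegular_matchstick_94_95_96 :
    (∃ G : MatchstickGraph, G.IsFourRegular ∧ G.V.card = 94) ∧
    (∃ G : MatchstickGraph, G.IsFourRegular ∧ G.V.card = 95) ∧
    (∃ G : MatchstickGraph, G.IsFourRegular ∧ G.V.card = 96) := by
  exact ⟨exists_graph_94, exists_graph_95, exists_graph_96⟩
end

section
/- For every natural number n ≥ 97 there exists a 4-regular matchstick graph with exactly n vertices. -/
open scoped Classical

/-- The Euclidean plane. -/
abbrev Plane := EuclideanSpace ℝ (Fin 2)

/-- Two index pairs are different as unordered pairs, and the segments they span are disjoint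
when they have no index in common. -/
def EdgesCompatible {P : Type*} [AddCommGroup P] [Module ℝ P] (pos : ℕ → P) (e f : ℕ × ℕ) : Prop :=
  ¬(e.1 = f.1 ∧ e.2 = f.2) ∧ ¬(e.1 = f.2 ∧ e.2 = f.1) ∧
  (e.1 ≠ f.1 → e.1 ≠ f.2 → e.2 ≠ f.1 → e.2 ≠ f.2 →
    Disjoint (segment ℝ (pos e.1) (pos e.2)) (segment ℝ (pos f.1) (pos f.2)))

theorem EdgesCompatible.symm {P : Type*} [AddCommGroup P] [Module ℝ P] {pos : ℕ → P}
    {e f : ℕ × ℕ} (h : EdgesCompatible pos e f) : EdgesCompatible pos f e :=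
  ⟨fun k => h.1 ⟨k.1.symm, k.2.symm⟩, fun k => h.2.1 ⟨k.2.symm, k.1.symm⟩,
    fun h1 h2 h3 h4 => (h.2.2 h1.symm h3.symm h2.symm h4.symm).symm⟩

instance {P : Type*} [AddCommGroup P] [Module ℝ P] (pos : ℕ → P) :
    Std.Symm (EdgesCompatible pos) :=
  ⟨fun _ _ h => h.symm⟩

/-- The number of edges in a list that contain the index `i`. -/
def incidences (L : List (ℕ × ℕ)) (i : ℕ) : ℕ :=
  (L.filter fun e => e.1 == i || e.2 == i).length

theorem segment_inter_of_common_endpoint {P : Type*} [NormedAddCommGroup P] [NormedSpace ℝ P]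
    {a b c z : P} (hb : dist a b = 1) (hc : dist a c = 1) (hbc : b ≠ c)
    (h₁ : z ∈ segment ℝ a b) (h₂ : z ∈ segment ℝ a c) : z = a := by
  rw [segment_eq_image'] at h₁ h₂
  obtain ⟨s, ⟨hs0, -⟩, rfl⟩ := h₁
  obtain ⟨t, ⟨ht0, -⟩, h⟩ := h₂
  simp only [add_right_inj] at h
  have hb' : ‖b - a‖ = 1 := by rw [← dist_eq_norm, dist_comm, hb]
  have hc' : ‖c - a‖ = 1 := by rw [← dist_eq_norm, dist_comm, hc]
  have hst : t = s := by
    have := congrArg norm h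
    rwa [norm_smul, norm_smul, hb', hc', mul_one, mul_one, Real.norm_of_nonneg hs0,
      Real.norm_of_nonneg ht0] at this
  subst hst
  by_cases h0 : t = 0
  · simp [h0]
  · exact absurd (sub_left_injective (smul_right_injective P h0 h)).symm hbc

section Assembly

variable {N : ℕ} {pos : ℕ → Plane} {L : List (ℕ × ℕ)}

theorem pos_injOn (hunit : ∀ e ∈ L, dist (pos e.1) (pos e.2) = 1)
    (hpair : L.Pairwise (EdgesCompatible pos)) (hdeg : ∀ i < N, incidences L i = 4)
    {i j : ℕ} (hi : i < N) (hj : j < N) (hij : pos i = pos j) : i = j := by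
  by_contra hne
  have hnd : L.Nodup := hpair.imp fun {a b} hab h => hab.1 ⟨by rw [h], by rw [h]⟩
  have hall : ∀ e ∈ L, ∀ f ∈ L, e ≠ f → EdgesCompatible pos e f := fun e he f hf hef =>
    hpair.forall he hf hef
  obtain ⟨e, he⟩ : ∃ e, e ∈ L.filter fun e => e.1 == i || e.2 == i :=
    List.exists_mem_of_length_pos (by have := hdeg i hi; unfold incidences at this; omega)
  set F := L.filter fun e => e.1 == j || e.2 == j with hF
  have hFl : F.length = 4 := hdeg j hj
  have hFn : F.Nodup := hnd.filter _
  simp only [List.mem_filter, Bool.or_eq_true, beq_iff_eq] at he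
  have hFm : ∀ f ∈ F, f ∈ L ∧ (f.1 = j ∨ f.2 = j) := fun f hf => by
    simpa [hF] using hf
  -- an edge at `j` disjoint from `e`
  have key : ∀ f ∈ F, e.1 = f.1 ∨ e.1 = f.2 ∨ e.2 = f.1 ∨ e.2 = f.2 := by
    intro f hf
    by_contra! hcon
    obtain ⟨hfL, hfj⟩ := hFm f hf
    have hef : e ≠ f := fun h => hcon.1 (by rw [h])
    have hd := (hall e he.1 f hfL hef).2.2 hcon.1 hcon.2.1 hcon.2.2.1 hcon.2.2.2
    have h1 : pos i ∈ segment ℝ (pos e.1) (pos e.2) := by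
      rcases he.2 with h | h <;> rw [← h]
      · exact left_mem_segment _ _ _
      · exact right_mem_segment _ _ _
    have h2 : pos j ∈ segment ℝ (pos f.1) (pos f.2) := by
      rcases hfj with h | h <;> rw [← h]
      · exact left_mem_segment _ _ _
      · exact right_mem_segment _ _ _
    exact Set.disjoint_left.1 hd h1 (hij ▸ h2)
  have hloop : ∀ f ∈ L, ∀ a b, pos a = pos b → ¬(f.1 = a ∧ f.2 = b) := by
    rintro f hf a b hab ⟨rfl, rfl⟩
    have := hunit f hf
    rw [hab, dist_self] at this
    exact zero_ne_one this
  obtain ⟨c, hc⟩ : ∃ c, ∀ f ∈ F, (f.1 = j ∧ f.2 = c) ∨ (f.1 = c ∧ f.2 = j) := by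
    have a1 := hloop e he.1 i j hij
    have a2 := hloop e he.1 j i hij.symm
    have b3 : ∀ f ∈ F, ¬(f.1 = i ∧ f.2 = j) ∧ ¬(f.1 = j ∧ f.2 = i) := fun f hf =>
      ⟨hloop f (hFm f hf).1 i j hij, hloop f (hFm f hf).1 j i hij.symm⟩
    rcases he.2 with h | h
    · refine ⟨e.2, fun f hf => ?_⟩
      have b := b3 f hf
      rcases (hFm f hf).2 with h' | h' <;> rcases key f hf with k | k | k | k <;>
        clear hloop hFm key b3 hall <;> omega
    · refine ⟨e.1, fun f hf => ?_⟩
      have b := b3 f hf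
      rcases (hFm f hf).2 with h' | h' <;> rcases key f hf with k | k | k | k <;>
        clear hloop hFm key b3 hall <;> omega
  match F, hFl, hFn, hFm, hc with
  | [f, g, _, _], _, hFn, hFm, hc =>
    have hfg : f ≠ g := by
      intro h; subst h; simp at hFn
    have hcomp := hall f (hFm f (by simp)).1 g (hFm g (by simp)).1 hfg
    have c1 := hcomp.1
    have c2 := hcomp.2.1
    rcases hc f (by simp) with h | h <;> rcases hc g (by simp) with h' | h'
    · exact c1 ⟨h.1.trans h'.1.symm, h.2.trans h'.2.symm⟩
    · exact c2 ⟨h.1.trans h'.2.symm, h.2.trans h'.1.symm⟩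
    · exact c2 ⟨h.1.trans h'.2.symm, h.2.trans h'.1.symm⟩
    · exact c1 ⟨h.1.trans h'.1.symm, h.2.trans h'.2.symm⟩

/-- A list of index pairs drawn with unit edges, pairwise compatible and with four edges at every
index, is a `4`-regular matchstick graph. -/
theorem exists_matchstickGraph (hlt : ∀ e ∈ L, e.1 < N ∧ e.2 < N)
    (hunit : ∀ e ∈ L, dist (pos e.1) (pos e.2) = 1)
    (hpair : L.Pairwise (EdgesCompatible pos)) (hdeg : ∀ i < N, incidences L i = 4) :
    ∃ G : MatchstickGraph, G.IsFourRegular ∧ G.V.card = N ∧ G.V = (Finset.range N).image pos := by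
  have hinj : ∀ i < N, ∀ j < N, pos i = pos j → i = j := fun i hi j hj h =>
    pos_injOn hunit hpair hdeg hi hj h
  have hall : ∀ e ∈ L, ∀ f ∈ L, e ≠ f → EdgesCompatible pos e f := fun e he f hf hef =>
    hpair.forall he hf hef
  let S : ℕ × ℕ → Sym2 Plane := fun e => s(pos e.1, pos e.2)
  have hS : ∀ e ∈ L, ∀ f ∈ L, S e = S f → e = f := by
    intro e he f hf h
    by_contra hne
    have hc := hall e he f hf hne
    obtain ⟨e1, e2⟩ := hlt e he
    obtain ⟨f1, f2⟩ := hlt f hf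
    simp only [S, Sym2.eq_iff] at h
    rcases h with h | h
    · exact hc.1 ⟨hinj _ e1 _ f1 h.1, hinj _ e2 _ f2 h.2⟩
    · exact hc.2.1 ⟨hinj _ e1 _ f2 h.1, hinj _ e2 _ f1 h.2⟩
  have hnd : L.Nodup := hpair.imp fun {a b} hab h => hab.1 ⟨by rw [h], by rw [h]⟩
  have hV : ∀ e ∈ L, pos e.1 ∈ (Finset.range N).image pos ∧ pos e.2 ∈ (Finset.range N).image pos :=
    fun e he => ⟨Finset.mem_image_of_mem _ (Finset.mem_range.2 (hlt e he).1),
      Finset.mem_image_of_mem _ (Finset.mem_range.2 (hlt e he).2)⟩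
  have hseg : ∀ e ∈ L, ∀ f ∈ L, e ≠ f →
      segment ℝ (pos e.1) (pos e.2) ∩ segment ℝ (pos f.1) (pos f.2) ⊆
        ({pos e.1, pos e.2} : Set Plane) ∩ {pos f.1, pos f.2} := by
    rintro e he f hf hef z ⟨hz1, hz2⟩
    obtain ⟨c1, c2, c3⟩ := hall e he f hf hef
    obtain ⟨e1, e2⟩ := hlt e he
    obtain ⟨f1, f2⟩ := hlt f hf
    have ue := hunit e he
    have uf := hunit f hf
    have hz1' := hz1
    have hz2' := hz2
    rw [segment_symm] at hz1' hz2'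
    by_cases h11 : e.1 = f.1
    · rw [← h11] at hz2 uf ⊢
      have := segment_inter_of_common_endpoint ue uf
        (fun h => c1 ⟨h11, hinj _ e2 _ f2 h⟩) hz1 hz2
      simp [this]
    by_cases h12 : e.1 = f.2
    · rw [← h12] at hz2' uf ⊢
      have := segment_inter_of_common_endpoint ue (by rwa [dist_comm] at uf)
        (fun h => c2 ⟨h12, hinj _ e2 _ f1 h⟩) hz1 hz2'
      simp [this]
    by_cases h21 : e.2 = f.1
    · rw [← h21] at hz2 uf ⊢
      have := segment_inter_of_common_endpoint (by rwa [dist_comm] at ue) uf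
        (fun h => c2 ⟨hinj _ e1 _ f2 h, h21⟩) hz1' hz2
      simp [this]
    by_cases h22 : e.2 = f.2
    · rw [← h22] at hz2' uf ⊢
      have := segment_inter_of_common_endpoint (by rwa [dist_comm] at ue) (by rwa [dist_comm] at uf)
        (fun h => c1 ⟨hinj _ e1 _ f1 h, h22⟩) hz1' hz2'
      simp [this]
    · exact absurd hz2 (Set.disjoint_left.1 (c3 h11 h12 h21 h22) hz1)
  have hE : ∀ e, e ∈ (L.map S).toFinset → ∀ u v, e = s(u, v) →
      ∃ f ∈ L, (u = pos f.1 ∧ v = pos f.2) ∨ (u = pos f.2 ∧ v = pos f.1) := by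
    intro e he u v huv
    obtain ⟨f, hf, hfe⟩ := List.mem_map.1 (List.mem_toFinset.1 he)
    refine ⟨f, hf, ?_⟩
    rw [huv] at hfe
    simp only [S, Sym2.eq_iff] at hfe
    rcases hfe with h | h
    · exact Or.inl ⟨h.1.symm, h.2.symm⟩
    · exact Or.inr ⟨h.2.symm, h.1.symm⟩
  refine ⟨{ V := (Finset.range N).image pos
            E := (L.map S).toFinset
            edge_mem := ?_, edge_ne := ?_, edge_unit := ?_, noncross := ?_ }, ?_, ?_, rfl⟩
  · intro e he u v huv
    obtain ⟨f, hf, ⟨rfl, rfl⟩ | ⟨rfl, rfl⟩⟩ := hE e he u v huv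
    · exact hV f hf
    · exact (hV f hf).symm
  · intro e he hd
    obtain ⟨f, hf, rfl⟩ := List.mem_map.1 (List.mem_toFinset.1 he)
    have h1 := hunit f hf
    simp only [S, Sym2.mk_isDiag_iff] at hd
    rw [hd, dist_self] at h1
    exact zero_ne_one h1
  · intro e he u v huv
    obtain ⟨f, hf, ⟨rfl, rfl⟩ | ⟨rfl, rfl⟩⟩ := hE e he u v huv
    · exact hunit f hf
    · rw [dist_comm]; exact hunit f hf
  · intro e₁ he₁ e₂ he₂ hne u v x y h₁ h₂
    obtain ⟨f, hf, hf'⟩ := hE e₁ he₁ u v h₁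
    obtain ⟨g, hg, hg'⟩ := hE e₂ he₂ x y h₂
    have hfg : f ≠ g := by
      rintro rfl
      apply hne
      rw [h₁, h₂, Sym2.eq_iff]
      rcases hf' with ⟨rfl, rfl⟩ | ⟨rfl, rfl⟩ <;> rcases hg' with ⟨rfl, rfl⟩ | ⟨rfl, rfl⟩ <;> simp
    have := hseg f hf g hg hfg
    have sf : segment ℝ u v = segment ℝ (pos f.1) (pos f.2) ∧
        ({u, v} : Set Plane) = {pos f.1, pos f.2} := by
      rcases hf' with ⟨rfl, rfl⟩ | ⟨rfl, rfl⟩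
      · exact ⟨rfl, rfl⟩
      · exact ⟨segment_symm _ _ _, Set.pair_comm _ _⟩
    have sg : segment ℝ x y = segment ℝ (pos g.1) (pos g.2) ∧
        ({x, y} : Set Plane) = {pos g.1, pos g.2} := by
      rcases hg' with ⟨rfl, rfl⟩ | ⟨rfl, rfl⟩
      · exact ⟨rfl, rfl⟩
      · exact ⟨segment_symm _ _ _, Set.pair_comm _ _⟩
    rw [sf.1, sf.2, sg.1, sg.2]
    exact this
  · intro v hv
    obtain ⟨i, hi, rfl⟩ := Finset.mem_image.1 hv
    rw [Finset.mem_range] at hi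
    have himg : (L.map S).toFinset.filter (fun e => pos i ∈ e) =
        (L.filter fun e => e.1 == i || e.2 == i).toFinset.image S := by
      ext x
      simp only [Finset.mem_filter, List.mem_toFinset, List.mem_map, Finset.mem_image,
        List.mem_filter, Bool.or_eq_true, beq_iff_eq]
      constructor
      · rintro ⟨⟨f, hf, rfl⟩, hx⟩
        refine ⟨f, ⟨hf, ?_⟩, rfl⟩
        simp only [S, Sym2.mem_iff] at hx
        exact hx.imp (fun h => (hinj _ hi _ (hlt f hf).1 h).symm)
          (fun h => (hinj _ hi _ (hlt f hf).2 h).symm)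
      · rintro ⟨f, ⟨hf, h⟩, rfl⟩
        refine ⟨⟨f, hf, rfl⟩, ?_⟩
        simp only [S, Sym2.mem_iff]
        exact h.imp (fun h => by rw [h]) (fun h => by rw [h])
    have hcard : ((L.filter fun e => e.1 == i || e.2 == i).toFinset.image S).card = 4 := by
      rw [Finset.card_image_of_injOn, List.toFinset_card_of_nodup (hnd.filter _)]
      · exact hdeg i hi
      · intro e he f hf h
        simp only [Finset.mem_coe, List.mem_toFinset, List.mem_filter] at he hf
        exact hS e he.1 f hf.1 h
    unfold MatchstickGraph.degree
    convert hcard using 2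
  · change ((Finset.range N).image pos).card = N
    rw [Finset.card_image_of_injOn, Finset.card_range]
    intro i hi j hj h
    exact hinj i (by simpa using hi) j (by simpa using hj) h

end Assembly

/-- The straight-line drawing with vertices `pos 0, …, pos (N - 1)` and edge list `L` is a
`4`-regular matchstick drawing in `P`. -/
structure IsFourRegularDrawing {P : Type*} [NormedAddCommGroup P] [NormedSpace ℝ P] (N : ℕ)
    (pos : ℕ → P) (L : List (ℕ × ℕ)) : Prop where
  lt : ∀ e ∈ L, e.1 < N ∧ e.2 < N
  unit : ∀ e ∈ L, dist (pos e.1) (pos e.2) = 1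
  compatible : L.Pairwise (EdgesCompatible pos)
  incidences_eq : ∀ i < N, incidences L i = 4

theorem IsFourRegularDrawing.map {P Q : Type*} [NormedAddCommGroup P] [NormedSpace ℝ P]
    [NormedAddCommGroup Q] [NormedSpace ℝ Q] {N : ℕ} {pos : ℕ → P} {L : List (ℕ × ℕ)}
    (h : IsFourRegularDrawing N pos L) (φ : P →ₗᵢ[ℝ] Q) :
    IsFourRegularDrawing N (φ ∘ pos) L where
  lt := h.lt
  unit e he := by simpa [φ.dist_map] using h.unit e he
  compatible := by
    refine h.compatible.imp fun {e f} hef => ⟨hef.1, hef.2.1, fun h1 h2 h3 h4 => ?_⟩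
    have himg : ∀ a b : P, segment ℝ (φ a) (φ b) = φ '' segment ℝ a b := fun a b =>
      (image_segment ℝ φ.toLinearMap.toAffineMap a b).symm
    simp only [Function.comp_apply, himg]
    exact (Set.disjoint_image_iff φ.injective).2 (hef.2.2 h1 h2 h3 h4)
  incidences_eq := h.incidences_eq

theorem edgesCompatible_of_disjoint {P : Type*} [AddCommGroup P] [Module ℝ P] {pos : ℕ → P}
    {e f : ℕ × ℕ}
    (h : Disjoint (segment ℝ (pos e.1) (pos e.2)) (segment ℝ (pos f.1) (pos f.2))) :
    EdgesCompatible pos e f := by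
  refine ⟨fun k => ?_, fun k => ?_, fun _ _ _ _ => h⟩
  · rw [k.1] at h
    exact Set.disjoint_left.1 h (left_mem_segment _ _ _) (left_mem_segment _ _ _)
  · rw [k.1] at h
    exact Set.disjoint_left.1 h (left_mem_segment _ _ _) (right_mem_segment _ _ _)

theorem incidences_append (L M : List (ℕ × ℕ)) (i : ℕ) :
    incidences (L ++ M) i = incidences L i + incidences M i := by
  simp [incidences]

/-- Two drawings in a nontrivial space can be placed side by side. -/
theorem IsFourRegularDrawing.exists_union {P : Type*} [NormedAddCommGroup P] [NormedSpace ℝ P]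
    [Nontrivial P] {N N' : ℕ} {pos pos' : ℕ → P} {L L' : List (ℕ × ℕ)}
    (h : IsFourRegularDrawing N pos L) (h' : IsFourRegularDrawing N' pos' L') :
    ∃ (pos₂ : ℕ → P) (L₂ : List (ℕ × ℕ)), IsFourRegularDrawing (N + N') pos₂ L₂ := by
  obtain ⟨R, hR⟩ : ∃ R : ℝ, (∀ i < N, ‖pos i‖ ≤ R) ∧ ∀ i < N', ‖pos' i‖ ≤ R := by
    obtain ⟨R₁, h₁⟩ := ((Finset.range N).image fun i => ‖pos i‖).bddAbove
    obtain ⟨R₂, h₂⟩ := ((Finset.range N').image fun i => ‖pos' i‖).bddAbove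
    refine ⟨max R₁ R₂, fun i hi => ?_, fun i hi => ?_⟩
    · exact le_max_of_le_left (h₁ (Finset.mem_coe.2
        (Finset.mem_image_of_mem _ (Finset.mem_range.2 hi))))
    · exact le_max_of_le_right (h₂ (Finset.mem_coe.2
        (Finset.mem_image_of_mem _ (Finset.mem_range.2 hi))))
  obtain ⟨x, hx⟩ := NormedSpace.exists_lt_norm ℝ P (2 * R)
  refine ⟨fun n => if n < N then pos n else pos' (n - N) + x,
    L ++ L'.map fun e => (N + e.1, N + e.2), ⟨?_, ?_, ?_, ?_⟩⟩
  · intro e he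
    rcases List.mem_append.1 he with he | he
    · have := h.lt e he; omega
    · obtain ⟨f, hf, rfl⟩ := List.mem_map.1 he
      have := h'.lt f hf
      simp only
      omega
  · intro e he
    rcases List.mem_append.1 he with he | he
    · simpa [h.lt e he] using h.unit e he
    · obtain ⟨f, hf, rfl⟩ := List.mem_map.1 he
      simpa using h'.unit f hf
  · rw [List.pairwise_append]
    refine ⟨?_, ?_, ?_⟩
    · refine h.compatible.imp_of_mem fun {e f} he hf hef => ?_
      simpa [EdgesCompatible, h.lt e he, h.lt f hf] using hef
    · rw [List.pairwise_map]
      refine h'.compatible.imp fun {e f} hef => ?_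
      have himg : ∀ a b : P, segment ℝ (a + x) (b + x) = (· + x) '' segment ℝ a b := fun a b => by
        simpa [add_comm] using (segment_translate_image ℝ x a b).symm
      simp only [EdgesCompatible, ne_eq, Nat.add_left_cancel_iff, not_lt, Nat.le_add_right,
        if_neg, Nat.add_sub_cancel_left, himg]
      exact ⟨hef.1, hef.2.1, fun h1 h2 h3 h4 =>
        (Set.disjoint_image_iff (add_left_injective x)).2 (hef.2.2 h1 h2 h3 h4)⟩
    · intro e he f' hf'
      obtain ⟨f, hf, rfl⟩ := List.mem_map.1 hf'
      apply edgesCompatible_of_disjoint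
      have he' := h.lt e he
      have hf'' := h'.lt f hf
      simp only [he', if_true, not_lt, Nat.le_add_right, if_neg, Nat.add_sub_cancel_left]
      have s₁ : segment ℝ (pos e.1) (pos e.2) ⊆ Metric.closedBall 0 R :=
        (convex_closedBall 0 R).segment_subset (by simpa using hR.1 _ he'.1)
          (by simpa using hR.1 _ he'.2)
      have s₂ : segment ℝ (pos' f.1 + x) (pos' f.2 + x) ⊆ Metric.closedBall x R :=
        (convex_closedBall x R).segment_subset (by simpa [dist_eq_norm] using hR.2 _ hf''.1)
          (by simpa [dist_eq_norm] using hR.2 _ hf''.2)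
      refine Set.disjoint_of_subset s₁ s₂ (Metric.closedBall_disjoint_closedBall ?_)
      rw [dist_zero_left]
      linarith
  · intro i hi
    rw [incidences_append]
    by_cases hiN : i < N
    · have h0 : incidences (L'.map fun e => (N + e.1, N + e.2)) i = 0 := by
        rw [incidences, List.length_eq_zero_iff, List.filter_eq_nil_iff]
        intro e he
        obtain ⟨f, -, rfl⟩ := List.mem_map.1 he
        simp
        omega
      rw [h0, h.incidences_eq i hiN]
    · have h0 : incidences L i = 0 := by
        rw [incidences, List.length_eq_zero_iff, List.filter_eq_nil_iff]
        intro e he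
        have := h.lt e he
        simp
        omega
      have h1 : incidences (L'.map fun e => (N + e.1, N + e.2)) i = incidences L' (i - N) := by
        rw [incidences, incidences, List.filter_map, List.length_map]
        congr 2
        funext e
        rw [Bool.eq_iff_iff]
        simp
        omega
      rw [h0, h1, h'.incidences_eq _ (by omega)]

/-- A formal integer combination of the five generators `1 / H`, `ω / H`, `u`, `ω u`, `d` of a
design. -/
structure LatticeVector where
  a : ℤ
  b : ℤ
  c : ℤ
  e : ℤ
  f : ℤ

/-- Combinatorial description of a drawing: lattice points, apexes of isosceles triangles with legs
`d` over two lattice points (with the numerical value of the height-to-base ratio), core edges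
between lattice points, and bars between lattice points. -/
structure Design where
  H : ℕ
  c : ℕ
  root : ℕ
  lattice : List LatticeVector
  apexes : List (ℕ × ℕ × ℤ)
  core : List (ℕ × ℕ)
  bars : List (ℕ × ℕ)

/-! ### Fixed-point arithmetic, with `10 ^ 8` units -/

namespace Fixed

abbrev one : ℤ := 100000000

def add (p q : ℤ × ℤ) : ℤ × ℤ := (p.1 + q.1, p.2 + q.2)

def sub (p q : ℤ × ℤ) : ℤ × ℤ := (p.1 - q.1, p.2 - q.2)

def smul (n : ℤ) (p : ℤ × ℤ) : ℤ × ℤ := (n * p.1, n * p.2)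

def mul (p q : ℤ × ℤ) : ℤ × ℤ :=
  ((p.1 * q.1 - p.2 * q.2) / one, (p.1 * q.2 + p.2 * q.1) / one)

/-- The image of `g` under the similarity taking `0` to `p` and `1` to `q`. -/
def interp (p q g : ℤ × ℤ) : ℤ × ℤ := add p (mul (sub q p) g)

def sqrt3 : ℤ := 173205080
def sqrt5 : ℤ := 223606797
def sqrt15 : ℤ := 387298334
def barLength : ℤ := 587336307

end Fixed

/-! ### The bar -/

/-- The vertices of the bar, in coordinates in which its two ends are `0` and `1`: the tuple
`(a, b, c, e)` stands for `(a + b √5 + i √3 (c + e √5)) / 264`. -/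
def barTable : List (ℤ × ℤ × ℤ × ℤ) :=
  [(0, 0, 0, 0), (264, 0, 0, 0), (132, 0, -84, 32), (132, 0, -132, 88),
   (30, 42, -54, 30), (36, 24, -120, 52), (114, -12, -48, 34), (198, -66, -42, 38),
   (81, 21, -93, 59), (165, -33, -87, 63), (117, -21, -81, 45), (18, 12, -60, 26),
   (99, -33, -21, 19), (234, -42, -54, 30), (228, -24, -120, 52), (150, 12, -48, 34),
   (66, 66, -42, 38), (183, -21, -93, 59), (99, 33, -87, 63), (147, 21, -81, 45),
   (246, -12, -60, 26), (165, 33, -21, 19)]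

/-- The edges of the bar. -/
def barEdges : List (ℕ × ℕ) :=
  [(0, 11), (3, 8), (4, 2), (5, 2), (5, 4), (6, 4), (7, 6), (8, 4), (8, 6),
   (9, 3), (9, 6), (9, 7), (9, 8), (10, 5), (10, 7), (11, 5), (11, 10), (12, 0),
   (12, 7), (12, 10), (12, 11), (1, 20), (3, 17), (13, 2), (14, 2), (14, 13), (15, 13),
   (16, 15), (17, 13), (17, 15), (18, 3), (18, 15), (18, 16), (18, 17), (19, 14), (19, 16),
   (20, 14), (20, 19), (21, 1), (21, 16), (21, 19), (21, 20)]

def barApprox (g : ℤ × ℤ × ℤ × ℤ) : ℤ × ℤ :=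
  ((Fixed.one * g.1 + Fixed.sqrt5 * g.2.1) / 264,
    (Fixed.sqrt3 * g.2.2.1 + Fixed.sqrt15 * g.2.2.2) / 264)

/-! ### Records and the crossing test -/

/-- An edge together with (shifted) fixed-point coordinates of its ends and their sum. -/
structure EdgeRecord where
  i : ℕ
  j : ℕ
  x₁ : ℕ
  y₁ : ℕ
  x₂ : ℕ
  y₂ : ℕ
  sx : ℕ
  sy : ℕ

namespace EdgeRecord

/-- `(x, y)` lies clearly to the left of the edge. -/
def left (r : EdgeRecord) (x y : ℕ) : Bool :=
  Nat.ble (r.x₂ * r.y₁ + r.x₁ * y + r.y₂ * x + 200000000000000)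
    (r.x₂ * y + r.y₂ * r.x₁ + r.y₁ * x)

/-- `(x, y)` lies clearly to the right of the edge. -/
def right (r : EdgeRecord) (x y : ℕ) : Bool :=
  Nat.ble (r.x₂ * y + r.y₂ * r.x₁ + r.y₁ * x + 200000000000000)
    (r.x₂ * r.y₁ + r.x₁ * y + r.y₂ * x)

/-- Both ends of `s` lie clearly on the same side of `r`. -/
def oneSide (r s : EdgeRecord) : Bool :=
  (r.left s.x₁ s.y₁ && r.left s.x₂ s.y₂) || (r.right s.x₁ s.y₁ && r.right s.x₂ s.y₂)

def adjacent (r s : EdgeRecord) : Bool :=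
  (Nat.beq r.i s.i && !Nat.beq r.j s.j) || (Nat.beq r.j s.j && !Nat.beq r.i s.i) ||
  (Nat.beq r.i s.j && !Nat.beq r.j s.i) || (Nat.beq r.j s.i && !Nat.beq r.i s.j)

def compatible (r s : EdgeRecord) : Bool :=
  Nat.ble (r.sy + 201600000) s.sy || Nat.ble (s.sy + 201600000) r.sy || r.adjacent s ||
    r.oneSide s || s.oneSide r

def scan (r : EdgeRecord) (lim : ℕ) : List EdgeRecord → Bool
  | [] => true
  | s :: l => bif Nat.ble lim s.sx then true else r.compatible s && scan r lim l

def allCompatible : List EdgeRecord → Bool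
  | [] => true
  | r :: l => scan r (r.sx + 201600000) l && allCompatible l

def sorted : List EdgeRecord → Bool
  | [] => true
  | [_] => true
  | r :: s :: l => Nat.ble r.sx s.sx && sorted (s :: l)

end EdgeRecord

/-! ### Merge sort by structural recursion -/

section MergeSort

variable {α : Type*} (key : α → ℕ)

def mergeFuel : ℕ → List α → List α → List α
  | 0, l, m => l ++ m
  | _ + 1, [], m => m
  | _ + 1, a :: l, [] => a :: l
  | n + 1, a :: l, b :: m =>
    bif Nat.ble (key a) (key b) then a :: mergeFuel n l (b :: m) else b :: mergeFuel n (a :: l) m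

def mergePairs : List (List α) → List (List α)
  | [] => []
  | [l] => [l]
  | l :: m :: r => mergeFuel key 1000 l m :: mergePairs r

def mergeAll : ℕ → List (List α) → List α
  | 0, L => L.flatten
  | n + 1, L => mergeAll n (mergePairs key L)

def sortByKey (l : List α) : List α := mergeAll key 10 (l.map fun a => [a])

end MergeSort

/-! ### Call-by-value combinators, for evaluation in the kernel -/

def withNat (n : ℕ) (k : ℕ → Bool) : Bool :=
  Nat.rec (k 0) (fun m _ => k (m + 1)) n

def withList {α : Type*} (l : List α) (k : List α → Bool) : Bool :=
  List.rec (motive := fun _ => (List α → Bool) → Bool) (fun k => k [])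
    (fun a _ ih k => ih fun t => k (a :: t)) l k

def withRecord (r : EdgeRecord) (k : EdgeRecord → Bool) : Bool :=
  withNat r.i fun i => withNat r.j fun j => withNat r.x₁ fun x₁ => withNat r.y₁ fun y₁ =>
  withNat r.x₂ fun x₂ => withNat r.y₂ fun y₂ => withNat r.sx fun sx => withNat r.sy fun sy =>
  k ⟨i, j, x₁, y₁, x₂, y₂, sx, sy⟩

def withRecords (l : List EdgeRecord) (k : List EdgeRecord → Bool) : Bool :=
  List.rec (motive := fun _ => (List EdgeRecord → Bool) → Bool) (fun k => k [])
    (fun a _ ih k => withRecord a fun a => ih fun t => k (a :: t)) l k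

/-- Shift an integer by `4 * 10 ^ 9` into the natural numbers. -/
def withShifted (x : ℤ) (k : ℕ → Bool) : Bool :=
  match x + 4000000000 with
  | Int.ofNat n => withNat n k
  | Int.negSucc _ => false

def withPoints (l : List (ℤ × ℤ)) (k : List (ℕ × ℕ) → Bool) : Bool :=
  List.rec (motive := fun _ => (List (ℕ × ℕ) → Bool) → Bool) (fun k => k [])
    (fun p _ ih k => withShifted p.1 fun x => withShifted p.2 fun y => ih fun t => k ((x, y) :: t))
    l k

namespace Design

variable (D : Design)

/-! ### Fixed-point version of the drawing -/

def latticeApprox (v : LatticeVector) : ℤ × ℤ :=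
  Fixed.add
    (Fixed.add (Fixed.smul v.a (Fixed.one / D.H, 0))
      (Fixed.smul v.b (Fixed.one / (2 * D.H), Fixed.sqrt3 / (2 * D.H))))
    (Fixed.add
      (Fixed.add (Fixed.smul v.c (Fixed.one * D.c / (2 * D.H), D.root / (2 * D.H)))
        (Fixed.smul v.e (Fixed.mul (50000000, Fixed.sqrt3 / 2)
          (Fixed.one * D.c / (2 * D.H), D.root / (2 * D.H)))))
      (Fixed.smul v.f (Fixed.barLength, 0)))

def apexApprox (L : List (ℤ × ℤ)) (z : ℕ × ℕ × ℤ) : ℤ × ℤ :=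
  Fixed.interp (L.getD z.1 (0, 0)) (L.getD z.2.1 (0, 0)) (50000000, z.2.2)

def hubsApprox : List (ℤ × ℤ) :=
  D.lattice.map D.latticeApprox ++ D.apexes.map (apexApprox (D.lattice.map D.latticeApprox))

/-! ### Numbering -/

def numHubs : ℕ := D.lattice.length + D.apexes.length

def apexBars : ℕ → List (ℕ × ℕ × ℤ) → List (ℕ × ℕ)
  | _, [] => []
  | m, z :: l => (z.1, m) :: (m, z.2.1) :: apexBars (m + 1) l

def allBars : List (ℕ × ℕ) := D.bars ++ apexBars D.lattice.length D.apexes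

/-- The number of vertices. -/
def order : ℕ := D.numHubs + 20 * D.allBars.length

/-- The global number of the `k`-th vertex of a bar whose inner vertices are numbered from `m`. -/
def barLabel (m : ℕ) (b : ℕ × ℕ) : ℕ → ℕ
  | 0 => b.1
  | 1 => b.2
  | k + 2 => m + k

/-! ### The checks -/

def checkParameters : Bool :=
  Nat.ble 1 D.H && Nat.ble D.c 1 &&
  Nat.ble (D.root * D.root) (10000000000000000 * (4 * D.H * D.H - D.c)) &&
  Nat.ble (10000000000000000 * (4 * D.H * D.H - D.c)) ((D.root + 1) * (D.root + 1)) 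

def smallVector (v : LatticeVector) : Bool :=
  Nat.ble (v.a.natAbs + v.b.natAbs + v.c.natAbs + v.e.natAbs + v.f.natAbs) 30

/-- `w - v` is a unit vector. -/
def isUnitStep (v w : LatticeVector) : Bool :=
  (w.f == v.f) &&
  (((w.c == v.c && w.e == v.e) &&
      ((w.a - v.a) * (w.a - v.a) + (w.a - v.a) * (w.b - v.b) + (w.b - v.b) * (w.b - v.b)
        == (D.H : ℤ) * D.H)) ||
    (((w.c - v.c) * (w.c - v.c) + (w.c - v.c) * (w.e - v.e) + (w.e - v.e) * (w.e - v.e) == 1) &&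
      ((w.a == v.a && w.b == v.b) ||
        (w.a - v.a == -(D.c * (w.c - v.c)) && w.b - v.b == -(D.c * (w.e - v.e))))))

/-- `w - v` is `d` or `-d`. -/
def isBarStep (v w : LatticeVector) : Bool :=
  (w.a == v.a && w.b == v.b) && (w.c == v.c && w.e == v.e) &&
    ((w.f - v.f) * (w.f - v.f) == 1)

def vector (i : ℕ) : LatticeVector := D.lattice.getD i ⟨0, 0, 0, 0, 0⟩

def checkEdge (e : ℕ × ℕ) : Bool :=
  Nat.blt e.1 D.lattice.length && Nat.blt e.2 D.lattice.length &&
    D.isUnitStep (D.vector e.1) (D.vector e.2)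

def checkBar (e : ℕ × ℕ) : Bool :=
  Nat.blt e.1 D.lattice.length && Nat.blt e.2 D.lattice.length &&
    isBarStep (D.vector e.1) (D.vector e.2)

def intLe (x y : ℤ) : Bool := decide (x ≤ y)

def sqNorm (p : ℤ × ℤ) : ℤ := p.1 * p.1 + p.2 * p.2

/-- The height-to-base ratio recorded with an apex is accurate to `10 ^ (-4)`. -/
def checkApex (z : ℕ × ℕ × ℤ) : Bool :=
  Nat.blt z.1 D.lattice.length && Nat.blt z.2.1 D.lattice.length &&
    (fun g : ℤ =>
      intLe 50000000000000000 g && intLe g 1380000000000000000 && intLe 10000 z.2.2 &&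
      intLe (((z.2.2 - 10000) * (z.2.2 - 10000) + 2500000000000000) * (g + 1200000000000))
        (Fixed.barLength * Fixed.barLength * 10000000000000000) &&
      intLe ((Fixed.barLength + 1) * (Fixed.barLength + 1) * 10000000000000000)
        (((z.2.2 + 10000) * (z.2.2 + 10000) + 2500000000000000) * (g - 1200000000000)))
    (sqNorm (Fixed.sub (D.latticeApprox (D.vector z.1)) (D.latticeApprox (D.vector z.2.1))))

def edgeRecord (i j : ℕ) (p q : ℕ × ℕ) : EdgeRecord :=
  ⟨i, j, p.1, p.2, q.1, q.2, p.1 + q.1, p.2 + q.2⟩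

def coreRecords (A : List (ℕ × ℕ)) : List EdgeRecord :=
  D.core.map fun e => edgeRecord e.1 e.2 (A.getD e.1 (0, 0)) (A.getD e.2 (0, 0))

def barPointsApprox (b : ℕ × ℕ) : List (ℤ × ℤ) :=
  barTable.map fun g =>
    Fixed.interp (D.hubsApprox.getD b.1 (0, 0)) (D.hubsApprox.getD b.2 (0, 0)) (barApprox g)

def barRecords (m : ℕ) (b : ℕ × ℕ) (B : List (ℕ × ℕ)) : List EdgeRecord :=
  barEdges.map fun e =>
    edgeRecord (barLabel m b e.1) (barLabel m b e.2) (B.getD e.1 (0, 0)) (B.getD e.2 (0, 0))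

def withBarRecords : List (ℕ × ℕ) → ℕ → List EdgeRecord → (List EdgeRecord → Bool) → Bool
  | [], _, acc, k => k acc
  | b :: l, m, acc, k => withPoints (D.barPointsApprox b) fun B =>
      withBarRecords l (m + 20) (barRecords m b B ++ acc) k

def endpoints (R : List EdgeRecord) : List ℕ := R.flatMap fun r => [r.i, r.j]

/-- The list is `m, m, m, m, m + 1, m + 1, m + 1, m + 1, …` with `n` quadruples. -/
def isFourfold : ℕ → ℕ → List ℕ → Bool
  | m, n + 1, a :: b :: c :: d :: l =>
    Nat.beq a m && Nat.beq b m && Nat.beq c m && Nat.beq d m && isFourfold (m + 1) n l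
  | _, 0, [] => true
  | _, _, _ => false

def checkRecords (R : List EdgeRecord) : Bool :=
  isFourfold 0 D.order (sortByKey id (endpoints R)) &&
    withList (sortByKey EdgeRecord.sx R) fun R =>
      EdgeRecord.sorted R && EdgeRecord.allCompatible R

def check : Bool :=
  D.checkParameters && D.lattice.all smallVector && D.core.all D.checkEdge &&
  D.bars.all D.checkBar && D.apexes.all D.checkApex &&
  withPoints D.hubsApprox fun A =>
    D.withBarRecords D.allBars D.numHubs (D.coreRecords A) fun R => withRecords R D.checkRecords

end Design

/-! ### Error bounds for the fixed-point arithmetic -/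

namespace Fixed

/-- The complex number with given integer coordinates. -/
def toComplex (p : ℤ × ℤ) : ℂ := ⟨p.1, p.2⟩

/-- `p` represents `z` up to an error of `ε` units. -/
def Near (ε : ℝ) (z : ℂ) (p : ℤ × ℤ) : Prop := ‖100000000 * z - toComplex p‖ ≤ ε

variable {ε δ : ℝ} {z w : ℂ} {p q : ℤ × ℤ}

theorem Near.mono (h : Near ε z p) (hε : ε ≤ δ) : Near δ z p := le_trans h hε

theorem near_of_re_im (hre : |100000000 * z.re - p.1| ≤ ε) (him : |100000000 * z.im - p.2| ≤ δ) :
    Near (ε + δ) z p := by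
  refine (Complex.norm_le_abs_re_add_abs_im _).trans (add_le_add ?_ ?_)
  · simpa [toComplex] using hre
  · simpa [toComplex] using him

theorem Near.re_im (h : Near ε z p) :
    |100000000 * z.re - p.1| ≤ ε ∧ |100000000 * z.im - p.2| ≤ ε := by
  constructor
  · refine le_trans ?_ h
    simpa [toComplex] using Complex.abs_re_le_norm (100000000 * z - toComplex p)
  · refine le_trans ?_ h
    simpa [toComplex] using Complex.abs_im_le_norm (100000000 * z - toComplex p)

theorem toComplex_add : toComplex (add p q) = toComplex p + toComplex q := by
  apply Complex.ext <;> simp [toComplex, add]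

theorem toComplex_sub : toComplex (sub p q) = toComplex p - toComplex q := by
  apply Complex.ext <;> simp [toComplex, sub]

theorem toComplex_smul (n : ℤ) : toComplex (smul n p) = n * toComplex p := by
  apply Complex.ext <;> simp [toComplex, smul]

theorem Near.add (h : Near ε z p) (h' : Near δ w q) : Near (ε + δ) (z + w) (add p q) := by
  unfold Near at *
  rw [toComplex_add, show 100000000 * (z + w) - (toComplex p + toComplex q) =
    (100000000 * z - toComplex p) + (100000000 * w - toComplex q) by ring]
  exact (norm_add_le _ _).trans (add_le_add h h')

theorem Near.sub (h : Near ε z p) (h' : Near δ w q) : Near (ε + δ) (z - w) (sub p q) := by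
  unfold Near at *
  rw [toComplex_sub, show 100000000 * (z - w) - (toComplex p - toComplex q) =
    (100000000 * z - toComplex p) - (100000000 * w - toComplex q) by ring]
  exact (norm_sub_le _ _).trans (add_le_add h h')

theorem Near.smul (h : Near ε z p) (n : ℤ) : Near (|(n : ℝ)| * ε) (n * z) (smul n p) := by
  unfold Near at *
  rw [toComplex_smul, show 100000000 * (n * z) - n * toComplex p =
    n * (100000000 * z - toComplex p) by ring, norm_mul, Complex.norm_intCast]
  exact mul_le_mul_of_nonneg_left h (abs_nonneg _)

theorem abs_div_sub_ediv_le (n : ℤ) {m : ℤ} (hm : 0 < m) :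
    |(n : ℝ) / m - ((n / m : ℤ) : ℝ)| ≤ 1 := by
  have hm' : (0 : ℝ) < m := by exact_mod_cast hm
  have h1 : ((n / m : ℤ) : ℝ) * m ≤ n := by exact_mod_cast Int.ediv_mul_le n hm.ne'
  have h2 : (n : ℝ) < (((n / m : ℤ) : ℝ) + 1) * m := by
    exact_mod_cast Int.lt_ediv_add_one_mul_self n hm
  rw [abs_le]
  constructor
  · have := (le_div_iff₀ hm').2 h1; linarith
  · have := (div_lt_iff₀ hm').2 h2; linarith

theorem abs_div_sub_ediv_le' {x : ℝ} {n m : ℤ} (hm : 2 ≤ m) (h : |x - n| ≤ 1) :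
    |x / m - ((n / m : ℤ) : ℝ)| ≤ 3 / 2 := by
  have h1 := abs_div_sub_ediv_le n (m := m) (by omega)
  have hm' : (2 : ℝ) ≤ m := by exact_mod_cast hm
  have h2 : |x / m - n / m| ≤ 1 / 2 := by
    rw [← sub_div, abs_div, abs_of_pos (by linarith : (0 : ℝ) < m)]
    rw [div_le_div_iff₀ (by linarith) (by norm_num)]
    linarith
  calc |x / m - ((n / m : ℤ) : ℝ)| = |(x / m - n / m) + (n / m - ((n / m : ℤ) : ℝ))| := by ring_nf
    _ ≤ _ := abs_add_le _ _
    _ ≤ 3 / 2 := by linarith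

theorem norm_toComplex_mul_sub_le :
    ‖toComplex p * toComplex q / 100000000 - toComplex (mul p q)‖ ≤ 2 := by
  refine (Complex.norm_le_abs_re_add_abs_im _).trans ?_
  have h1 := abs_div_sub_ediv_le (p.1 * q.1 - p.2 * q.2) (m := one) (by norm_num)
  have h2 := abs_div_sub_ediv_le (p.1 * q.2 + p.2 * q.1) (m := one) (by norm_num)
  have e : toComplex p * toComplex q / 100000000 =
      ((1 / 100000000 : ℝ) : ℂ) * (toComplex p * toComplex q) := by push_cast; ring
  rw [e]
  simp only [toComplex, mul, Complex.sub_re, Complex.sub_im, Complex.mul_re, Complex.mul_im,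
    Complex.ofReal_re, Complex.ofReal_im, zero_mul, sub_zero, add_zero]
  push_cast at h1 h2
  rw [show (1 / 100000000 : ℝ) * ((p.1 : ℝ) * q.1 - p.2 * q.2) =
    ((p.1 : ℝ) * q.1 - p.2 * q.2) / 100000000 by ring,
    show (1 / 100000000 : ℝ) * ((p.1 : ℝ) * q.2 + p.2 * q.1) =
    ((p.1 : ℝ) * q.2 + p.2 * q.1) / 100000000 by ring]
  linarith

theorem Near.mul (h : Near ε z p) (h' : Near δ w q) :
    Near (ε * ‖w‖ + δ * ‖z‖ + ε * δ / 100000000 + 2) (z * w) (mul p q) := by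
  unfold Near at *
  have e : 100000000 * (z * w) - toComplex (Fixed.mul p q) =
      (100000000 * z - toComplex p) * w + (100000000 * w - toComplex q) * z -
      (100000000 * z - toComplex p) * (100000000 * w - toComplex q) / 100000000 +
      (toComplex p * toComplex q / 100000000 - toComplex (Fixed.mul p q)) := by ring
  rw [e]
  have hε : 0 ≤ ε := (norm_nonneg _).trans h
  refine (norm_add_le _ _).trans (add_le_add ?_ norm_toComplex_mul_sub_le)
  refine (norm_sub_le _ _).trans (add_le_add ((norm_add_le _ _).trans (add_le_add ?_ ?_)) ?_)
  · rw [norm_mul]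
    exact mul_le_mul_of_nonneg_right h (norm_nonneg _)
  · rw [norm_mul]
    exact mul_le_mul_of_nonneg_right h' (norm_nonneg _)
  · rw [norm_div, norm_mul, Complex.norm_ofNat]
    exact div_le_div_of_nonneg_right (mul_le_mul h h' (norm_nonneg _) hε) (by norm_num)

theorem Near.interp {γ : ℂ} {g : ℤ × ℤ} {η : ℝ} (hz : Near ε z p) (hw : Near ε w q)
    (hγ : Near η γ g) :
    Near (ε + (2 * ε * ‖γ‖ + η * ‖w - z‖ + 2 * ε * η / 100000000 + 2)) (z + (w - z) * γ)
      (interp p q g) := by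
  have := hz.add ((hw.sub hz).mul hγ)
  rwa [← two_mul] at this

end Fixed

open Fixed

/-! ### The exact drawing -/

/-- The sixth root of unity `exp (i π / 3)`. -/
noncomputable def omega : ℂ := ⟨1 / 2, √3 / 2⟩

/-- The distance between the two ends of a bar. -/
noncomputable def barLen : ℝ := √((687 + 279 * √5) / 38)

theorem sqrt3_bounds : |100000000 * √3 - Fixed.sqrt3| ≤ 1 := by
  have h1 : (1.7320508 : ℝ) ≤ √3 := Real.le_sqrt_of_sq_le (by norm_num)
  have h2 : √3 ≤ 1.73205081 := Real.sqrt_le_iff.2 (by norm_num)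
  rw [abs_le]; norm_num [Fixed.sqrt3]; constructor <;> linarith

theorem sqrt5_bounds : (2.23606797 : ℝ) ≤ √5 ∧ √5 ≤ 2.23606798 :=
  ⟨Real.le_sqrt_of_sq_le (by norm_num), Real.sqrt_le_iff.2 (by norm_num)⟩

theorem abs_sqrt5_sub_le : |100000000 * √5 - Fixed.sqrt5| ≤ 1 := by
  obtain ⟨h1, h2⟩ := sqrt5_bounds
  rw [abs_le]; norm_num [Fixed.sqrt5]; constructor <;> linarith

theorem abs_sqrt15_sub_le : |100000000 * (√3 * √5) - Fixed.sqrt15| ≤ 1 := by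
  rw [← Real.sqrt_mul (by norm_num)]
  have h1 : (3.87298334 : ℝ) ≤ √(3 * 5) := Real.le_sqrt_of_sq_le (by norm_num)
  have h2 : √(3 * 5) ≤ (3.87298335 : ℝ) := Real.sqrt_le_iff.2 (by norm_num)
  rw [abs_le]; norm_num [Fixed.sqrt15]; norm_num at h1 h2; constructor <;> linarith

theorem barLen_sq : barLen ^ 2 = (687 + 279 * √5) / 38 :=
  Real.sq_sqrt (by positivity)

theorem barLen_bounds : (5.87336307 : ℝ) ≤ barLen ∧ barLen ≤ 5.87336308 := by
  obtain ⟨h1, h2⟩ := sqrt5_bounds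
  exact ⟨Real.le_sqrt_of_sq_le (by norm_num; linarith),
    Real.sqrt_le_iff.2 ⟨by norm_num, by norm_num; linarith⟩⟩

theorem barLen_pos : 0 < barLen := by linarith [barLen_bounds.1]

theorem norm_sq_add_mul_omega (a b : ℝ) : ‖(a + b * omega : ℂ)‖ ^ 2 = a * a + a * b + b * b := by
  rw [Complex.sq_norm, Complex.normSq_apply]
  simp [omega]
  ring_nf
  norm_num
  ring

theorem norm_omega : ‖omega‖ = 1 := by
  have h := norm_sq_add_mul_omega 0 1
  norm_num at h
  exact h.resolve_right fun h => by linarith [norm_nonneg omega]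

namespace Design

variable (D : Design)

/-- The unit vector `u` of a design. -/
noncomputable def unit : ℂ := ⟨D.c / (2 * D.H), √(4 * D.H * D.H - D.c) / (2 * D.H)⟩

/-- The position of a lattice point. -/
noncomputable def linear (v : LatticeVector) : ℂ :=
  (v.a * (1 / D.H) + v.b * (omega / D.H)) + ((v.c * D.unit + v.e * (omega * D.unit)) + v.f * barLen)

theorem le_four_mul_mul {c H : ℕ} (hH : 1 ≤ H) (hc : c ≤ 1) : c ≤ 4 * H * H := by
  nlinarith [Nat.mul_le_mul hH hH]

theorem parameters (h : D.checkParameters = true) : 1 ≤ D.H ∧ D.c ≤ 1 ∧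
    |100000000 * √(4 * D.H * D.H - D.c) - D.root| ≤ 1 := by
  simp only [checkParameters, Bool.and_eq_true, Nat.ble_eq] at h
  obtain ⟨⟨⟨h1, h2⟩, h3⟩, h4⟩ := h
  refine ⟨h1, h2, ?_⟩
  have hle := le_four_mul_mul h1 h2
  have h3' : (D.root : ℝ) * D.root ≤ 10000000000000000 * (4 * D.H * D.H - D.c) := by
    exact_mod_cast h3
  have h4' : 10000000000000000 * (4 * D.H * D.H - D.c) ≤ ((D.root : ℝ) + 1) * (D.root + 1) := by
    exact_mod_cast h4
  have h0 : (0 : ℝ) ≤ 4 * D.H * D.H - D.c := by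
    have : (D.c : ℝ) ≤ 4 * D.H * D.H := by exact_mod_cast hle
    linarith
  have hs := Real.mul_self_sqrt h0
  have hs0 := Real.sqrt_nonneg (4 * (D.H : ℝ) * D.H - D.c)
  set s := √(4 * (D.H : ℝ) * D.H - D.c)
  have hr : (0 : ℝ) ≤ D.root := Nat.cast_nonneg _
  rw [abs_le]
  constructor
  · nlinarith
  · nlinarith

variable {D}

theorem norm_unit (h : D.checkParameters = true) : ‖D.unit‖ = 1 ∧ ‖D.unit - D.c / D.H‖ = 1 := by
  obtain ⟨h1, h2, -⟩ := D.parameters h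
  have hle := le_four_mul_mul h1 h2
  have h0 : (0 : ℝ) ≤ 4 * D.H * D.H - D.c := by
    have : (D.c : ℝ) ≤ 4 * D.H * D.H := by exact_mod_cast hle
    linarith
  have hH : (D.H : ℝ) ≠ 0 := by positivity
  have hc : (D.c : ℝ) * D.c = D.c := by interval_cases D.c <;> norm_num
  have hs := Real.mul_self_sqrt h0
  have key : ‖D.unit‖ ^ 2 = 1 ∧ ‖D.unit - D.c / D.H‖ ^ 2 = 1 := by
    constructor
    · rw [Complex.sq_norm, Complex.normSq_apply]
      simp only [unit]
      set s := √(4 * (D.H : ℝ) * D.H - D.c)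
      field_simp
      linear_combination hs + hc
    · rw [Complex.sq_norm, Complex.normSq_apply]
      have e : ((D.c : ℂ) / D.H) = ((D.c / D.H : ℝ) : ℂ) := by push_cast; rfl
      rw [e]
      simp only [unit, Complex.sub_re, Complex.sub_im, Complex.ofReal_re, Complex.ofReal_im]
      set s := √(4 * (D.H : ℝ) * D.H - D.c)
      field_simp
      linear_combination hs + hc
  constructor
  · exact (pow_eq_one_iff_of_nonneg (norm_nonneg _) two_ne_zero).1 key.1
  · exact (pow_eq_one_iff_of_nonneg (norm_nonneg _) two_ne_zero).1 key.2

theorem linear_sub (v w : LatticeVector) : D.linear w - D.linear v =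
    ((((w.a - v.a : ℤ) : ℝ) + ((w.b - v.b : ℤ) : ℝ) * omega) / D.H +
      (((w.c - v.c : ℤ) : ℝ) + ((w.e - v.e : ℤ) : ℝ) * omega) * D.unit) +
      ((w.f - v.f : ℤ) : ℝ) * barLen := by
  simp only [linear]
  push_cast
  ring

theorem norm_linear_sub_of_isUnitStep (h : D.checkParameters = true) {v w : LatticeVector}
    (hvw : D.isUnitStep v w = true) : ‖D.linear w - D.linear v‖ = 1 := by
  obtain ⟨hH, -, -⟩ := D.parameters h
  obtain ⟨hu, hu'⟩ := norm_unit h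
  have hH' : (0 : ℝ) < D.H := by exact_mod_cast hH
  have hH'' : (D.H : ℂ) ≠ 0 := by exact_mod_cast hH'.ne'
  simp only [isUnitStep, Bool.and_eq_true, Bool.or_eq_true, beq_iff_eq] at hvw
  rw [linear_sub]
  obtain ⟨hf, hvw⟩ := hvw
  rw [hf, sub_self, Int.cast_zero, Complex.ofReal_zero, zero_mul, add_zero]
  have norm_eq {a b k : ℤ} (hk : 0 ≤ k) (hab : a * a + a * b + b * b = k * k) :
      ‖((a : ℝ) + (b : ℝ) * omega : ℂ)‖ = k := by
    have h1 := norm_sq_add_mul_omega a b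
    have h2 : (a : ℝ) * a + a * b + b * b = (k : ℝ) ^ 2 := by
      rw [sq]; exact_mod_cast hab
    rw [h2] at h1
    exact (pow_left_inj₀ (norm_nonneg _) (by exact_mod_cast hk) two_ne_zero).1 h1
  rcases hvw with ⟨⟨hc, he⟩, hab⟩ | ⟨hce, ⟨ha, hb⟩ | ⟨ha, hb⟩⟩
  · rw [hc, he, sub_self, sub_self, Int.cast_zero, Complex.ofReal_zero, zero_mul, add_zero,
      zero_mul, add_zero, norm_div, norm_eq (Int.natCast_nonneg _) hab, Complex.norm_natCast,
      Int.cast_natCast, div_self hH'.ne']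
  · rw [ha, hb, sub_self, sub_self, Int.cast_zero, Complex.ofReal_zero, zero_mul, add_zero,
      zero_div, zero_add, norm_mul, hu, norm_eq zero_le_one (hce.trans (one_mul 1).symm)]
    simp
  · rw [ha, hb]
    generalize w.c - v.c = c at *
    generalize w.e - v.e = e at *
    rw [show ((((-(D.c * c) : ℤ) : ℝ) : ℂ) + ((-(D.c * e) : ℤ) : ℝ) * omega) / D.H +
      ((c : ℝ) + (e : ℝ) * omega) * D.unit = ((c : ℝ) + (e : ℝ) * omega) * (D.unit - D.c / D.H) by
        push_cast; field_simp; ring, norm_mul, hu',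
      norm_eq zero_le_one (hce.trans (one_mul 1).symm)]
    simp

theorem norm_linear_sub_of_isBarStep {v w : LatticeVector}
    (hvw : isBarStep v w = true) : ‖D.linear w - D.linear v‖ = barLen := by
  simp only [isBarStep, Bool.and_eq_true, beq_iff_eq] at hvw
  obtain ⟨⟨⟨ha, hb⟩, hc, he⟩, hf⟩ := hvw
  rw [linear_sub, ha, hb, hc, he]
  have : |((w.f - v.f : ℤ) : ℝ)| = 1 := by
    rw [← Int.cast_abs]
    have : |w.f - v.f| = 1 := by
      rcases mul_self_eq_one_iff.1 hf with h | h <;> simp [h]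
    exact_mod_cast this
  simp only [sub_self, Int.cast_zero, Complex.ofReal_zero, zero_mul, add_zero, zero_div, zero_add,
    norm_mul, Complex.norm_real, Real.norm_eq_abs, this, abs_of_pos barLen_pos, one_mul]

end Design

namespace Fixed

variable {ε δ : ℝ} {z w : ℂ} {p q : ℤ × ℤ}

theorem abs_div_sub_ediv_le_two {x : ℝ} {n m : ℤ} (hm : 0 < m) (h : |x - n| ≤ m) :
    |x / m - ((n / m : ℤ) : ℝ)| ≤ 2 := by
  have h1 := abs_div_sub_ediv_le n hm
  have hm' : (0 : ℝ) < m := by exact_mod_cast hm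
  have h2 : |x / m - n / m| ≤ 1 := by
    rw [← sub_div, abs_div, abs_of_pos hm']
    exact (div_le_one hm').2 h
  calc |x / m - ((n / m : ℤ) : ℝ)| = |(x / m - n / m) + (n / m - ((n / m : ℤ) : ℝ))| := by ring_nf
    _ ≤ _ := abs_add_le _ _
    _ ≤ 2 := by linarith

theorem norm_toComplex_sq : ‖toComplex p‖ ^ 2 = (Design.sqNorm p : ℝ) := by
  rw [Complex.sq_norm, Complex.normSq_apply]
  simp [toComplex, Design.sqNorm]

theorem Near.abs_norm_sub_le (h : Near ε z p) : |100000000 * ‖z‖ - ‖toComplex p‖| ≤ ε := by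
  refine le_trans ?_ h
  have := abs_norm_sub_norm_le (100000000 * z) (toComplex p)
  rwa [norm_mul, Complex.norm_ofNat] at this

theorem near_omega : Near (3 / 2) omega (50000000, Fixed.sqrt3 / 2) := by
  have := near_of_re_im (z := omega) (p := (50000000, Fixed.sqrt3 / 2)) (ε := 0) (δ := 3 / 2)
    (by norm_num [omega]) (by
      have := abs_div_sub_ediv_le' (m := 2) le_rfl sqrt3_bounds
      simpa only [omega, ← mul_div_assoc, Int.cast_ofNat] using this)
  exact this.mono (by norm_num)

theorem near_barLen : Near 1 barLen (Fixed.barLength, 0) := by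
  obtain ⟨h1, h2⟩ := barLen_bounds
  have := near_of_re_im (z := barLen) (p := (Fixed.barLength, 0)) (ε := 1) (δ := 0)
    (by
      rw [abs_le, Complex.ofReal_re]; norm_num [barLength]; constructor <;> linarith)
    (by simp)
  exact this.mono (by norm_num)

end Fixed

namespace Design

variable {D : Design}

theorem near_linear (h : D.checkParameters = true) {v : LatticeVector}
    (hv : smallVector v = true) : Near 210 (D.linear v) (D.latticeApprox v) := by
  obtain ⟨hH, -, hr⟩ := D.parameters h
  have hH0 : (0 : ℤ) < D.H := by omega
  have hH2 : (2 : ℤ) ≤ 2 * D.H := by omega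
  have h1 : Near 7 (1 / D.H) (Fixed.one / D.H, 0) := by
    refine (near_of_re_im (ε := 1) (δ := 0) ?_ ?_).mono (by norm_num)
    · have := abs_div_sub_ediv_le one hH0
      rw [Complex.div_natCast_re, Complex.one_re, mul_one_div]
      simpa using this
    · simp
  have h2 : Near 7 (omega / D.H) (Fixed.one / (2 * D.H), Fixed.sqrt3 / (2 * D.H)) := by
    refine (near_of_re_im (ε := 1) (δ := 3 / 2) ?_ ?_).mono (by norm_num)
    · have := abs_div_sub_ediv_le one (m := 2 * D.H) (by omega)
      rw [Complex.div_natCast_re]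
      convert this using 3
      simp only [omega]
      push_cast
      ring
    · have := abs_div_sub_ediv_le' hH2 sqrt3_bounds
      rw [Complex.div_natCast_im]
      convert this using 3
      simp only [omega]
      push_cast
      ring
  have h3 : Near (5 / 2) D.unit (Fixed.one * D.c / (2 * D.H), D.root / (2 * D.H)) := by
    refine (near_of_re_im (ε := 1) (δ := 3 / 2) ?_ ?_).mono (by norm_num)
    · have := abs_div_sub_ediv_le (one * D.c) (m := 2 * D.H) (by omega)
      convert this using 3
      simp only [unit]
      push_cast
      ring
    · have := abs_div_sub_ediv_le' (n := D.root) hH2 hr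
      convert this using 3
      simp only [unit]
      push_cast
      ring
  have h4 := (near_omega.mul h3).mono (δ := 7) (by
    rw [norm_omega, (norm_unit h).1]; norm_num)
  have hsum := (((h1.smul v.a).add (h2.smul v.b)).add
    ((((h3.mono (δ := 7) (by norm_num)).smul v.c).add (h4.smul v.e)).add
      ((near_barLen.mono (δ := 7) (by norm_num)).smul v.f)))
  have hlin : D.linear v = (v.a * (1 / D.H) + v.b * (omega / D.H)) +
      ((v.c * D.unit + v.e * (omega * D.unit)) + v.f * barLen) := by
    simp [linear]
  rw [hlin]
  refine hsum.mono ?_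
  rw [smallVector, Nat.ble_eq] at hv
  have hv' : (v.a.natAbs + v.b.natAbs + v.c.natAbs + v.e.natAbs + v.f.natAbs : ℝ) ≤ 30 := by
    exact_mod_cast hv
  simp only [Nat.cast_natAbs, Int.cast_abs] at hv'
  linarith

end Design

/-! ### Exact bar points -/

/-- The position of a bar vertex relative to the ends `0` and `1`. -/
noncomputable def barPoint (g : ℤ × ℤ × ℤ × ℤ) : ℂ :=
  ⟨(g.1 + √5 * g.2.1) / 264, (√3 * g.2.2.1 + √3 * √5 * g.2.2.2) / 264⟩

theorem barTable_bounds : ∀ g ∈ barTable, |g.2.1| ≤ 264 ∧ |g.2.2.1| + |g.2.2.2| ≤ 264 ∧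
    Design.sqNorm (barApprox g) ≤ 100000000 * 100000000 := by
  decide +kernel

theorem near_barPoint {g : ℤ × ℤ × ℤ × ℤ} (hg : g ∈ barTable) :
    Near 4 (barPoint g) (barApprox g) := by
  obtain ⟨h1, h2, -⟩ := barTable_bounds g hg
  have h1' : |(g.2.1 : ℝ)| ≤ 264 := by exact_mod_cast h1
  have h2' : |(g.2.2.1 : ℝ)| + |(g.2.2.2 : ℝ)| ≤ 264 := by exact_mod_cast h2
  refine (near_of_re_im (ε := 2) (δ := 2) ?_ ?_).mono (by norm_num)
  · have hx : |(100000000 * (g.1 + √5 * g.2.1) : ℝ) -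
        ((Fixed.one * g.1 + Fixed.sqrt5 * g.2.1 : ℤ) : ℝ)| ≤ ((264 : ℤ) : ℝ) := by
      have e : (100000000 * (g.1 + √5 * g.2.1) : ℝ) -
        ((Fixed.one * g.1 + Fixed.sqrt5 * g.2.1 : ℤ) : ℝ) =
          (100000000 * √5 - Fixed.sqrt5) * g.2.1 := by push_cast; ring
      rw [e, abs_mul]
      have := mul_le_mul abs_sqrt5_sub_le h1' (abs_nonneg _) zero_le_one
      push_cast
      linarith
    have := abs_div_sub_ediv_le_two (by norm_num) hx
    convert this using 3
    · simp only [barPoint]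
      push_cast
      ring
    · rfl
  · have hx : |(100000000 * (√3 * g.2.2.1 + √3 * √5 * g.2.2.2) : ℝ) -
        ((Fixed.sqrt3 * g.2.2.1 + Fixed.sqrt15 * g.2.2.2 : ℤ) : ℝ)| ≤ ((264 : ℤ) : ℝ) := by
      have e : (100000000 * (√3 * g.2.2.1 + √3 * √5 * g.2.2.2) : ℝ) -
        ((Fixed.sqrt3 * g.2.2.1 + Fixed.sqrt15 * g.2.2.2 : ℤ) : ℝ) =
          (100000000 * √3 - Fixed.sqrt3) * g.2.2.1 +
            (100000000 * (√3 * √5) - Fixed.sqrt15) * g.2.2.2 := by push_cast; ring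
      rw [e]
      refine (abs_add_le _ _).trans ?_
      rw [abs_mul, abs_mul]
      have := mul_le_mul_of_nonneg_right sqrt3_bounds (abs_nonneg (g.2.2.1 : ℝ))
      have := mul_le_mul_of_nonneg_right abs_sqrt15_sub_le (abs_nonneg (g.2.2.2 : ℝ))
      push_cast
      linarith
    have := abs_div_sub_ediv_le_two (by norm_num) hx
    convert this using 3
    · simp only [barPoint]
      push_cast
      ring
    · rfl

theorem norm_barPoint_le {g : ℤ × ℤ × ℤ × ℤ} (hg : g ∈ barTable) : ‖barPoint g‖ ≤ 1.001 := by
  obtain ⟨-, -, h⟩ := barTable_bounds g hg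
  have h1 : ‖toComplex (barApprox g)‖ ≤ 100000000 := by
    have h2 : ‖toComplex (barApprox g)‖ ^ 2 ≤ 100000000 ^ 2 := by
      rw [norm_toComplex_sq]
      norm_num at h ⊢
      exact_mod_cast h
    exact (pow_le_pow_iff_left₀ (norm_nonneg _) (by norm_num) two_ne_zero).1 h2
  have := (abs_le.1 (near_barPoint hg).abs_norm_sub_le).2
  linarith

/-- The entry of `barTable` with number `k`. -/
def barEntry (k : ℕ) : ℤ × ℤ × ℤ × ℤ := barTable.getD k (0, 0, 0, 0)

theorem barEdges_eq : ∀ e ∈ barEdges,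
    (fun a b c d : ℤ => a * a + 5 * (b * b) + 3 * (c * c) + 15 * (d * d) = 21984 ∧
      2 * (a * b) + 6 * (c * d) = -8928)
    ((barEntry e.2).1 - (barEntry e.1).1) ((barEntry e.2).2.1 - (barEntry e.1).2.1)
    ((barEntry e.2).2.2.1 - (barEntry e.1).2.2.1)
    ((barEntry e.2).2.2.2 - (barEntry e.1).2.2.2) := by
  decide +kernel

theorem norm_barPoint_sub {e : ℕ × ℕ} (he : e ∈ barEdges) :
    barLen * ‖barPoint (barEntry e.2) - barPoint (barEntry e.1)‖ = 1 := by
  obtain ⟨h1, h2⟩ := barEdges_eq e he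
  generalize barEntry e.1 = g at *
  generalize barEntry e.2 = g' at *
  have h1' := congrArg (Int.cast : ℤ → ℝ) h1
  have h2' := congrArg (Int.cast : ℤ → ℝ) h2
  push_cast at h1' h2'
  have h3 : √3 * √3 = (3 : ℝ) := Real.mul_self_sqrt (by norm_num)
  have h5 : √5 * √5 = (5 : ℝ) := Real.mul_self_sqrt (by norm_num)
  refine (pow_eq_one_iff_of_nonneg (mul_nonneg barLen_pos.le (norm_nonneg _)) two_ne_zero).1 ?_
  have key : ‖barPoint g' - barPoint g‖ ^ 2 = (21984 - 8928 * √5) / 69696 := by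
    rw [Complex.sq_norm, Complex.normSq_apply]
    simp only [barPoint, Complex.sub_re, Complex.sub_im]
    generalize √3 = x at *
    generalize √5 = y at *
    generalize hB : (g'.2.1 : ℝ) - g.2.1 = B at *
    generalize hA : (g'.1 : ℝ) - g.1 = A at *
    generalize hC : (g'.2.2.1 : ℝ) - g.2.2.1 = C at *
    generalize hE : (g'.2.2.2 : ℝ) - g.2.2.2 = E at *
    have e1 : ((g'.1 : ℝ) + y * g'.2.1) / 264 - (g.1 + y * g.2.1) / 264 = (A + y * B) / 264 := by
      rw [← hA, ← hB]; ring
    have e2 : (x * (g'.2.2.1 : ℝ) + x * y * g'.2.2.2) / 264 -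
        (x * g.2.2.1 + x * y * g.2.2.2) / 264 = x * (C + y * E) / 264 := by
      rw [← hC, ← hE]; ring
    rw [e1, e2]
    linear_combination (1 / 69696) * h1' + (y / 69696) * h2' + ((C + y * E) ^ 2 / 69696) * h3 +
      ((B * B + 3 * E * E) / 69696) * h5
  rw [mul_pow, key, barLen_sq]
  linear_combination (- 8928 * 279 / (38 * 69696)) * h5

/-! ### Apexes -/

/-- The ratio of height and base of an isosceles triangle with base `y` and legs `barLen`. -/
noncomputable def apexRatio (y : ℝ) : ℝ := √(barLen ^ 2 / y ^ 2 - 1 / 4)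

/-- The apex of an isosceles triangle with legs `barLen` over the base `P`, `Q`. -/
noncomputable def apexPoint (P Q : ℂ) : ℂ := P + (Q - P) * ⟨1 / 2, apexRatio ‖Q - P‖⟩

theorem norm_mk_apexRatio {s y : ℝ} (hs : s ^ 2 = 1 / 4) (hy : 0 < y)
    (h : 0 ≤ barLen ^ 2 / y ^ 2 - 1 / 4) : y * ‖(⟨s, apexRatio y⟩ : ℂ)‖ = barLen := by
  refine (pow_left_inj₀ (mul_nonneg hy.le (norm_nonneg _)) barLen_pos.le two_ne_zero).1 ?_
  rw [mul_pow, Complex.sq_norm, Complex.normSq_apply]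
  simp only [apexRatio]
  rw [Real.mul_self_sqrt h]
  field_simp
  linear_combination 4 * y ^ 2 * hs

theorem norm_apexPoint_sub {P Q : ℂ} (hy : 0 < ‖Q - P‖)
    (h : 0 ≤ barLen ^ 2 / ‖Q - P‖ ^ 2 - 1 / 4) :
    ‖apexPoint P Q - P‖ = barLen ∧ ‖Q - apexPoint P Q‖ = barLen := by
  have e : Q - apexPoint P Q = -((Q - P) * ⟨-1 / 2, apexRatio ‖Q - P‖⟩) := by
    have : (⟨1 / 2, apexRatio ‖Q - P‖⟩ : ℂ) = ⟨-1 / 2, apexRatio ‖Q - P‖⟩ + 1 := by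
      apply Complex.ext <;> norm_num
    rw [apexPoint, this]
    ring
  rw [e, norm_neg, apexPoint, add_sub_cancel_left, norm_mul, norm_mul]
  exact ⟨norm_mk_apexRatio (by norm_num) hy h, norm_mk_apexRatio (by norm_num) hy h⟩

namespace Design

variable {D : Design}

theorem apexPoint_of_near {P Q : ℂ} {p q : ℤ × ℤ} {T : ℤ} (hP : Near 210 P p) (hQ : Near 210 Q q)
    (hl : 50000000000000000 ≤ sqNorm (sub p q)) (hg : sqNorm (sub p q) ≤ 1380000000000000000)
    (hT : 10000 ≤ T)
    (h₁ : ((T - 10000) * (T - 10000) + 2500000000000000) * (sqNorm (sub p q) + 1200000000000) ≤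
      Fixed.barLength * Fixed.barLength * 10000000000000000)
    (h₂ : (Fixed.barLength + 1) * (Fixed.barLength + 1) * 10000000000000000 ≤
      ((T + 10000) * (T + 10000) + 2500000000000000) * (sqNorm (sub p q) - 1200000000000)) :
    Near 125000 (apexPoint P Q) (interp p q (50000000, T)) ∧
      ‖apexPoint P Q - P‖ = barLen ∧ ‖Q - apexPoint P Q‖ = barLen := by
  have hd := (hP.sub hQ).abs_norm_sub_le
  have hG := norm_toComplex_sq (p := sub p q)
  generalize sqNorm (sub p q) = G at *
  have hr0 := norm_nonneg (toComplex (sub p q))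
  generalize ‖toComplex (sub p q)‖ = r at *
  rw [norm_sub_rev] at hd
  have hl' : (50000000000000000 : ℝ) ≤ G := by exact_mod_cast hl
  have hg' : (G : ℝ) ≤ 1380000000000000000 := by exact_mod_cast hg
  have hT' : (10000 : ℝ) ≤ T := by exact_mod_cast hT
  have h₁' : (((T : ℝ) - 10000) * (T - 10000) + 2500000000000000) * (G + 1200000000000) ≤
      Fixed.barLength * Fixed.barLength * 10000000000000000 := by exact_mod_cast h₁
  have h₂' : ((Fixed.barLength : ℝ) + 1) * (Fixed.barLength + 1) * 10000000000000000 ≤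
      (((T : ℝ) + 10000) * (T + 10000) + 2500000000000000) * (G - 1200000000000) := by
    exact_mod_cast h₂
  obtain ⟨hb1, hb2⟩ := barLen_bounds
  have hbl : (Fixed.barLength : ℝ) = 587336307 := by norm_num [Fixed.barLength]
  rw [hbl] at h₁' h₂'
  have hy0 := norm_nonneg (Q - P)
  have hA : apexPoint P Q = P + (Q - P) * ⟨1 / 2, apexRatio ‖Q - P‖⟩ := rfl
  have hN := fun h h' => norm_apexPoint_sub (P := P) (Q := Q) h h'
  have hM := fun h h' => norm_mk_apexRatio (s := 1 / 2) (y := ‖Q - P‖) (by norm_num) h h'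
  generalize hy : ‖Q - P‖ = y at *
  rw [abs_le] at hd
  have hrl : (220000000 : ℝ) ≤ r := by nlinarith
  have hru : r ≤ 1180000000 := by nlinarith
  have hyl : (2.19 : ℝ) ≤ y := by linarith
  have hyu : y ≤ 11.801 := by linarith
  have hGu : 10000000000000000 * y ^ 2 ≤ G + 1200000000000 := by nlinarith
  have hGl : G - 1200000000000 ≤ 10000000000000000 * y ^ 2 := by nlinarith
  have hy2 : 0 < y ^ 2 := by positivity
  set X := barLen ^ 2 / y ^ 2 - 1 / 4 with hX
  have hXy : X * y ^ 2 = barLen ^ 2 - y ^ 2 / 4 := by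
    rw [hX]; field_simp
  have kl : (5.87336307 : ℝ) ^ 2 ≤ barLen ^ 2 := pow_le_pow_left₀ (by norm_num) hb1 2
  have ku : barLen ^ 2 ≤ (5.87336308 : ℝ) ^ 2 := pow_le_pow_left₀ barLen_pos.le hb2 2
  have hu : ((T : ℝ) - 10000) ^ 2 ≤ 10000000000000000 * X := by
    refine le_of_mul_le_mul_right ?_ hy2
    have := mul_le_mul_of_nonneg_left hGu (add_nonneg (mul_self_nonneg ((T : ℝ) - 10000))
      (by norm_num : (0 : ℝ) ≤ 2500000000000000))
    rw [mul_assoc _ X, hXy]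
    linarith
  have hv : 10000000000000000 * X ≤ ((T : ℝ) + 10000) ^ 2 := by
    refine le_of_mul_le_mul_right ?_ hy2
    have := mul_le_mul_of_nonneg_left hGl (add_nonneg (mul_self_nonneg ((T : ℝ) + 10000))
      (by norm_num : (0 : ℝ) ≤ 2500000000000000))
    rw [mul_assoc _ X, hXy]
    linarith
  have hX0 : 0 ≤ X := by linarith [sq_nonneg ((T : ℝ) - 10000)]
  have hy1 : 0 < y := by linarith
  refine ⟨?_, hN hy1 hX0⟩
  have hs := Real.sq_sqrt hX0
  have hs0 := Real.sqrt_nonneg X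
  have hR : apexRatio y = √X := rfl
  have hnear : Near 10000 (⟨1 / 2, apexRatio y⟩ : ℂ) (50000000, T) := by
    refine (near_of_re_im (ε := 0) (δ := 10000) (by norm_num) ?_).mono (by norm_num)
    rw [hR]
    simp only [abs_le]
    generalize √X = s at *
    have hs' : 10000000000000000 * X = (100000000 * s) ^ 2 := by rw [← hs]; ring
    rw [hs'] at hu hv
    have := (pow_le_pow_iff_left₀ (by linarith) (by positivity) two_ne_zero).1 hu
    have := (pow_le_pow_iff_left₀ (by positivity) (by linarith) two_ne_zero).1 hv
    constructor <;> linarith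
  have hm := hM hy1 hX0
  have hm3 : ‖(⟨1 / 2, apexRatio y⟩ : ℂ)‖ ≤ 3 :=
    le_of_mul_le_mul_left (by rw [hm]; linarith) hy1
  rw [hA]
  refine (hP.interp hQ hnear).mono ?_
  rw [hy]
  linarith

end Design

/-! ### Correctness of the crossing test -/

/-- `(x, y)` are shifted fixed-point coordinates of `z`. -/
def NearShifted (z : ℂ) (x y : ℕ) : Prop :=
  |100000000 * z.re + 4000000000 - x| ≤ 390000 ∧ |100000000 * z.im + 4000000000 - y| ≤ 390000

theorem disjoint_segment_of_linear (p q : ℝ) {a b c d : ℂ} {k : ℝ}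
    (ha : p * a.re + q * a.im ≤ k) (hb : p * b.re + q * b.im ≤ k)
    (hc : k < p * c.re + q * c.im) (hd : k < p * d.re + q * d.im) :
    Disjoint (segment ℝ a b) (segment ℝ c d) := by
  have hf : IsLinearMap ℝ fun z : ℂ => p * z.re + q * z.im :=
    ⟨fun x y => by simp; ring, fun t x => by simp; ring⟩
  refine Set.disjoint_of_subset ((convex_halfSpace_le hf k).segment_subset ha hb)
    ((convex_halfSpace_gt hf k).segment_subset hc hd) ?_
  exact Set.disjoint_left.2 fun z (h₁ : _ ≤ k) (h₂ : k < _) => absurd h₁ h₂.not_ge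

theorem abs_re_sub_le_one {a b : ℂ} (h : dist a b = 1) : |a.re - b.re| ≤ 1 ∧ |a.im - b.im| ≤ 1 := by
  rw [dist_eq_norm] at h
  exact ⟨(Complex.abs_re_le_norm (a - b)).trans h.le, (Complex.abs_im_le_norm (a - b)).trans h.le⟩

namespace EdgeRecord

/-- The record belongs to a unit edge of the drawing with vertices `pos`. -/
structure Describes (r : EdgeRecord) (pos : ℕ → ℂ) : Prop where
  near₁ : NearShifted (pos r.i) r.x₁ r.y₁
  near₂ : NearShifted (pos r.j) r.x₂ r.y₂
  sx_eq : r.sx = r.x₁ + r.x₂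
  sy_eq : r.sy = r.y₁ + r.y₂
  dist_eq : dist (pos r.i) (pos r.j) = 1

/-- The pair of vertices of the edge. -/
def ends (r : EdgeRecord) : ℕ × ℕ := (r.i, r.j)

variable {r s : EdgeRecord} {pos : ℕ → ℂ}

theorem Describes.ne (h : r.Describes pos) : r.i ≠ r.j := fun e => by
  have := h.dist_eq
  simp [e] at this

theorem Describes.compatible_of_sx (hr : r.Describes pos) (hs : s.Describes pos)
    (h : r.sx + 201600000 ≤ s.sx) : EdgesCompatible pos r.ends s.ends := by
  apply edgesCompatible_of_disjoint
  have h1 := hr.near₁.1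
  have h2 := hr.near₂.1
  have h3 := hs.near₁.1
  have h4 := hs.near₂.1
  have h5 := (abs_re_sub_le_one hr.dist_eq).1
  have h6 := (abs_re_sub_le_one hs.dist_eq).1
  rw [hr.sx_eq, hs.sx_eq] at h
  have h' : (r.x₁ + r.x₂ + 201600000 : ℝ) ≤ s.x₁ + s.x₂ := by exact_mod_cast h
  rw [abs_le] at *
  refine disjoint_segment_of_linear 1 0
    (k := ((pos r.i).re + (pos r.j).re) / 2 + 1 / 2) ?_ ?_ ?_ ?_ <;>
  · simp only [ends]; linarith

theorem Describes.compatible_of_sy (hr : r.Describes pos) (hs : s.Describes pos)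
    (h : r.sy + 201600000 ≤ s.sy) : EdgesCompatible pos r.ends s.ends := by
  apply edgesCompatible_of_disjoint
  have h1 := hr.near₁.2
  have h2 := hr.near₂.2
  have h3 := hs.near₁.2
  have h4 := hs.near₂.2
  have h5 := (abs_re_sub_le_one hr.dist_eq).2
  have h6 := (abs_re_sub_le_one hs.dist_eq).2
  rw [hr.sy_eq, hs.sy_eq] at h
  have h' : (r.y₁ + r.y₂ + 201600000 : ℝ) ≤ s.y₁ + s.y₂ := by exact_mod_cast h
  rw [abs_le] at *
  refine disjoint_segment_of_linear 0 1
    (k := ((pos r.i).im + (pos r.j).im) / 2 + 1 / 2) ?_ ?_ ?_ ?_ <;>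
  · simp only [ends]; linarith

theorem Describes.compatible_of_adjacent (hr : r.Describes pos) (hs : s.Describes pos)
    (h : r.adjacent s = true) : EdgesCompatible pos r.ends s.ends := by
  have h1 := hr.ne
  have h2 := hs.ne
  simp only [adjacent, Bool.or_eq_true, Bool.and_eq_true, Nat.beq_eq, Bool.not_eq_true',
    ← Bool.not_eq_true] at h
  simp only [EdgesCompatible, ends]
  refine ⟨by omega, by omega, fun k1 k2 k3 k4 => ?_⟩
  omega

theorem abs_mul_sub_mul_le {v w x y δ : ℝ} (hx : |x| ≤ δ) (hy : |y| ≤ δ) :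
    |v * y - w * x| ≤ (|v| + |w|) * δ := by
  calc |v * y - w * x| ≤ |v * y| + |w * x| := abs_sub _ _
    _ ≤ (|v| + |w|) * δ := by
      rw [abs_mul, abs_mul, add_mul]
      exact add_le_add (mul_le_mul_of_nonneg_left hy (abs_nonneg _))
        (mul_le_mul_of_nonneg_left hx (abs_nonneg _))

theorem Describes.abs_cross_sub_le (hr : r.Describes pos) {z : ℂ} {x y : ℕ}
    (hz : NearShifted z x y) :
    |((r.x₂ : ℝ) - r.x₁) * (100000000 * z.im + 4000000000 - y) -
      ((r.y₂ : ℝ) - r.y₁) * (100000000 * z.re + 4000000000 - x)| ≤ 79000000000000 := by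
  refine (abs_mul_sub_mul_le hz.1 hz.2).trans ?_
  have hv : |(r.x₂ : ℝ) - r.x₁| ≤ 100780000 := by
    have h1 := hr.near₁.1
    have h2 := hr.near₂.1
    have h3 := (abs_re_sub_le_one hr.dist_eq).1
    rw [abs_le] at *
    constructor <;> linarith
  have hw : |(r.y₂ : ℝ) - r.y₁| ≤ 100780000 := by
    have h1 := hr.near₁.2
    have h2 := hr.near₂.2
    have h3 := (abs_re_sub_le_one hr.dist_eq).2
    rw [abs_le] at *
    constructor <;> linarith
  linarith

theorem Describes.compatible_of_oneSide (hr : r.Describes pos) (hs : s.Describes pos)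
    (h : r.oneSide s = true) : EdgesCompatible pos r.ends s.ends := by
  apply edgesCompatible_of_disjoint
  have h1 := abs_le.1 (hr.abs_cross_sub_le hr.near₁)
  have h2 := abs_le.1 (hr.abs_cross_sub_le hr.near₂)
  have h3 := abs_le.1 (hr.abs_cross_sub_le hs.near₁)
  have h4 := abs_le.1 (hr.abs_cross_sub_le hs.near₂)
  simp only [oneSide, left, right, Bool.or_eq_true, Bool.and_eq_true, Nat.ble_eq] at h
  simp only [ends]
  rcases h with ⟨k1, k2⟩ | ⟨k1, k2⟩
  · have k1' : (r.x₂ * r.y₁ + r.x₁ * s.y₁ + r.y₂ * s.x₁ + 200000000000000 : ℝ) ≤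
      r.x₂ * s.y₁ + r.y₂ * r.x₁ + r.y₁ * s.x₁ := by exact_mod_cast k1
    have k2' : (r.x₂ * r.y₁ + r.x₁ * s.y₂ + r.y₂ * s.x₂ + 200000000000000 : ℝ) ≤
      r.x₂ * s.y₂ + r.y₂ * r.x₁ + r.y₁ * s.x₂ := by exact_mod_cast k2
    refine disjoint_segment_of_linear (-((r.y₂ : ℝ) - r.y₁)) ((r.x₂ : ℝ) - r.x₁)
      (k := (((r.x₂ : ℝ) - r.x₁) * r.y₁ - ((r.y₂ : ℝ) - r.y₁) * r.x₁ + 79000000000000 -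
        4000000000 * (((r.x₂ : ℝ) - r.x₁) - ((r.y₂ : ℝ) - r.y₁))) / 100000000) ?_ ?_ ?_ ?_ <;>
    linarith
  · have k1' : (r.x₂ * s.y₁ + r.y₂ * r.x₁ + r.y₁ * s.x₁ + 200000000000000 : ℝ) ≤
      r.x₂ * r.y₁ + r.x₁ * s.y₁ + r.y₂ * s.x₁ := by exact_mod_cast k1
    have k2' : (r.x₂ * s.y₂ + r.y₂ * r.x₁ + r.y₁ * s.x₂ + 200000000000000 : ℝ) ≤
      r.x₂ * r.y₁ + r.x₁ * s.y₂ + r.y₂ * s.x₂ := by exact_mod_cast k2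
    refine disjoint_segment_of_linear ((r.y₂ : ℝ) - r.y₁) (-((r.x₂ : ℝ) - r.x₁))
      (k := (-(((r.x₂ : ℝ) - r.x₁) * r.y₁ - ((r.y₂ : ℝ) - r.y₁) * r.x₁) + 79000000000000 +
        4000000000 * (((r.x₂ : ℝ) - r.x₁) - ((r.y₂ : ℝ) - r.y₁))) / 100000000) ?_ ?_ ?_ ?_ <;>
    linarith

theorem Describes.compatible (hr : r.Describes pos) (hs : s.Describes pos)
    (h : r.compatible s = true) : EdgesCompatible pos r.ends s.ends := by
  simp only [EdgeRecord.compatible, Bool.or_eq_true, Nat.ble_eq] at h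
  rcases h with (((h | h) | h) | h) | h
  · exact hr.compatible_of_sy hs h
  · exact (hs.compatible_of_sy hr h).symm
  · exact hr.compatible_of_adjacent hs h
  · exact hr.compatible_of_oneSide hs h
  · exact (hs.compatible_of_oneSide hr h).symm

theorem pairwise_of_sorted : ∀ {l : List EdgeRecord}, sorted l = true →
    l.Pairwise fun r s => r.sx ≤ s.sx := by
  intro l h
  rw [← List.isChain_iff_pairwise (R := fun r s : EdgeRecord => r.sx ≤ s.sx)]
  induction l with
  | nil => exact List.isChain_nil
  | cons r l ih =>
    cases l with
    | nil => exact List.isChain_singleton _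
    | cons s l =>
      simp only [sorted, Bool.and_eq_true, Nat.ble_eq] at h
      exact List.isChain_cons_cons.2 ⟨h.1, ih h.2⟩

theorem compatible_of_scan (hr : r.Describes pos) : ∀ {l : List EdgeRecord},
    (∀ s ∈ l, s.Describes pos) → (l.Pairwise fun r s => r.sx ≤ s.sx) →
    scan r (r.sx + 201600000) l = true → ∀ s ∈ l, EdgesCompatible pos r.ends s.ends := by
  intro l
  induction l with
  | nil => simp
  | cons t l ih =>
    intro hl hsort h s hs
    rw [List.pairwise_cons] at hsort
    rw [scan, cond_eq_ite] at h
    split_ifs at h with hlim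
    · rw [Nat.ble_eq] at hlim
      refine hr.compatible_of_sx (hl s hs) (hlim.trans ?_)
      rcases List.mem_cons.1 hs with rfl | hs
      · exact le_rfl
      · exact hsort.1 s hs
    · rw [Bool.and_eq_true] at h
      rcases List.mem_cons.1 hs with rfl | hs'
      · exact hr.compatible (hl s hs) h.1
      · exact ih (fun s hs => hl s (List.mem_cons_of_mem _ hs)) hsort.2 h.2 s hs'

theorem pairwise_of_allCompatible : ∀ {l : List EdgeRecord}, (∀ s ∈ l, s.Describes pos) →
    (l.Pairwise fun r s => r.sx ≤ s.sx) → allCompatible l = true →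
    l.Pairwise fun r s => EdgesCompatible pos r.ends s.ends := by
  intro l
  induction l with
  | nil => simp
  | cons r l ih =>
    intro hl hsort h
    rw [allCompatible, Bool.and_eq_true] at h
    have hl' : ∀ s ∈ l, s.Describes pos := fun s hs => hl s (List.mem_cons_of_mem _ hs)
    rw [List.pairwise_cons] at hsort ⊢
    exact ⟨compatible_of_scan (hl r (List.mem_cons_self ..)) hl' hsort.2 h.1,
      ih hl' hsort.2 h.2⟩

end EdgeRecord

/-! ### Correctness of the sorting -/

section MergeSort

variable {α : Type*} (key : α → ℕ)

theorem mergeFuel_perm : ∀ (n : ℕ) (l m : List α), (mergeFuel key n l m).Perm (l ++ m)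
  | 0, l, m => List.Perm.refl _
  | _ + 1, [], m => List.Perm.refl _
  | _ + 1, a :: l, [] => by simp [mergeFuel]
  | n + 1, a :: l, b :: m => by
    rw [mergeFuel, cond_eq_ite]
    split_ifs
    · exact (mergeFuel_perm n l (b :: m)).cons a
    · exact ((mergeFuel_perm n (a :: l) m).cons b).trans List.perm_middle.symm

theorem mergePairs_perm : ∀ L : List (List α), (mergePairs key L).flatten.Perm L.flatten
  | [] => List.Perm.refl _
  | [l] => List.Perm.refl _
  | l :: m :: r => by
    simp only [mergePairs, List.flatten_cons, ← List.append_assoc]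
    exact (mergeFuel_perm key 1000 l m).append (mergePairs_perm r)

theorem mergeAll_perm : ∀ (n : ℕ) (L : List (List α)), (mergeAll key n L).Perm L.flatten
  | 0, _ => List.Perm.refl _
  | n + 1, L => (mergeAll_perm n _).trans (mergePairs_perm key L)

theorem sortByKey_perm (l : List α) : (sortByKey key l).Perm l := by
  have := mergeAll_perm key 10 (l.map fun a => [a])
  rwa [← List.flatMap_def, List.flatMap_singleton'] at this

end MergeSort

/-! ### The combinators are function application -/

theorem withNat_eq (n : ℕ) (k : ℕ → Bool) : withNat n k = k n := by
  cases n <;> rfl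

theorem withList_eq {α : Type*} (l : List α) (k : List α → Bool) : withList l k = k l := by
  induction l generalizing k with
  | nil => rfl
  | cons a l ih => exact ih fun t => k (a :: t)

theorem withRecord_eq (r : EdgeRecord) (k : EdgeRecord → Bool) : withRecord r k = k r := by
  simp only [withRecord, withNat_eq]

theorem withRecords_eq (l : List EdgeRecord) (k : List EdgeRecord → Bool) :
    withRecords l k = k l := by
  induction l generalizing k with
  | nil => rfl
  | cons a l ih =>
    exact (withRecord_eq a fun a => withRecords l fun t => k (a :: t)).trans
      (ih fun t => k (a :: t))

/-- Shift a pair of integers by `4 * 10 ^ 9` into the natural numbers. -/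
def shift (p : ℤ × ℤ) : ℕ × ℕ := ((p.1 + 4000000000).toNat, (p.2 + 4000000000).toNat)

theorem withShifted_eq_true {x : ℤ} {k : ℕ → Bool} (h : withShifted x k = true) :
    0 ≤ x + 4000000000 ∧ k (x + 4000000000).toNat = true := by
  unfold withShifted at h
  split at h
  · rename_i n hn
    rw [withNat_eq] at h
    rw [hn]
    exact ⟨Int.natCast_nonneg n, h⟩
  · exact absurd h Bool.false_ne_true

theorem withPoints_eq_true {l : List (ℤ × ℤ)} {k : List (ℕ × ℕ) → Bool}
    (h : withPoints l k = true) :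
    (∀ p ∈ l, 0 ≤ p.1 + 4000000000 ∧ 0 ≤ p.2 + 4000000000) ∧ k (l.map shift) = true := by
  induction l generalizing k with
  | nil => exact ⟨by simp, h⟩
  | cons p l ih =>
    obtain ⟨h1, h⟩ := withShifted_eq_true h
    obtain ⟨h2, h⟩ := withShifted_eq_true h
    obtain ⟨h3, h⟩ := ih h
    exact ⟨List.forall_mem_cons.2 ⟨⟨h1, h2⟩, h3⟩, h⟩

theorem Fixed.Near.nearShifted {z : ℂ} {p : ℤ × ℤ} {ε : ℝ} (h : Fixed.Near ε z p)
    (hε : ε ≤ 390000) (h1 : 0 ≤ p.1 + 4000000000) (h2 : 0 ≤ p.2 + 4000000000) :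
    NearShifted z (shift p).1 (shift p).2 := by
  obtain ⟨hre, him⟩ := h.re_im
  have e1 : (((p.1 + 4000000000).toNat : ℕ) : ℝ) = p.1 + 4000000000 := by
    exact_mod_cast congrArg (Int.cast : ℤ → ℝ) (Int.toNat_of_nonneg h1)
  have e2 : (((p.2 + 4000000000).toNat : ℕ) : ℝ) = p.2 + 4000000000 := by
    exact_mod_cast congrArg (Int.cast : ℤ → ℝ) (Int.toNat_of_nonneg h2)
  simp only [NearShifted, shift, e1, e2, add_sub_add_right_eq_sub]
  exact ⟨hre.trans hε, him.trans hε⟩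

/-! ### Counting -/

namespace Design

theorem isFourfold_spec : ∀ {m n : ℕ} {l : List ℕ}, isFourfold m n l = true →
    (∀ x ∈ l, m ≤ x ∧ x < m + n) ∧ ∀ i, m ≤ i → i < m + n → l.count i = 4
  | _, 0, [], _ => ⟨by simp, by omega⟩
  | m, n + 1, a :: b :: c :: d :: l, h => by
    simp only [isFourfold, Bool.and_eq_true, Nat.beq_eq] at h
    obtain ⟨⟨⟨⟨ha, hb⟩, hc⟩, hd⟩, h⟩ := h
    subst a b c d
    obtain ⟨h1, h2⟩ := isFourfold_spec h
    constructor
    · intro x hx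
      simp only [List.mem_cons] at hx
      rcases hx with rfl | rfl | rfl | rfl | hx
      any_goals omega
      have := h1 x hx
      omega
    · intro i hi hi'
      rcases hi.eq_or_lt with rfl | hlt
      · have : l.count m = 0 := List.count_eq_zero.2 fun hm => by
          have := h1 _ hm
          omega
        simp [this]
      · rw [List.count_cons_of_ne (by omega), List.count_cons_of_ne (by omega),
          List.count_cons_of_ne (by omega), List.count_cons_of_ne (by omega)]
        exact h2 i (by omega) (by omega)

theorem incidences_ends {R : List EdgeRecord} (h : ∀ r ∈ R, r.i ≠ r.j) (x : ℕ) :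
    incidences (R.map EdgeRecord.ends) x = (endpoints R).count x := by
  induction R with
  | nil => rfl
  | cons r R ih =>
    rw [List.forall_mem_cons] at h
    have hr := h.1
    have e : endpoints (r :: R) = [r.i, r.j] ++ endpoints R := rfl
    rw [e, List.count_append, ← ih h.2, List.map_cons, ← List.singleton_append,
      incidences_append]
    congr 1
    by_cases h1 : r.i = x <;> by_cases h2 : r.j = x <;>
      simp_all [incidences, EdgeRecord.ends]

variable {D : Design} {pos : ℕ → ℂ}

theorem isFourRegularDrawing_of_checkRecords {R : List EdgeRecord}
    (hR : ∀ r ∈ R, r.Describes pos) (h : D.checkRecords R = true) :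
    IsFourRegularDrawing D.order pos (R.map EdgeRecord.ends) := by
  simp only [checkRecords, withList_eq, Bool.and_eq_true] at h
  obtain ⟨h4, hsort, hall⟩ := h
  have hperm := sortByKey_perm id (endpoints R)
  obtain ⟨hlt, hcount⟩ := isFourfold_spec h4
  have hlt' : ∀ x ∈ endpoints R, x < D.order := fun x hx => by
    simpa using (hlt x (hperm.mem_iff.2 hx)).2
  refine ⟨?_, ?_, ?_, ?_⟩
  · intro e he
    obtain ⟨r, hr, rfl⟩ := List.mem_map.1 he
    exact ⟨hlt' _ (List.mem_flatMap.2 ⟨r, hr, by simp [EdgeRecord.ends]⟩),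
      hlt' _ (List.mem_flatMap.2 ⟨r, hr, by simp [EdgeRecord.ends]⟩)⟩
  · intro e he
    obtain ⟨r, hr, rfl⟩ := List.mem_map.1 he
    exact (hR r hr).dist_eq
  · have hp := sortByKey_perm EdgeRecord.sx R
    rw [List.pairwise_map, ← hp.pairwise_iff fun h => EdgesCompatible.symm h]
    exact EdgeRecord.pairwise_of_allCompatible (fun s hs => hR s (hp.mem_iff.1 hs))
      (EdgeRecord.pairwise_of_sorted hsort) hall
  · intro i hi
    rw [incidences_ends fun r hr => (hR r hr).ne, ← hperm.count_eq]
    exact hcount i (Nat.zero_le _) (by omega)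

end Design

/-! ### The drawing of a design -/

namespace Design

variable (D : Design)

/-- The position of a lattice point or apex. -/
noncomputable def hub (n : ℕ) : ℂ :=
  if n < D.lattice.length then D.linear (D.vector n)
  else (fun z : ℕ × ℕ × ℤ => apexPoint (D.linear (D.vector z.1)) (D.linear (D.vector z.2.1)))
    (D.apexes.getD (n - D.lattice.length) (0, 0, 0))

/-- The position of a point of the bar `b`. -/
noncomputable def barPosition (b : ℕ × ℕ) (k : ℕ) : ℂ :=
  D.hub b.1 + (D.hub b.2 - D.hub b.1) * barPoint (barEntry k)

/-- The position of a vertex. -/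
noncomputable def position (n : ℕ) : ℂ :=
  if n < D.numHubs then D.hub n
  else D.barPosition (D.allBars.getD ((n - D.numHubs) / 20) (0, 0)) ((n - D.numHubs) % 20 + 2)

/-- The part of the check that does not concern the crossings. -/
structure IsAdmissible : Prop where
  parameters : D.checkParameters = true
  lattice : ∀ v ∈ D.lattice, smallVector v = true
  core : ∀ e ∈ D.core, D.checkEdge e = true
  bars : ∀ e ∈ D.bars, D.checkBar e = true
  apexes : ∀ z ∈ D.apexes, D.checkApex z = true

variable {D}

theorem getD_map_latticeApprox {n : ℕ} (hn : n < D.lattice.length) :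
    (D.lattice.map D.latticeApprox).getD n (0, 0) = D.latticeApprox (D.vector n) := by
  simp [vector, hn]

theorem hub_of_lt {n : ℕ} (hn : n < D.lattice.length) : D.hub n = D.linear (D.vector n) :=
  if_pos hn

theorem hub_add {k : ℕ} : D.hub (D.lattice.length + k) =
    apexPoint (D.linear (D.vector (D.apexes.getD k (0, 0, 0)).1))
      (D.linear (D.vector (D.apexes.getD k (0, 0, 0)).2.1)) := by
  simp [hub]

namespace IsAdmissible

theorem near_vector (h : D.IsAdmissible) {n : ℕ} (hn : n < D.lattice.length) :
    Near 210 (D.linear (D.vector n)) (D.latticeApprox (D.vector n)) := by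
  refine near_linear h.parameters (h.lattice _ ?_)
  rw [vector, List.getD_eq_getElem _ _ hn]
  exact List.getElem_mem hn

theorem apex (h : D.IsAdmissible) {z : ℕ × ℕ × ℤ} (hz : z ∈ D.apexes) :
    (z.1 < D.lattice.length ∧ z.2.1 < D.lattice.length) ∧
    Near 125000 (apexPoint (D.linear (D.vector z.1)) (D.linear (D.vector z.2.1)))
      (apexApprox (D.lattice.map D.latticeApprox) z) ∧
    ‖apexPoint (D.linear (D.vector z.1)) (D.linear (D.vector z.2.1)) -
      D.linear (D.vector z.1)‖ = barLen ∧
    ‖D.linear (D.vector z.2.1) -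
      apexPoint (D.linear (D.vector z.1)) (D.linear (D.vector z.2.1))‖ = barLen := by
  have hc := h.apexes z hz
  simp only [checkApex, intLe, Bool.and_eq_true, decide_eq_true_eq, Nat.blt_eq] at hc
  obtain ⟨⟨h1, h2⟩, ⟨⟨⟨hl, hg⟩, hT⟩, h₁⟩, h₂⟩ := hc
  rw [apexApprox, getD_map_latticeApprox h1, getD_map_latticeApprox h2]
  exact ⟨⟨h1, h2⟩, apexPoint_of_near (h.near_vector h1) (h.near_vector h2) hl hg hT h₁ h₂⟩

theorem near_hub (h : D.IsAdmissible) {n : ℕ} (hn : n < D.numHubs) :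
    Near 125000 (D.hub n) (D.hubsApprox.getD n (0, 0)) := by
  rcases lt_or_ge n D.lattice.length with hlt | hge
  · rw [hub_of_lt hlt, hubsApprox, List.getD_append _ _ _ _ (by simpa using hlt),
      getD_map_latticeApprox hlt]
    exact (h.near_vector hlt).mono (by norm_num)
  · obtain ⟨k, rfl⟩ := Nat.exists_eq_add_of_le hge
    have hk : k < D.apexes.length := by
      rw [numHubs] at hn
      omega
    rw [hub_add, hubsApprox, List.getD_append_right _ _ _ _ (by simp)]
    simp only [List.length_map, Nat.add_sub_cancel_left, List.getD_eq_getElem, hk,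
      List.getElem_map]
    exact (h.apex (List.getElem_mem hk)).2.1

end IsAdmissible

theorem mem_apexBars {b : ℕ × ℕ} : ∀ {m : ℕ} {l : List (ℕ × ℕ × ℤ)}, b ∈ apexBars m l →
    ∃ k < l.length, b = ((l.getD k (0, 0, 0)).1, m + k) ∨ b = (m + k, (l.getD k (0, 0, 0)).2.1)
  | _, [], h => absurd h List.not_mem_nil
  | m, z :: l, h => by
    rw [apexBars, List.mem_cons, List.mem_cons] at h
    rcases h with rfl | rfl | h
    · exact ⟨0, by simp, by simp⟩
    · exact ⟨0, by simp, by simp⟩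
    · obtain ⟨k, hk, hb⟩ := mem_apexBars h
      refine ⟨k + 1, by simpa using hk, ?_⟩
      rwa [List.getD_cons_succ, ← add_assoc, add_right_comm]

namespace IsAdmissible

theorem bar (h : D.IsAdmissible) {b : ℕ × ℕ} (hb : b ∈ D.allBars) :
    (b.1 < D.numHubs ∧ b.2 < D.numHubs) ∧ ‖D.hub b.2 - D.hub b.1‖ = barLen := by
  rcases List.mem_append.1 hb with hb | hb
  · have hc := h.bars b hb
    simp only [checkBar, Bool.and_eq_true, Nat.blt_eq] at hc
    obtain ⟨⟨h1, h2⟩, h3⟩ := hc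
    rw [hub_of_lt h1, hub_of_lt h2, numHubs]
    exact ⟨by omega, norm_linear_sub_of_isBarStep h3⟩
  · obtain ⟨k, hk, hb⟩ := mem_apexBars hb
    have hz := h.apex (z := D.apexes.getD k (0, 0, 0)) (by
      rw [List.getD_eq_getElem _ _ hk]
      exact List.getElem_mem hk)
    rw [numHubs]
    rcases hb with rfl | rfl
    · simp only
      rw [hub_add, hub_of_lt hz.1.1]
      exact ⟨by omega, hz.2.2.1⟩
    · simp only
      rw [hub_add, hub_of_lt hz.1.2]
      exact ⟨by omega, hz.2.2.2⟩

theorem dist_core (h : D.IsAdmissible) {e : ℕ × ℕ} (he : e ∈ D.core) :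
    (e.1 < D.numHubs ∧ e.2 < D.numHubs) ∧ dist (D.hub e.1) (D.hub e.2) = 1 := by
  have hc := h.core e he
  simp only [checkEdge, Bool.and_eq_true, Nat.blt_eq] at hc
  obtain ⟨⟨h1, h2⟩, h3⟩ := hc
  rw [hub_of_lt h1, hub_of_lt h2, numHubs, dist_eq_norm, norm_sub_rev]
  exact ⟨by omega, norm_linear_sub_of_isUnitStep h.parameters h3⟩

theorem near_barPosition (h : D.IsAdmissible) {b : ℕ × ℕ} (hb : b ∈ D.allBars) {k : ℕ}
    (hk : k < 22) : Near 390000 (D.barPosition b k)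
      (interp (D.hubsApprox.getD b.1 (0, 0)) (D.hubsApprox.getD b.2 (0, 0))
        (barApprox (barEntry k))) := by
  obtain ⟨⟨h1, h2⟩, h3⟩ := h.bar hb
  have hmem : barEntry k ∈ barTable := by
    rw [barEntry, List.getD_eq_getElem _ _ (show k < barTable.length from hk)]
    exact List.getElem_mem _
  refine ((h.near_hub h1).interp (h.near_hub h2) (near_barPoint hmem)).mono ?_
  rw [h3]
  linarith [norm_barPoint_le hmem, barLen_bounds.2]

end IsAdmissible

theorem getD_map_shift {l : List (ℤ × ℤ)} {n : ℕ} (hn : n < l.length) :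
    (l.map shift).getD n (0, 0) = shift (l.getD n (0, 0)) := by
  simp [hn]

theorem length_hubsApprox : D.hubsApprox.length = D.numHubs := by
  simp [hubsApprox, numHubs]

theorem nearShifted_getD {l : List (ℤ × ℤ)} {n : ℕ} {z : ℂ} (hn : n < l.length)
    (hl : ∀ p ∈ l, 0 ≤ p.1 + 4000000000 ∧ 0 ≤ p.2 + 4000000000)
    (hz : Near 390000 z (l.getD n (0, 0))) :
    NearShifted z ((l.map shift).getD n (0, 0)).1 ((l.map shift).getD n (0, 0)).2 := by
  rw [getD_map_shift hn]
  have hm : l.getD n (0, 0) ∈ l := by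
    rw [List.getD_eq_getElem _ _ hn]
    exact List.getElem_mem hn
  exact hz.nearShifted le_rfl (hl _ hm).1 (hl _ hm).2

theorem position_of_lt {n : ℕ} (hn : n < D.numHubs) : D.position n = D.hub n :=
  if_pos hn

theorem describes_of_mem_coreRecords (h : D.IsAdmissible)
    (hA : ∀ p ∈ D.hubsApprox, 0 ≤ p.1 + 4000000000 ∧ 0 ≤ p.2 + 4000000000) {r : EdgeRecord}
    (hr : r ∈ D.coreRecords (D.hubsApprox.map shift)) : r.Describes D.position := by
  obtain ⟨e, he, rfl⟩ := List.mem_map.1 hr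
  obtain ⟨⟨h1, h2⟩, h3⟩ := h.dist_core he
  rw [← position_of_lt h1, ← position_of_lt h2] at h3
  refine ⟨?_, ?_, rfl, rfl, h3⟩
  · refine nearShifted_getD (length_hubsApprox.symm ▸ h1) hA ?_
    simp only [edgeRecord, position_of_lt h1]
    exact (h.near_hub h1).mono (by norm_num)
  · refine nearShifted_getD (length_hubsApprox.symm ▸ h2) hA ?_
    simp only [edgeRecord, position_of_lt h2]
    exact (h.near_hub h2).mono (by norm_num)

theorem barPosition_zero (b : ℕ × ℕ) : D.barPosition b 0 = D.hub b.1 := by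
  have : barPoint (barEntry 0) = 0 := by
    apply Complex.ext <;> simp [barPoint, barEntry, barTable]
  simp [barPosition, this]

theorem barPosition_one (b : ℕ × ℕ) : D.barPosition b 1 = D.hub b.2 := by
  have : barPoint (barEntry 1) = 1 := by
    apply Complex.ext <;> simp [barPoint, barEntry, barTable]
  simp [barPosition, this]

theorem position_barLabel (h : D.IsAdmissible) {b : ℕ × ℕ} {l l' : List (ℕ × ℕ)}
    (hb : D.allBars = l ++ b :: l') {k : ℕ} (hk : k < 22) :
    D.position (barLabel (D.numHubs + 20 * l.length) b k) = D.barPosition b k := by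
  obtain ⟨⟨h1, h2⟩, -⟩ := h.bar (b := b) (by simp [hb])
  match k with
  | 0 => rw [barPosition_zero]; exact position_of_lt h1
  | 1 => rw [barPosition_one]; exact position_of_lt h2
  | k + 2 =>
    have e : D.numHubs + 20 * l.length + k - D.numHubs = 20 * l.length + k := by omega
    rw [barLabel, position, if_neg (by omega), e, show (20 * l.length + k) / 20 = l.length by omega,
      show (20 * l.length + k) % 20 = k by omega, hb, List.getD_append_right _ _ _ _ le_rfl]
    simp

theorem barEdges_lt : ∀ e ∈ barEdges, e.1 < 22 ∧ e.2 < 22 := by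
  decide +kernel

theorem describes_of_mem_barRecords (h : D.IsAdmissible) {b : ℕ × ℕ} {l l' : List (ℕ × ℕ)}
    (hb : D.allBars = l ++ b :: l')
    (hB : ∀ p ∈ D.barPointsApprox b, 0 ≤ p.1 + 4000000000 ∧ 0 ≤ p.2 + 4000000000) {r : EdgeRecord}
    (hr : r ∈ barRecords (D.numHubs + 20 * l.length) b ((D.barPointsApprox b).map shift)) :
    r.Describes D.position := by
  have hmem : b ∈ D.allBars := by simp [hb]
  obtain ⟨e, he, rfl⟩ := List.mem_map.1 hr
  obtain ⟨h1, h2⟩ := barEdges_lt e he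
  have hnear {k : ℕ} (hk : k < 22) :
      NearShifted (D.position (barLabel (D.numHubs + 20 * l.length) b k))
        (((D.barPointsApprox b).map shift).getD k (0, 0)).1
        (((D.barPointsApprox b).map shift).getD k (0, 0)).2 := by
    have hk' : k < barTable.length := hk
    refine nearShifted_getD (by simpa [barPointsApprox] using hk') hB ?_
    rw [position_barLabel h hb hk]
    have := h.near_barPosition hmem hk
    rw [barEntry, List.getD_eq_getElem _ _ hk'] at this
    simpa [barPointsApprox, List.getD_eq_getElem, hk'] using this
  refine ⟨hnear h1, hnear h2, rfl, rfl, ?_⟩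
  simp only [edgeRecord]
  rw [position_barLabel h hb h1, position_barLabel h hb h2, dist_comm, dist_eq_norm]
  rw [barPosition, barPosition, add_sub_add_left_eq_sub, ← mul_sub, norm_mul, (h.bar hmem).2,
    norm_barPoint_sub he]

theorem exists_records_of_withBarRecords (h : D.IsAdmissible) {k : List EdgeRecord → Bool} :
    ∀ {l' l : List (ℕ × ℕ)} {acc : List EdgeRecord}, D.allBars = l ++ l' →
    (∀ r ∈ acc, r.Describes D.position) →
    D.withBarRecords l' (D.numHubs + 20 * l.length) acc k = true →
    ∃ R : List EdgeRecord, (∀ r ∈ R, r.Describes D.position) ∧ k R = true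
  | [], _, acc, _, hacc, hk => ⟨acc, hacc, hk⟩
  | b :: l', l, acc, hb, hacc, hk => by
    obtain ⟨hB, hk⟩ := withPoints_eq_true hk
    rw [show D.numHubs + 20 * l.length + 20 = D.numHubs + 20 * (l ++ [b]).length by simp; ring]
      at hk
    refine exists_records_of_withBarRecords h (by simp [hb]) ?_ hk
    intro r hr
    rcases List.mem_append.1 hr with hr | hr
    · exact describes_of_mem_barRecords h hb hB hr
    · exact hacc r hr

/-- Designs that pass the check yield `4`-regular drawings. -/
theorem exists_drawing (h : D.check = true) :
    ∃ (pos : ℕ → ℂ) (L : List (ℕ × ℕ)), IsFourRegularDrawing D.order pos L := by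
  simp only [check, Bool.and_eq_true, List.all_eq_true] at h
  obtain ⟨⟨⟨⟨⟨h1, h2⟩, h3⟩, h4⟩, h5⟩, h⟩ := h
  have hD : D.IsAdmissible := ⟨h1, h2, h3, h4, h5⟩
  obtain ⟨hA, h⟩ := withPoints_eq_true h
  obtain ⟨R, hR, h⟩ := exists_records_of_withBarRecords hD (l := []) rfl
    (fun r hr => describes_of_mem_coreRecords hD hA hr) h
  rw [withRecords_eq] at h
  exact ⟨D.position, _, isFourRegularDrawing_of_checkRecords hR h⟩

end Design

/-! ### The families -/

/-- Edges of a strip of `l` vertices numbered from `m`, consecutive triples forming triangles. -/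
def stripEdges (m l : ℕ) : List (ℕ × ℕ) :=
  ((List.range (l - 1)).map fun k => (m + k, m + k + 1)) ++
    (List.range (l - 2)).map fun k => (m + k, m + k + 2)

/-- Two strips above each other, joined by two sticks and by chains of bars on both sides: two bars
on the right, and two (or three, if `long`) on the left. -/
def stack (long : Bool) (a b : ℕ) (q r s t t' : ℤ) : Design where
  H := 1
  c := 0
  root := 200000000
  lattice := ((List.range (2 * a + 1)).map fun k => ⟨k / 2, k % 2, 0, 0, 0⟩) ++
    ((List.range (2 * b + 1)).map fun k => ⟨q + k / 2 + k % 2, r - k % 2, s, 0, 0⟩) ++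
    bif long then [⟨0, 0, 0, 0, -1⟩] else []
  apexes := [(bif long then 2 * a + 2 * b + 2 else 0, 2 * a + 1, t), (2 * a + 2 * b + 1, 2 * a, t')]
  core := (1, 2 * a + 2) :: (2 * a - 1, 2 * a + 2 * b) ::
    (stripEdges 0 (2 * a + 1) ++ stripEdges (2 * a + 1) (2 * b + 1))
  bars := bif long then [(0, 2 * a + 2 * b + 2)] else []

/-- Two equal strips, with two bars on either side; it has `84 + 4 * a` vertices. -/
def equalStack (a : ℕ) : Design := stack false a a (-1) 2 1 209084682 209084682

/-- Two unequal strips, with two bars on either side; it has `86 + 4 * a` vertices. -/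
def unequalStack (a : ℕ) : Design := stack false a (a + 1) (-2) 3 0 216288147 216288147

/-- Two equal strips, with three bars on the left; it has `105 + 4 * a` vertices. -/
def longEqualStack (a : ℕ) : Design := stack true a a (-1) 2 1 75638349 209084682

/-- Two unequal strips, with three bars on the left; it has `107 + 4 * a` vertices. -/
def longUnequalStack (a : ℕ) : Design := stack true a (a + 1) (-2) 3 0 84756909 216288147

/-- Three strips, of lengths `j`, `l` and `j`, forming an arch closed by a stick on top. With `side`
the pairs of bars are attached on the left and on the right, otherwise below and on top. -/
def arch (l j H c root : ℕ) (side : Bool) (t t' : ℤ) : Design where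
  H := H
  c := c
  root := root
  lattice :=
    ((List.range (2 * l + 1)).map fun k => ⟨H * (k / 2 + k % 2), -(H * (k % 2)), 0, 0, 0⟩) ++
    ((List.range (2 * j + 1)).map fun k => ⟨0, 0, (k + 1) / 2, (k + 1) % 2, 0⟩) ++
    ((List.range (2 * j + 1)).map fun k =>
      ⟨H * l - c * ((k + 1) / 2 + (k + 1) % 2), c * ((k + 1) % 2), (k + 1) / 2 + (k + 1) % 2,
        -((k + 1) % 2), 0⟩) ++
    [⟨H, -H, 0, 1, 0⟩, ⟨H * l - c, c - H, 1, -1, 0⟩]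
  apexes := bif side then
      [(2 * l + 4 * j + 3, 2 * l + 1 + 2 * j, t), (2 * l + 4 * j + 2, 2 * l + 4 * j + 4, t')]
    else [(2 * l + 4 * j + 4, 2 * l + 4 * j + 3, t), (2 * l + 1 + 2 * j, 2 * l + 4 * j + 2, t')]
  core := [(2 * l + 2 * j, 2 * l + 4 * j + 1), (0, 2 * l + 1), (0, 2 * l + 2),
      (2 * l, 2 * l + 2 * j + 2), (2 * l, 2 * l + 2 * j + 3), (2 * l + 4 * j + 3, 2 * l + 1),
      (2 * l + 4 * j + 3, 1), (2 * l + 4 * j + 4, 2 * l + 2 * j + 2),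
      (2 * l + 4 * j + 4, 2 * l - 1)] ++
    stripEdges 0 (2 * l + 1) ++ stripEdges (2 * l + 1) (2 * j + 1) ++
    stripEdges (2 * l + 2 * j + 2) (2 * j + 1)
  bars := []

/-- Three bars forming an equilateral triangle. -/
def ring : Design where
  H := 1
  c := 0
  root := 200000000
  lattice := [⟨0, 0, 0, 0, 0⟩, ⟨0, 0, 0, 0, 1⟩]
  apexes := [(0, 1, 86602540)]
  core := []
  bars := [(1, 0)]

theorem ring_check : ring.check = true := by decide +kernel

/-- Seven arches, whose orders are the odd numbers from `97` to `109`. -/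
def archDesigns : List Design :=
  [arch 1 2 1 0 200000000 true 195591717 195591717, arch 1 3 1 0 200000000 true 142129315 142129315,
    arch 1 4 1 0 200000000 true 109163296 109163296, arch 1 5 1 0 200000000 true 86329160 86329160,
    arch 2 2 2 1 387298334 false 236774154 236774154,
    arch 2 3 3 1 591607978 false 225656325 225656325,
    arch 2 4 4 1 793725393 false 220879217 220879217]

theorem archDesigns_check : ∀ D ∈ archDesigns, D.check = true := by
  simp only [archDesigns, List.forall_mem_cons]
  refine ⟨?_, ?_, ?_, ?_, ?_, ?_, ?_, List.forall_mem_nil _⟩ <;> decide +kernel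

theorem equalStack_check {a : ℕ} (ha : a < 15) : (equalStack (a + 4)).check = true := by
  interval_cases a <;> decide +kernel

theorem unequalStack_check {a : ℕ} (ha : a < 16) : (unequalStack (a + 3)).check = true := by
  interval_cases a <;> decide +kernel

theorem longEqualStack_check {a : ℕ} (ha : a < 12) : (longEqualStack (a + 2)).check = true := by
  interval_cases a <;> decide +kernel

theorem longUnequalStack_check {a : ℕ} (ha : a < 13) :
    (longUnequalStack (a + 1)).check = true := by
  interval_cases a <;> decide +kernel

/-- The designs for the orders from `97` to `159`. -/
def smallDesigns : List Design :=
  archDesigns ++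
  ((List.range 15).map fun a => equalStack (a + 4)) ++
  ((List.range 16).map fun a => unequalStack (a + 3)) ++
  ((List.range 12).map fun a => longEqualStack (a + 2)) ++
  (List.range 13).map fun a => longUnequalStack (a + 1)

theorem smallDesigns_orders :
    (List.range 63).all (fun k => (smallDesigns.map Design.order).contains (97 + k)) = true := by
  decide +kernel

theorem smallDesigns_check {D : Design} (hD : D ∈ smallDesigns) : D.check = true := by
  simp only [smallDesigns, List.mem_append, List.mem_map, List.mem_range] at hD
  rcases hD with (((hD | ⟨a, ha, rfl⟩) | ⟨a, ha, rfl⟩) | ⟨a, ha, rfl⟩) | ⟨a, ha, rfl⟩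
  · exact archDesigns_check D hD
  · exact equalStack_check ha
  · exact unequalStack_check ha
  · exact longEqualStack_check ha
  · exact longUnequalStack_check ha

/-! ### All orders -/

theorem exists_drawing_of_ge {n : ℕ} (hn : 97 ≤ n) :
    ∃ (pos : ℕ → ℂ) (L : List (ℕ × ℕ)), IsFourRegularDrawing n pos L := by
  induction n using Nat.strong_induction_on with
  | _ n ih =>
    rcases lt_or_ge n 160 with hlt | hge
    · have h := List.all_eq_true.1 smallDesigns_orders (n - 97) (by simp; omega)
      rw [List.contains_iff_mem, Nat.add_sub_cancel' hn] at h
      obtain ⟨D, hD, rfl⟩ := List.mem_map.1 h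
      exact Design.exists_drawing (smallDesigns_check hD)
    · obtain ⟨pos, L, h⟩ := ih (n - 63) (by omega) (by omega)
      obtain ⟨pos', L', h'⟩ := Design.exists_drawing ring_check
      have := h.exists_union h'
      rwa [show ring.order = 63 from rfl, Nat.sub_add_cancel (by omega)] at this

/-- For every natural number n ≥ 97 there exists a 4-regular matchstick graph
with exactly n vertices. -/
theorem exists_fourRegular_matchstick_of_ge_97 (n : ℕ) (hn : 97 ≤ n) :
    ∃ G : MatchstickGraph, G.IsFourRegular ∧ G.V.card = n := by
  obtain ⟨pos, L, h⟩ := exists_drawing_of_ge hn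
  have h' := h.map Complex.orthonormalBasisOneI.repr.toLinearIsometry
  obtain ⟨G, hG, hcard, -⟩ :=
    exists_matchstickGraph h'.lt h'.unit h'.compatible h'.incidences_eq
  exact ⟨G, hG, hcard⟩
end
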